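/- (Induction proposition, third kernel.) Let m ≥ 2, Δ > 1, 0 < α < 1/m, and let 0 < l ≤ m be an integer. There is a constant C, depending only on Δ, α, m and l, such that the following holds under the induction hypotheses. Set K(t,x) := ∑_{i=1}^{l} ∫_{ℝ^m} (∂^0_i ∂^1_i g)_{tD}(x + Jp) dp. Then |Λ(𝒯,J,K)((F_j)_{j∈𝒞})| ≤ C (∏_{h=1}^m max(d_h^{2α}, d_h^{−2})) |Q_𝒯| ∏_{j∈𝒞} M_α(F_j)(A_j𝒯). -/

import Mathlib

open MeasureTheory Matrix
open scoped ENNReal NNReal BigOperators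

noncomputable section

namespace SBL

/-- The set of corners of the `m`-dimensional cube: functions `{1,…,m} → {0,1}`. -/
abbrev Corner (m : ℕ) := Fin m → Fin 2

/-- Index type for `ℝ^{2m}`: coordinates `x^0_i` (left) and `x^1_i` (right). -/
abbrev Idx (m : ℕ) := Fin m ⊕ Fin m

/-- The coordinate of `ℝ^{2m}` selected by the corner `j` at position `i`. -/
def sel {m : ℕ} (j : Corner m) (i : Fin m) : Idx m :=
  if j i = 0 then Sum.inl i else Sum.inr i

/-- The projection `Π_j : ℝ^{2m} → ℝ^m`, `Π_j x = (x_1^{j(1)},…,x_m^{j(m)})`. -/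
def proj {m : ℕ} (j : Corner m) (x : Idx m → ℝ) : Fin m → ℝ := fun i => x (sel j i)

/-- The projection `Π_j` as an `m × 2m` matrix. -/
def projM {m : ℕ} (j : Corner m) : Matrix (Fin m) (Idx m) ℝ :=
  Matrix.of fun i k => if k = sel j i then 1 else 0

/-- `A_j := Π_j J`, the `m × m` matrix obtained by applying `Π_j` to (the columns of) a
`2m × m` matrix `J`, i.e. selecting rows of `J` according to the corner `j`. -/
def Amat {m : ℕ} (J : Matrix (Idx m) (Fin m) ℝ) (j : Corner m) : Matrix (Fin m) (Fin m) ℝ :=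
  Matrix.of fun i k => J (sel j i) k

/-- Euclidean norm on a finite pi type. -/
def en {ι : Type*} [Fintype ι] (x : ι → ℝ) : ℝ := Real.sqrt (∑ i, (x i) ^ 2)

/-- Operator norm of a matrix with respect to the Euclidean norms. -/
def opNorm {ι κ : Type*} [Fintype ι] [Fintype κ] [DecidableEq κ] (A : Matrix ι κ ℝ) : ℝ :=
  ‖LinearMap.toContinuousLinearMap (Matrix.toEuclideanLin A)‖

/-- `Δ`-regularity of a square matrix: `max(‖A‖, |det A|⁻¹) ≤ Δ` (in particular `det A ≠ 0`). -/
def IsReg {m : ℕ} (Δ : ℝ) (A : Matrix (Fin m) (Fin m) ℝ) : Prop :=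
  opNorm A ≤ Δ ∧ A.det ≠ 0 ∧ |A.det|⁻¹ ≤ Δ

/-- A Calderón–Zygmund kernel of order `n` in `ℝ^m`, given by its multiplier `K̂` on
`ℝ^m ∖ {0}`: it is `n` times continuously differentiable there and satisfies the symbol
estimates `‖D^k K̂(η)‖ ≤ |η|^{-k}` for all `k ≤ n`. -/
def IsCZ {m : ℕ} (n : ℕ) (Khat : (Fin m → ℝ) → ℂ) : Prop :=
  ContDiffOn ℝ n Khat {0}ᶜ ∧
  ∀ k : ℕ, k ≤ n → ∀ η : Fin m → ℝ, η ≠ 0 →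
    ‖iteratedFDerivWithin ℝ k Khat {0}ᶜ η‖ ≤ (en η) ^ (-(k : ℝ))

/-- Fourier transform of a (nice) function on `ℝ^{2m}`. -/
def fourierT {m : ℕ} (φ : (Idx m → ℝ) → ℝ) (ξ : Idx m → ℝ) : ℂ :=
  ∫ x : Idx m → ℝ, Complex.exp (-2 * Real.pi * Complex.I * (∑ k, x k * ξ k)) * (φ x : ℂ)

/-- The principal value `p.v. ∫_{ℝ^{2m}} (∏_j F_j(Π_j x)) K(Πx) dx`, defined as
`∫_{ℝ^m} φ̂(−Π^T η) K̂(η) dη` with `φ = ∏_j F_j ∘ Π_j`. -/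
def pv {m : ℕ} (P : Matrix (Fin m) (Idx m) ℝ) (Khat : (Fin m → ℝ) → ℂ)
    (F : Corner m → (Fin m → ℝ) → ℝ) : ℂ :=
  ∫ η : Fin m → ℝ, fourierT (fun x => ∏ j, F j (proj j x)) (-(P.transpose.mulVec η)) * Khat η

/-- Upper `m×m` block `J^0` of a `2m×m` matrix. -/
def Jb0 {m : ℕ} (J : Matrix (Idx m) (Fin m) ℝ) : Matrix (Fin m) (Fin m) ℝ :=
  J.submatrix Sum.inl id

/-- Lower `m×m` block `J^1` of a `2m×m` matrix. -/
def Jb1 {m : ℕ} (J : Matrix (Idx m) (Fin m) ℝ) : Matrix (Fin m) (Fin m) ℝ :=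
  J.submatrix Sum.inr id

/-- `Π^J := (I, −J^0 (J^1)⁻¹)`. -/
def PiJ {m : ℕ} (J : Matrix (Idx m) (Fin m) ℝ) : Matrix (Fin m) (Idx m) ℝ :=
  Matrix.fromCols 1 (-(Jb0 J * (Jb1 J)⁻¹))

/-- The dyadic cube with parameters `Q = (k, n)`: `∏_i [2^k n_i, 2^k (n_i+1))`. -/
def dC {m : ℕ} (Q : ℤ × (Fin m → ℤ)) : Set (Fin m → ℝ) :=
  {x | ∀ i, (2:ℝ)^Q.1 * (Q.2 i : ℝ) ≤ x i ∧ x i < (2:ℝ)^Q.1 * ((Q.2 i : ℝ) + 1)}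

/-- `Q*`: the cube with the same center as `Q` and three times the side length. -/
def dCstar {m : ℕ} (Q : ℤ × (Fin m → ℤ)) : Set (Fin m → ℝ) :=
  {x | ∀ i, (2:ℝ)^Q.1 * ((Q.2 i : ℝ) - 1) ≤ x i ∧ x i < (2:ℝ)^Q.1 * ((Q.2 i : ℝ) + 2)}

/-- A (1/2-)sparse collection of dyadic cubes. -/
def IsSparse {m : ℕ} (S : Set (ℤ × (Fin m → ℤ))) : Prop :=
  ∀ Q ∈ S,
    (∑' Q' : {q : ℤ × (Fin m → ℤ) // q ∈ S ∧ dC q ⊆ dC Q}, volume (dC Q'.val)) ≤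
      2 * volume (dC Q)

/-- The average `[F]_S := (|S|⁻¹ ∫_S |F|^{2^{m-1}})^{2^{1-m}}`. -/
def avg {m : ℕ} (S : Set (Fin m → ℝ)) (F : (Fin m → ℝ) → ℝ) : ℝ :=
  (((volume S).toReal)⁻¹ * ∫ x in S, |F x| ^ (2^(m-1) : ℕ)) ^ ((2:ℝ) ^ ((1:ℤ) - (m:ℤ)))

/-- The closed axis-parallel box `∏_i [a_i, b_i]`. -/
def box {m : ℕ} (a b : Fin m → ℝ) : Set (Fin m → ℝ) := {x | ∀ i, a i ≤ x i ∧ x i ≤ b i}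

/-- Reciprocal eccentricity `ε_R = (min_i |I_i|)/(max_i |I_i|)` of the box `∏_i [a_i,b_i]`. -/
def ecc {m : ℕ} (a b : Fin m → ℝ) : ℝ := (⨅ i, (b i - a i)) / (⨆ i, (b i - a i))

/-- Modified strong maximal function evaluated on a set `S`:
`sup { (ε_R^α)^{2^{1-m}} [F]_R : R ∈ ℛ, S ⊆ R }` (as an extended real). -/
def Mal {m : ℕ} (α : ℝ) (F : (Fin m → ℝ) → ℝ) (S : Set (Fin m → ℝ)) : ℝ≥0∞ :=
  ⨆ (a : Fin m → ℝ) (b : Fin m → ℝ) (_ : ∀ i, a i < b i) (_ : S ⊆ box a b),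
    ENNReal.ofReal ((ecc a b ^ α) ^ ((2:ℝ) ^ ((1:ℤ) - (m:ℤ))) * avg (box a b) F)

/-- `M_α(F)(A𝒯) := sup_{Q ∈ 𝒯} M_α(F)(AQ)`. -/
def MalTree {m : ℕ} (α : ℝ) (F : (Fin m → ℝ) → ℝ) (A : Matrix (Fin m) (Fin m) ℝ)
    (T : Set (ℤ × (Fin m → ℤ))) : ℝ≥0∞ :=
  ⨆ Q ∈ T, Mal α F (A.mulVec '' dC Q)

/-- A convex tree of dyadic cubes with top cube `Qt`. -/
def ConvexTree {m : ℕ} (T : Set (ℤ × (Fin m → ℤ))) (Qt : ℤ × (Fin m → ℤ)) : Prop :=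
  Qt ∈ T ∧ (∀ Q ∈ T, dC Q ⊆ dC Qt) ∧
  ∀ Q ∈ T, ∀ Q' : ℤ × (Fin m → ℤ), dC Q ⊆ dC Q' → dC Q' ⊆ dC Qt → Q' ∈ T

/-- The Gaussian `g(x) = e^{−π|x|²}` on `ℝ^{2m}`. -/
def gss {m : ℕ} (x : Idx m → ℝ) : ℝ := Real.exp (-Real.pi * ∑ k, (x k) ^ 2)

/-- The mixed partial derivative `∂^0_i ∂^1_i g`. -/
def ddg {m : ℕ} (i : Fin m) (x : Idx m → ℝ) : ℝ :=
  fderiv ℝ (fun y : Idx m → ℝ => fderiv ℝ gss y (Pi.single (Sum.inl i) (1:ℝ))) x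
    (Pi.single (Sum.inr i) (1:ℝ))

/-- Isotropic `L¹` dilation on `ℝ^{2m}`: `φ_t(x) = t^{-2m} φ(t⁻¹ x)`. -/
def dil {m : ℕ} (t : ℝ) (φ : (Idx m → ℝ) → ℝ) (x : Idx m → ℝ) : ℝ :=
  (t ^ (2*m))⁻¹ * φ (t⁻¹ • x)

/-- Matrix dilation: `φ_D(x) = (det D)⁻¹ φ(D⁻¹ x)`. -/
def dilM {m : ℕ} (D : Matrix (Idx m) (Idx m) ℝ) (φ : (Idx m → ℝ) → ℝ) (x : Idx m → ℝ) : ℝ :=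
  (D.det)⁻¹ * φ (D⁻¹.mulVec x)

/-- The region `Ω_𝒯 = ∪_{Q∈𝒯} Q × (ℓ(Q)/2, ℓ(Q))` in the upper half space. -/
def Omega {m : ℕ} (T : Set (ℤ × (Fin m → ℤ))) : Set ((Fin m → ℝ) × ℝ) :=
  ⋃ Q ∈ T, (dC Q) ×ˢ Set.Ioo ((2:ℝ)^Q.1 / 2) ((2:ℝ)^Q.1)

/-- The localized form `Λ_𝒯((F_j)_j)`. -/
def LambdaT {m : ℕ} (J : Matrix (Idx m) (Fin m) ℝ) (T : Set (ℤ × (Fin m → ℤ)))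
    (c : ℝ → ℂ) (u : Idx m → ℝ) (i : Fin m) (F : Corner m → (Fin m → ℝ) → ℝ) : ℂ :=
  ∫ z in Omega T, c z.2 * Complex.ofReal ((1 + en u ^ (4*m))⁻¹ * (z.2)⁻¹ *
    ∫ x : Idx m → ℝ, (∏ j, F j (proj j x)) * dil z.2 (ddg i) (x - J.mulVec z.1 + z.2 • u))

/-- `T_k := ∪ {Q ∈ 𝒯 : ℓ(Q) = 2^k}`. -/
def Tkset {m : ℕ} (T : Set (ℤ × (Fin m → ℤ))) (k : ℤ) : Set (Fin m → ℝ) :=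
  ⋃ Q ∈ {q ∈ T | q.1 = k}, dC Q

/-- The form `Λ̃_𝒯((F_j)_j)` with localization in the `x` variables. -/
def LambdaTilde {m : ℕ} (J : Matrix (Idx m) (Fin m) ℝ) (T : Set (ℤ × (Fin m → ℤ)))
    (c : ℝ → ℂ) (u : Idx m → ℝ) (i : Fin m) (F : Corner m → (Fin m → ℝ) → ℝ) : ℂ :=
  ∑' k : ℤ, ∫ t in Set.Ioc ((2:ℝ)^(k-1)) ((2:ℝ)^k),
    c t * Complex.ofReal ((1 + en u ^ (4*m))⁻¹ * t⁻¹ *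
      ∫ p : Fin m → ℝ, ∫ x : Idx m → ℝ,
        (∏ j, Set.indicator ((Amat J j).mulVec '' Tkset T k) (F j) (proj j x)) *
          dil t (ddg i) (x - J.mulVec p + t • u))

/-- The form `Λ(𝒯,J,K)((F_j)_j)` from the induction proposition. -/
def LambdaK {m : ℕ} (J : Matrix (Idx m) (Fin m) ℝ) (T : Set (ℤ × (Fin m → ℤ)))
    (K : ℝ → (Idx m → ℝ) → ℂ) (F : Corner m → (Fin m → ℝ) → ℝ) : ℂ :=
  ∑' k : ℤ, ∫ x : Idx m → ℝ,
    Complex.ofReal (∏ j, Set.indicator ((Amat J j).mulVec '' Tkset T k) (F j) (proj j x)) *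
      ∫ t in Set.Ioc ((2:ℝ)^(k-1)) ((2:ℝ)^k), K t x * (t : ℂ)⁻¹

/-- The reflected corner `i∗j`, differing from `j` exactly at position `i`. -/
def istar {m : ℕ} (i : Fin m) (j : Corner m) : Corner m :=
  fun k => if k = i then 1 - j i else j k

/-- The diagonal matrix `Θ̃` with entry 0 at positions `i ≤ l` and 1 at positions `i > l`
(1-based), i.e. 0 for `i < l` and 1 otherwise in 0-based indexing. -/
def Th {m : ℕ} (l : ℕ) : Matrix (Fin m) (Fin m) ℝ :=
  Matrix.diagonal fun i => if (i : ℕ) < l then 0 else 1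

/-- The block diagonal matrix `Θ = diag(Θ̃, Θ̃)`. -/
def ThB {m : ℕ} (l : ℕ) : Matrix (Idx m) (Idx m) ℝ :=
  Matrix.diagonal (Sum.elim (fun i : Fin m => if (i:ℕ) < l then (0:ℝ) else 1)
    (fun i : Fin m => if (i:ℕ) < l then (0:ℝ) else 1))

end SBL

namespace SBL

/-! ### Derivatives of the one-dimensional Gaussian -/

/-- The polynomial factor of the `n`-th derivative of `y ↦ exp (-π y²)`. -/
def hermP : ℕ → Polynomial ℝ
  | 0 => 1
  | n + 1 => Polynomial.derivative (hermP n) - Polynomial.C (2 * Real.pi) * Polynomial.X * hermP n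

/-- The `n`-th derivative of `y ↦ exp (-π y²)`. -/
def hn (n : ℕ) (y : ℝ) : ℝ := (hermP n).eval y * Real.exp (-Real.pi * y ^ 2)

lemma hn_zero (y : ℝ) : hn 0 y = Real.exp (-Real.pi * y ^ 2) := by simp [hn, hermP]

lemma hn_zero_pos (y : ℝ) : 0 < hn 0 y := by rw [hn_zero]; positivity

lemma hasDerivAt_hn (n : ℕ) (y : ℝ) : HasDerivAt (hn n) (hn (n + 1) y) y := by
  have h1 := (hermP n).hasDerivAt y
  have h2 : HasDerivAt (fun y : ℝ => Real.exp (-Real.pi * y ^ 2))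
      (Real.exp (-Real.pi * y ^ 2) * (-Real.pi * (2 * y))) y := by
    have := ((hasDerivAt_pow 2 y).const_mul (-Real.pi)).exp
    simpa using this
  refine (h1.mul h2).congr_deriv ?_
  simp only [hn, hermP, Polynomial.eval_sub, Polynomial.eval_mul, Polynomial.eval_C,
    Polynomial.eval_X]
  ring

@[fun_prop]
lemma continuous_hn (n : ℕ) : Continuous (hn n) := by unfold hn; fun_prop

lemma hermP_rec (n : ℕ) : hermP (n + 2) = - Polynomial.C (2 * Real.pi) *
    (Polynomial.X * hermP (n + 1) + ((n : Polynomial ℝ) + 1) * hermP n) := by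
  induction n with
  | zero => simp [hermP]; ring
  | succ n ih =>
    have : hermP (n + 1 + 2) = Polynomial.derivative (hermP (n + 2)) -
      Polynomial.C (2 * Real.pi) * Polynomial.X * hermP (n + 2) := rfl
    rw [this]
    conv_lhs => rw [ih]
    have h1 : Polynomial.derivative (hermP n) =
      hermP (n + 1) + Polynomial.C (2 * Real.pi) * Polynomial.X * hermP n := by
      simp [hermP]
    have h2 : Polynomial.derivative (hermP (n + 1)) =
      hermP (n + 2) + Polynomial.C (2 * Real.pi) * Polynomial.X * hermP (n + 1) := by
      simp [hermP]
    simp only [Polynomial.derivative_mul, Polynomial.derivative_add, Polynomial.derivative_neg,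
      Polynomial.derivative_C, Polynomial.derivative_X, Polynomial.derivative_natCast,
      Polynomial.derivative_one, h1, h2]
    rw [ih]
    push_cast
    ring

lemma hn_rec (n : ℕ) (y : ℝ) :
    hn (n + 2) y = -(2 * Real.pi) * (y * hn (n + 1) y + (n + 1) * hn n y) := by
  simp only [hn, hermP_rec n, Polynomial.eval_mul, Polynomial.eval_neg, Polynomial.eval_C,
    Polynomial.eval_add, Polynomial.eval_X, Polynomial.eval_natCast, Polynomial.eval_one]
  ring

lemma exists_poly_mul_exp_bound (P : Polynomial ℝ) :
    ∃ C : ℝ, 0 ≤ C ∧ ∀ y : ℝ, |P.eval y| * Real.exp (-(Real.pi / 2) * y ^ 2) ≤ C := by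
  induction P using Polynomial.induction_on' with
  | add p q hp hq =>
    obtain ⟨C, hC, h⟩ := hp
    obtain ⟨D, hD, h'⟩ := hq
    refine ⟨C + D, by positivity, fun y => ?_⟩
    rw [Polynomial.eval_add]
    calc _ ≤ (|p.eval y| + |q.eval y|) * Real.exp (-(Real.pi / 2) * y ^ 2) := by
          gcongr; exact abs_add_le _ _
      _ ≤ _ := by rw [add_mul]; exact add_le_add (h y) (h' y)
  | monomial n a =>
    refine ⟨|a| * (n.factorial * Real.exp 1), by positivity, fun y => ?_⟩
    rw [Polynomial.eval_monomial, abs_mul, mul_assoc, abs_pow]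
    refine mul_le_mul_of_nonneg_left ?_ (abs_nonneg a)
    have h1 := Real.pow_div_factorial_le_exp (x := |y|) (abs_nonneg y) n
    rw [div_le_iff₀ (by positivity)] at h1
    calc |y| ^ n * Real.exp (-(Real.pi / 2) * y ^ 2)
        ≤ (Real.exp |y| * n.factorial) * Real.exp (-(Real.pi / 2) * y ^ 2) := by gcongr
      _ = n.factorial * Real.exp (|y| + -(Real.pi / 2) * y ^ 2) := by rw [Real.exp_add]; ring
      _ ≤ _ := by
        gcongr
        have := Real.pi_gt_three
        have h2 : y ^ 2 = |y| ^ 2 := (sq_abs y).symm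
        nlinarith [sq_nonneg (|y| - 1), abs_nonneg y]

lemma exists_hn_bound (n : ℕ) :
    ∃ C : ℝ, 0 ≤ C ∧ ∀ y : ℝ, |hn n y| ≤ C * Real.exp (-(Real.pi / 2) * y ^ 2) := by
  obtain ⟨C, hC, h⟩ := exists_poly_mul_exp_bound (hermP n)
  refine ⟨C, hC, fun y => ?_⟩
  unfold hn
  rw [abs_mul, abs_of_pos (Real.exp_pos _)]
  have : Real.exp (-Real.pi * y ^ 2) =
      Real.exp (-(Real.pi / 2) * y ^ 2) * Real.exp (-(Real.pi / 2) * y ^ 2) := by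
    rw [← Real.exp_add]; ring_nf
  rw [this, ← mul_assoc]
  gcongr
  exact h y

/-- A constant with `|hn n y| ≤ hC n * exp (-π y² / 2)`. -/
def hC (n : ℕ) : ℝ := (exists_hn_bound n).choose

lemma hC_nonneg (n : ℕ) : 0 ≤ hC n := (exists_hn_bound n).choose_spec.1

lemma abs_hn_le (n : ℕ) (y : ℝ) : |hn n y| ≤ hC n * Real.exp (-(Real.pi / 2) * y ^ 2) :=
  (exists_hn_bound n).choose_spec.2 y

lemma abs_hn_le_const (n : ℕ) (y : ℝ) : |hn n y| ≤ hC n := by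
  refine (abs_hn_le n y).trans (mul_le_of_le_one_right (hC_nonneg n) ?_)
  rw [Real.exp_le_one_iff]
  have := Real.pi_pos
  nlinarith [sq_nonneg y]

lemma integrable_hn (n : ℕ) : Integrable (hn n) := by
  refine ((integrable_exp_neg_mul_sq (b := Real.pi / 2) (by positivity)).const_mul (hC n)).mono'
    (continuous_hn n).aestronglyMeasurable (Filter.Eventually.of_forall fun y => ?_)
  exact abs_hn_le n y

lemma integrable_hn_comp_mul (n : ℕ) {c : ℝ} (hc : c ≠ 0) : Integrable fun u => hn n (c * u) :=
  (integrable_hn n).comp_mul_left' hc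

/-! ### Convolution -/

/-- Convolution of two Gaussian derivatives at scale `1 / √2`. -/
def hconv (n l : ℕ) (y : ℝ) : ℝ := ∫ u : ℝ, hn n (√2 * u) * hn l (√2 * (y - u))

lemma integrable_hconv (n l : ℕ) (y : ℝ) :
    Integrable fun u : ℝ => hn n (√2 * u) * hn l (√2 * (y - u)) := by
  refine (integrable_hn_comp_mul n (c := √2) (by positivity)).mul_bdd (c := hC l)
    (by fun_prop) (Filter.Eventually.of_forall fun u => ?_)
  exact abs_hn_le_const l _

lemma hconv_zero_zero (y : ℝ) : hconv 0 0 y = 1 / 2 * hn 0 y := by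
  unfold hconv
  have h2 : (√2 : ℝ) ^ 2 = 2 := Real.sq_sqrt (by norm_num)
  have : ∀ u : ℝ, hn 0 (√2 * u) * hn 0 (√2 * (y - u)) =
      hn 0 y * Real.exp (-(4 * Real.pi) * (u - y / 2) ^ 2) := by
    intro u
    simp only [hn_zero, ← Real.exp_add]
    congr 1
    simp only [mul_pow, h2]
    ring
  simp_rw [this]
  rw [integral_const_mul, integral_sub_right_eq_self (fun u : ℝ =>
    Real.exp (-(4 * Real.pi) * u ^ 2)), integral_gaussian]
  have : Real.pi / (4 * Real.pi) = (1 / 2) ^ 2 := by field_simp; norm_num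
  rw [this, Real.sqrt_sq (by norm_num)]
  ring

lemma hconv_succ_left (n l : ℕ) (y : ℝ) : hconv (n + 1) l y = hconv n (l + 1) y := by
  have hd : ∀ u : ℝ, HasDerivAt (fun u : ℝ => hn n (√2 * u) * hn l (√2 * (y - u)))
      (√2 * (hn (n + 1) (√2 * u) * hn l (√2 * (y - u)))
        - √2 * (hn n (√2 * u) * hn (l + 1) (√2 * (y - u)))) u := by
    intro u
    have h1 : HasDerivAt (fun u : ℝ => hn n (√2 * u)) (hn (n + 1) (√2 * u) * √2) u := by
      exact ((hasDerivAt_hn n (√2 * u)).comp u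
        ((hasDerivAt_id u).const_mul (√2))).congr_deriv (by simp)
    have h2 : HasDerivAt (fun u : ℝ => hn l (√2 * (y - u)))
        (hn (l + 1) (√2 * (y - u)) * -√2) u := by
      refine ((hasDerivAt_hn l (√2 * (y - u))).comp u
        (((hasDerivAt_id u).const_sub y).const_mul (√2))).congr_deriv ?_
      ring
    refine (h1.mul h2).congr_deriv ?_
    ring
  have h0 := integral_eq_zero_of_hasDerivAt_of_integrable hd
    (((integrable_hconv (n + 1) l y).const_mul _).sub ((integrable_hconv n (l + 1) y).const_mul _))
    (integrable_hconv n l y)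
  rw [integral_sub ((integrable_hconv (n + 1) l y).const_mul _)
    ((integrable_hconv n (l + 1) y).const_mul _), integral_const_mul, integral_const_mul,
    ← mul_sub] at h0
  have := (mul_eq_zero.mp h0).resolve_left (by positivity)
  exact sub_eq_zero.mp this

lemma hasDerivAt_hconv (l : ℕ) (y : ℝ) :
    HasDerivAt (hconv 0 l) (√2 * hconv 0 (l + 1) y) y := by
  have := hasDerivAt_integral_of_dominated_loc_of_deriv_le (μ := volume) (𝕜 := ℝ)
    (F := fun y u : ℝ => hn 0 (√2 * u) * hn l (√2 * (y - u)))
    (F' := fun y u : ℝ => √2 * (hn 0 (√2 * u) * hn (l + 1) (√2 * (y - u))))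
    (x₀ := y) (s := Set.univ) (bound := fun u => √2 * (‖hn 0 (√2 * u)‖ * hC (l + 1)))
    Filter.univ_mem
    (Filter.Eventually.of_forall fun x => (integrable_hconv 0 l x).aestronglyMeasurable)
    (integrable_hconv 0 l y)
    ((integrable_hconv 0 (l + 1) y).const_mul _).aestronglyMeasurable
    (Filter.Eventually.of_forall fun u x _ => ?_)
    (((integrable_hn_comp_mul 0 (c := √2) (by positivity)).norm.mul_const _).const_mul _)
    (Filter.Eventually.of_forall fun u x _ => ?_)
  · simp only [hconv]
    rw [← integral_const_mul]
    exact this.2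
  · rw [norm_mul, norm_mul, Real.norm_of_nonneg (Real.sqrt_nonneg 2)]
    gcongr
    exact abs_hn_le_const _ _
  · have h2 := (hasDerivAt_hn l (√2 * (x - u))).comp x
        (((hasDerivAt_id x).sub_const u).const_mul (√2))
    refine (h2.const_mul (hn 0 (√2 * u))).congr_deriv ?_
    ring

lemma hconv_zero_left (l : ℕ) (y : ℝ) : hconv 0 l y = (√2)⁻¹ ^ l * (1 / 2) * hn l y := by
  induction l generalizing y with
  | zero => rw [hconv_zero_zero]; simp
  | succ l ih =>
    have h1 := hasDerivAt_hconv l y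
    have h2 : HasDerivAt (hconv 0 l) ((√2)⁻¹ ^ l * (1 / 2) * hn (l + 1) y) y := by
      rw [show hconv 0 l = fun y => (√2)⁻¹ ^ l * (1 / 2) * hn l y from funext ih]
      exact (hasDerivAt_hn l y).const_mul _
    have h3 := h1.unique h2
    have h4 : (√2 : ℝ) ≠ 0 := by positivity
    rw [pow_succ]
    field_simp at h3 ⊢
    linarith

lemma hconv_eq (n l : ℕ) (y : ℝ) : hconv n l y = (√2)⁻¹ ^ (n + l) * (1 / 2) * hn (n + l) y := by
  induction n generalizing l with
  | zero => rw [hconv_zero_left, zero_add]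
  | succ n ih => rw [hconv_succ_left, ih]; congr 2 <;> ring

/-- Each Gaussian derivative of positive order is a superposition of translates of the first. -/
lemma hn_succ_eq_conv (n : ℕ) (y : ℝ) : hn (n + 1) y =
    (2 * (√2) ^ (n + 1)) * ∫ u : ℝ, hn n (√2 * u) * hn 1 (√2 * (y - u)) := by
  have := hconv_eq n 1 y
  unfold hconv at this
  rw [this]
  have h4 : (√2 : ℝ) ^ (n + 1) ≠ 0 := by positivity
  rw [inv_pow]
  field_simp

/-! ### Scaling derivative -/

/-- Derivative of a dilated Gaussian derivative in the squared scale. -/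
lemma hasDerivAt_scaled_hn (n : ℕ) (y : ℝ) {w : ℝ} (hw : 0 < w) :
    HasDerivAt (fun w : ℝ => w⁻¹ ^ (n + 1) * hn n (y / w))
      ((2 * Real.pi)⁻¹ * (w * (w⁻¹ ^ (n + 3) * hn (n + 2) (y / w)))) w := by
  have h1 : HasDerivAt (fun w : ℝ => w⁻¹) (-(w ^ 2)⁻¹) w := hasDerivAt_inv hw.ne'
  have h2 : HasDerivAt (fun w : ℝ => hn n (y / w)) (hn (n + 1) (y / w) * (y * -(w ^ 2)⁻¹)) w := by
    have := (hasDerivAt_hn n (y / w)).comp w (h1.const_mul y)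
    exact this
  have h3 := (h1.pow (n + 1)).mul h2
  refine h3.congr_deriv ?_
  rw [hn_rec]
  have : Real.pi ≠ 0 := Real.pi_ne_zero
  simp only [Nat.add_sub_cancel, Pi.pow_apply]
  push_cast
  have e1 : w⁻¹ ^ (n + 3) = w⁻¹ ^ n * (w ^ 3)⁻¹ := by rw [pow_add, inv_pow w 3]
  have e2 : w⁻¹ ^ (n + 1) = w⁻¹ ^ n * w⁻¹ := pow_succ _ _
  rw [e1, e2]
  generalize w⁻¹ ^ n = z
  field_simp
  ring

/-! ### Finner's inequality -/

/-- The coordinate `x^c_h` of `ℝ^{2m}`. -/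
def slot {m : ℕ} (h : Fin m) (c : Fin 2) : Idx m := if c = 0 then Sum.inl h else Sum.inr h

lemma sel_eq_slot {m : ℕ} (j : Corner m) (h : Fin m) : sel j h = slot h (j h) := rfl

@[simp] lemma slot_zero {m : ℕ} (h : Fin m) : slot h 0 = Sum.inl h := rfl

@[simp] lemma slot_one {m : ℕ} (h : Fin m) : slot h 1 = Sum.inr h := rfl

lemma slot_inj {m : ℕ} {h h' : Fin m} {c c' : Fin 2} : slot h c = slot h' c' ↔ h = h' ∧ c = c' := by
  fin_cases c <;> fin_cases c' <;> simp [slot]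

lemma exists_slot {m : ℕ} (k : Idx m) : ∃ h c, k = slot h c := by
  rcases k with h | h
  · exact ⟨h, 0, rfl⟩
  · exact ⟨h, 1, rfl⟩

lemma sel_injective {m : ℕ} (j : Corner m) : Function.Injective (sel j) := by
  intro a b h
  simp only [sel_eq_slot, slot_inj] at h
  exact h.1

lemma slot_mem_image_sel {m : ℕ} (j : Corner m) (h : Fin m) (c : Fin 2) :
    slot h c ∈ Finset.univ.image (sel j) ↔ j h = c := by
  simp only [Finset.mem_image, Finset.mem_univ, true_and, sel_eq_slot, slot_inj]
  constructor
  · rintro ⟨a, rfl, h⟩; exact h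
  · intro h; exact ⟨_, rfl, h⟩

lemma card_corner_filter {m : ℕ} (h : Fin m) (c : Fin 2) :
    (Finset.univ.filter fun j : Corner m => j h = c).card = 2 ^ (m - 1) := by
  have : (Finset.univ.filter fun j : Corner m => j h = c) =
      Fintype.piFinset (fun i => if i = h then {c} else Finset.univ) := by
    ext j
    simp only [Finset.mem_filter, Finset.mem_univ, true_and, Fintype.mem_piFinset]
    constructor
    · intro hj i
      split_ifs with hi
      · subst hi; simp [hj]
      · simp
    · intro hj; simpa using hj h
  rw [this, Fintype.card_piFinset]
  have : ∀ i, (if i = h then {c} else (Finset.univ : Finset (Fin 2))).card =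
      if i = h then 1 else 2 := by
    intro i; split_ifs <;> simp
  simp only [this]
  rw [Finset.prod_ite]
  simp only [Finset.prod_const_one, Finset.prod_const, one_mul]
  congr 1
  rw [Finset.filter_ne' Finset.univ h, Finset.card_erase_of_mem (Finset.mem_univ _)]
  simp

lemma finner_lmarginal {δ ι : Type*} [Fintype δ] [DecidableEq δ] [Fintype ι]
    (f : ι → (δ → ℝ) → ℝ≥0∞) (hf : ∀ j, Measurable (f j)) (s : ι → Finset δ)
    (hs : ∀ j, DependsOn (f j) (s j)) (p : ℝ) (hp : 0 ≤ p)
    (hsum : ∀ k, ∑ j with k ∈ s j, p = 1) (t : Finset δ) (x : δ → ℝ) :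
    (∫⋯∫⁻_t, (fun x => ∏ j, f j x ^ p) ∂fun _ => volume) x ≤
      ∏ j, ((∫⋯∫⁻_(t ∩ s j), f j ∂fun _ => volume) x) ^ p := by
  induction t using Finset.induction generalizing x with
  | empty => simp
  | insert k t hk ih =>
    rw [lmarginal_insert _ (by fun_prop) hk]
    have hne : ∀ j, k ∉ s j → ∀ y,
        (∫⋯∫⁻_(t ∩ s j), f j ∂fun _ => volume) (Function.update x k y) =
        (∫⋯∫⁻_(t ∩ s j), f j ∂fun _ => volume) x := by
      intro j hj y
      rw [lmarginal_update_of_notMem (hf j) (by simp [hj])]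
      have : f j ∘ (Function.update · k y) = f j := by
        funext z
        refine hs j fun i hi => ?_
        refine Function.update_of_ne ?_ _ _
        rintro rfl
        exact hj hi
      rw [this]
    calc ∫⁻ y, (∫⋯∫⁻_t, (fun x => ∏ j, f j x ^ p) ∂fun _ => volume) (Function.update x k y)
        ≤ ∫⁻ y, ∏ j, ((∫⋯∫⁻_(t ∩ s j), f j ∂fun _ => volume) (Function.update x k y)) ^ p :=
          lintegral_mono fun y => ih _
      _ = ∫⁻ y, (∏ j with k ∈ s j,
            ((∫⋯∫⁻_(t ∩ s j), f j ∂fun _ => volume) (Function.update x k y)) ^ p) *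
          ∏ j with k ∉ s j, ((∫⋯∫⁻_(t ∩ s j), f j ∂fun _ => volume) x) ^ p := by
          refine lintegral_congr fun y => ?_
          rw [← Finset.prod_filter_mul_prod_filter_not Finset.univ (fun j => k ∈ s j)]
          congr 1
          refine Finset.prod_congr rfl fun j hj => ?_
          rw [hne j (Finset.mem_filter.mp hj).2]
      _ = (∫⁻ y, ∏ j with k ∈ s j,
            ((∫⋯∫⁻_(t ∩ s j), f j ∂fun _ => volume) (Function.update x k y)) ^ p) *
          ∏ j with k ∉ s j, ((∫⋯∫⁻_(t ∩ s j), f j ∂fun _ => volume) x) ^ p := by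
          rw [lintegral_mul_const]
          have : ∀ j, Measurable fun y =>
              (∫⋯∫⁻_(t ∩ s j), f j ∂fun _ => volume) (Function.update x k y) := fun j =>
            ((hf j).lmarginal (fun _ => volume)).comp (measurable_update x)
          fun_prop
      _ ≤ (∏ j with k ∈ s j, (∫⁻ y,
            (∫⋯∫⁻_(t ∩ s j), f j ∂fun _ => volume) (Function.update x k y)) ^ p) *
          ∏ j with k ∉ s j, ((∫⋯∫⁻_(t ∩ s j), f j ∂fun _ => volume) x) ^ p := by
          gcongr
          refine ENNReal.lintegral_prod_norm_pow_le _ (fun j _ => ?_) (hsum k) (fun _ _ => hp)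
          exact (((hf j).lmarginal (fun _ => volume)).comp (measurable_update x)).aemeasurable
      _ = _ := by
          rw [← Finset.prod_filter_mul_prod_filter_not Finset.univ (fun j => k ∈ s j)]
          congr 1
          · refine Finset.prod_congr rfl fun j hj => ?_
            rw [Finset.insert_inter_of_mem (Finset.mem_filter.mp hj).2,
              lmarginal_insert _ (hf j) (by simp [hk])]
          · refine Finset.prod_congr rfl fun j hj => ?_
            rw [Finset.insert_inter_of_notMem (Finset.mem_filter.mp hj).2]

lemma finner {m : ℕ} (u : Corner m → (Fin m → ℝ) → ℝ≥0∞)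
    (hu : ∀ j, Measurable (u j)) :
    ∫⁻ x : Idx m → ℝ, ∏ j, u j (proj j x) ≤
      ∏ j, (∫⁻ z, u j z ^ (2 ^ (m - 1) : ℕ)) ^ (((2 ^ (m - 1) : ℕ) : ℝ)⁻¹) := by
  have hproj : ∀ j : Corner m, Measurable (proj j) := fun j => by
    unfold proj; fun_prop
  have hN : ((2 ^ (m - 1) : ℕ) : ℝ) ≠ 0 := by positivity
  have key := finner_lmarginal (fun (j : Corner m) x => (u j (proj j x)) ^ (2 ^ (m - 1) : ℕ))
    (fun j => ((hu j).comp (hproj j)).pow_const _) (fun j => Finset.univ.image (sel j))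
    (fun j x y hxy => ?_) (((2 ^ (m - 1) : ℕ) : ℝ)⁻¹) (by positivity) (fun k => ?_)
    Finset.univ 0
  · rw [← lintegral_eq_lmarginal_univ] at key
    have e1 : ∀ a : ℝ≥0∞, (a ^ (2 ^ (m - 1) : ℕ)) ^ (((2 ^ (m - 1) : ℕ) : ℝ)⁻¹) = a := by
      intro a
      rw [← ENNReal.rpow_natCast, ← ENNReal.rpow_mul, mul_inv_cancel₀ hN, ENNReal.rpow_one]
    simp only [e1] at key
    refine key.trans (le_of_eq ?_)
    refine Finset.prod_congr rfl fun j _ => ?_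
    congr 1
    rw [Finset.univ_inter]
    have := lmarginal_image (μ := fun _ : Idx m => (volume : Measure ℝ)) (sel_injective j)
      Finset.univ (f := fun z => u j z ^ (2 ^ (m - 1) : ℕ)) ((hu j).pow_const _) 0
    refine Eq.trans this ?_
    rw [← lintegral_eq_lmarginal_univ]
    rfl
  · have : proj j x = proj j y := funext fun i => hxy _ (by simp)
    simp only [this]
  · obtain ⟨h, c, rfl⟩ := exists_slot k
    simp only [slot_mem_image_sel]
    rw [Finset.sum_const, card_corner_filter, nsmul_eq_mul, mul_inv_cancel₀ hN]

section Forms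

variable {m : ℕ}

/-! ### Dilated Gaussian derivatives on `ℝ^{2m}` -/

/-- The partial derivative of order `β` of the Gaussian on `ℝ^{2m}`, dilated by `w`. -/
def phi (w : Idx m → ℝ) (β : Idx m → ℕ) (x : Idx m → ℝ) : ℝ :=
  ∏ k, (w k)⁻¹ * hn (β k) (x k / w k)

@[fun_prop]
lemma continuous_phi (w : Idx m → ℝ) (β : Idx m → ℕ) : Continuous (phi w β) := by
  unfold phi
  refine continuous_finsetProd _ fun k _ => continuous_const.mul ?_
  exact (continuous_hn _).comp ((continuous_apply k).div_const _)

@[fun_prop]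
lemma measurable_phi (w : Idx m → ℝ) (β : Idx m → ℕ) : Measurable (phi w β) :=
  (continuous_phi w β).measurable

lemma phi_zero_pos {w : Idx m → ℝ} (hw : ∀ k, 0 < w k) (x : Idx m → ℝ) : 0 < phi w 0 x :=
  Finset.prod_pos fun k _ => mul_pos (inv_pos.mpr (hw k)) (hn_zero_pos _)

lemma integrable_hn_div (n : ℕ) {w : ℝ} (hw : 0 < w) :
    Integrable fun y : ℝ => w⁻¹ * hn n (y / w) := by
  have := (integrable_hn n).comp_div hw.ne'
  exact this.const_mul _

lemma integrable_phi {w : Idx m → ℝ} (hw : ∀ k, 0 < w k) (β : Idx m → ℕ) :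
    Integrable (phi w β) := by
  exact Integrable.fintype_prod (f := fun k y => (w k)⁻¹ * hn (β k) (y / w k))
    fun k => integrable_hn_div _ (hw k)

lemma integral_hn_zero : ∫ y, hn 0 y = 1 := by
  simp only [hn_zero]
  rw [integral_gaussian, div_self Real.pi_ne_zero, Real.sqrt_one]

lemma integral_phi_zero {w : Idx m → ℝ} (hw : ∀ k, 0 < w k) : ∫ x, phi w 0 x = 1 := by
  unfold phi
  rw [integral_fintype_prod_volume_eq_prod
    (fun k y => (w k)⁻¹ * hn ((0 : Idx m → ℕ) k) (y / w k))]
  refine Finset.prod_eq_one fun k _ => ?_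
  rw [integral_const_mul, Measure.integral_comp_div, Pi.zero_apply, integral_hn_zero,
    abs_of_pos (hw k), smul_eq_mul, mul_one, inv_mul_cancel₀ (hw k).ne']

lemma lintegral_phi_zero {w : Idx m → ℝ} (hw : ∀ k, 0 < w k) :
    ∫⁻ x, ENNReal.ofReal (phi w 0 x) = 1 := by
  rw [← ofReal_integral_eq_lintegral_ofReal (integrable_phi hw 0)
    (Filter.Eventually.of_forall fun x => (phi_zero_pos hw x).le), integral_phi_zero hw,
    ENNReal.ofReal_one]

/-! ### Linear algebra of the projections -/

@[fun_prop]
lemma measurable_proj (j : Corner m) : Measurable (proj j) := by unfold proj; fun_prop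

lemma proj_add (j : Corner m) (x y : Idx m → ℝ) : proj j (x + y) = proj j x + proj j y := rfl

lemma proj_mulVec (J : Matrix (Idx m) (Fin m) ℝ) (j : Corner m) (p : Fin m → ℝ) :
    proj j (J.mulVec p) = (Amat J j).mulVec p := rfl

lemma dist_proj_le (j : Corner m) (x y : Idx m → ℝ) : dist (proj j x) (proj j y) ≤ dist x y :=
  (dist_pi_le_iff dist_nonneg).2 fun i => dist_le_pi_dist x y (sel j i)

@[fun_prop]
lemma measurable_mulVec {ι κ : Type*} [Fintype ι] [Fintype κ] (A : Matrix ι κ ℝ) :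
    Measurable A.mulVec := by
  unfold Matrix.mulVec dotProduct; fun_prop

@[fun_prop]
lemma continuous_mulVec {ι κ : Type*} [Fintype ι] [Fintype κ] (A : Matrix ι κ ℝ) :
    Continuous A.mulVec := by
  unfold Matrix.mulVec dotProduct; fun_prop

lemma dist_mulVec_le {ι : Type*} [Fintype ι] (A : Matrix ι (Fin m) ℝ) {Δ : ℝ}
    (hΔ : 0 ≤ Δ) (hA : ∀ i k, |A i k| ≤ Δ) (p q : Fin m → ℝ) :
    dist (A.mulVec p) (A.mulVec q) ≤ m * Δ * dist p q := by
  refine (dist_pi_le_iff (by positivity)).2 fun i => ?_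
  rw [Real.dist_eq]
  have : A.mulVec p i - A.mulVec q i = ∑ k, A i k * (p k - q k) := by
    simp only [Matrix.mulVec, dotProduct, mul_sub, Finset.sum_sub_distrib]
  rw [this]
  refine (Finset.abs_sum_le_sum_abs _ _).trans ?_
  calc ∑ k, |A i k * (p k - q k)| ≤ ∑ _k : Fin m, Δ * dist p q := by
        refine Finset.sum_le_sum fun k _ => ?_
        rw [abs_mul]
        gcongr
        · exact hA i k
        · exact (Real.dist_eq _ _).symm.trans_le (dist_le_pi_dist p q k)
    _ = _ := by simp; ring

lemma lintegral_comp_mulVec {A : Matrix (Fin m) (Fin m) ℝ} (hA : A.det ≠ 0)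
    {f : (Fin m → ℝ) → ℝ≥0∞} (hf : Measurable f) :
    ∫⁻ p, f (A.mulVec p) = ENNReal.ofReal |A.det|⁻¹ * ∫⁻ z, f z := by
  have h := Real.map_matrix_volume_pi_eq_smul_volume_pi hA
  have h2 : ∫⁻ z, f z ∂(Measure.map (Matrix.toLin' A) volume) = ∫⁻ p, f (A.mulVec p) := by
    rw [lintegral_map hf]
    · rfl
    · exact measurable_mulVec A
  rw [← h2, h, lintegral_smul_measure, abs_inv, smul_eq_mul]

lemma lintegral_comp_sub_mulVec {A : Matrix (Fin m) (Fin m) ℝ} (hA : A.det ≠ 0)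
    {f : (Fin m → ℝ) → ℝ≥0∞} (hf : Measurable f) (z : Fin m → ℝ) :
    ∫⁻ p, f (z - A.mulVec p) = ENNReal.ofReal |A.det|⁻¹ * ∫⁻ z, f z := by
  rw [lintegral_comp_mulVec hA (f := fun y => f (z - y)) (by fun_prop),
    lintegral_sub_left_eq_self]

/-! ### The Gaussian averaged along the range of `J` -/

/-- `∫ φ_w(x + Jp) dp` for the Gaussian `φ`. -/
def gaussAvg (J : Matrix (Idx m) (Fin m) ℝ) (w : Idx m → ℝ) (x : Idx m → ℝ) : ℝ≥0∞ :=
  ∫⁻ p, ENNReal.ofReal (phi w 0 (x + J.mulVec p))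

@[fun_prop]
lemma measurable_gaussAvg (J : Matrix (Idx m) (Fin m) ℝ) (w : Idx m → ℝ) :
    Measurable (gaussAvg J w) := by
  unfold gaussAvg
  refine Measurable.lintegral_prod_right'
    (f := fun q : (Idx m → ℝ) × (Fin m → ℝ) => ENNReal.ofReal (phi w 0 (q.1 + J.mulVec q.2))) ?_
  fun_prop

lemma lintegral_gaussAvg_mul (J : Matrix (Idx m) (Fin m) ℝ) {w : Idx m → ℝ} (hw : ∀ k, 0 < w k)
    (j : Corner m) (hA : (Amat J j).det ≠ 0) {f : (Fin m → ℝ) → ℝ≥0∞} (hf : Measurable f) :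
    ∫⁻ y, gaussAvg J w y * f (proj j y) = ENNReal.ofReal |(Amat J j).det|⁻¹ * ∫⁻ z, f z := by
  have h1 : ∀ y, gaussAvg J w y * f (proj j y) =
      ∫⁻ p, ENNReal.ofReal (phi w 0 (y + J.mulVec p)) * f (proj j y) := by
    intro y
    rw [gaussAvg, lintegral_mul_const]
    fun_prop
  simp_rw [h1]
  rw [lintegral_lintegral_swap]
  swap
  · refine Measurable.aemeasurable ?_
    unfold Function.uncurry
    fun_prop
  have h2 : ∀ p, ∫⁻ y, ENNReal.ofReal (phi w 0 (y + J.mulVec p)) * f (proj j y) =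
      ∫⁻ y, ENNReal.ofReal (phi w 0 y) * f (proj j y - (Amat J j).mulVec p) := by
    intro p
    rw [← lintegral_add_right_eq_self (μ := volume) (fun y => ENNReal.ofReal (phi w 0 y) *
      f (proj j y - (Amat J j).mulVec p)) (J.mulVec p)]
    refine lintegral_congr fun y => ?_
    rw [proj_add, proj_mulVec, add_sub_cancel_right]
  simp_rw [h2]
  rw [lintegral_lintegral_swap]
  swap
  · refine Measurable.aemeasurable ?_
    unfold Function.uncurry
    fun_prop
  have h3 : ∀ y, ∫⁻ p, ENNReal.ofReal (phi w 0 y) * f (proj j y - (Amat J j).mulVec p) =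
      ENNReal.ofReal (phi w 0 y) * (ENNReal.ofReal |(Amat J j).det|⁻¹ * ∫⁻ z, f z) := by
    intro y
    rw [lintegral_const_mul, lintegral_comp_sub_mulVec hA hf]
    fun_prop
  simp_rw [h3]
  rw [lintegral_mul_const _ (by fun_prop), lintegral_phi_zero hw, one_mul]

/-! ### The boundary estimate -/

/-- The product `∏_h max(1, d_h⁻¹)²`. -/
def bd (d : Fin m → ℝ) : ℝ := ∏ h, (max 1 (d h)⁻¹) ^ 2

/-- The widths `t D`, `D = diag(d, d)`. -/
def wid (d : Fin m → ℝ) (t : ℝ) : Idx m → ℝ := fun k => t * Sum.elim d d k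

lemma wid_pos {d : Fin m → ℝ} (hd : ∀ h, 0 < d h) {t : ℝ} (ht : 0 < t) (k : Idx m) :
    0 < wid d t k := by
  rcases k with h | h <;> exact mul_pos ht (hd h)

lemma gauss_shift_le {w ρ D a b : ℝ} (hw : 0 < w) (hρ : 0 < ρ)
    (hD : ρ / w ≤ 2 * D) (hD1 : 1 ≤ D) (hab : |a - b| ≤ ρ) :
    w⁻¹ * hn 0 (a / w) ≤ (2 * √2 * Real.exp Real.pi * D) *
      ((√2 * max w ρ)⁻¹ * hn 0 (b / (√2 * max w ρ))) := by
  set M := max w ρ with hM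
  have hMw : w ≤ M := le_max_left _ _
  have hMρ : ρ ≤ M := le_max_right _ _
  have hM0 : 0 < M := hw.trans_le hMw
  have h2 : (√2 : ℝ) ^ 2 = 2 := Real.sq_sqrt (by norm_num)
  have hs : (0 : ℝ) < √2 := by positivity
  have e1 : hn 0 (a / w) ≤ Real.exp Real.pi * hn 0 (b / (√2 * M)) := by
    rw [hn_zero, hn_zero, ← Real.exp_add, Real.exp_le_exp]
    have : (b / (√2 * M)) ^ 2 ≤ (a / w) ^ 2 + 1 := by
      rw [div_pow, mul_pow, h2, div_le_iff₀ (by positivity)]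
      have hb : b ^ 2 ≤ 2 * a ^ 2 + 2 * ρ ^ 2 := by
        have : (a - b) ^ 2 ≤ ρ ^ 2 := sq_le_sq' (by linarith [abs_le.mp hab]) (abs_le.mp hab).2
        nlinarith [sq_nonneg (2 * a - b)]
      have ha : a ^ 2 ≤ (a / w) ^ 2 * M ^ 2 := by
        rw [div_pow, div_mul_eq_mul_div, le_div_iff₀ (by positivity)]
        gcongr
      have hr : ρ ^ 2 ≤ M ^ 2 := by gcongr
      nlinarith
    nlinarith [Real.pi_pos]
  have e2 : w⁻¹ ≤ (2 * √2 * D) * (√2 * M)⁻¹ := by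
    have : M ≤ 2 * D * w := by
      rw [div_le_iff₀ hw] at hD
      exact max_le (by nlinarith) hD
    rw [inv_eq_one_div, ← div_eq_mul_inv, div_le_div_iff₀ hw (by positivity)]
    nlinarith
  calc w⁻¹ * hn 0 (a / w) ≤ ((2 * √2 * D) * (√2 * M)⁻¹) *
        (Real.exp Real.pi * hn 0 (b / (√2 * M))) := by
        have := (hn_zero_pos (a / w)).le
        gcongr
    _ = _ := by ring

lemma phi_shift_le {d : Fin m → ℝ} (hd : ∀ h, 0 < d h) {t ρ : ℝ} (hρ : 0 < ρ)
    (ht : ρ / 2 ≤ t) {x y : Idx m → ℝ} (hxy : dist x y ≤ ρ) :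
    phi (wid d t) 0 x ≤ ((2 * √2 * Real.exp Real.pi) ^ (2 * m) * bd d) *
      phi (fun k => √2 * max (wid d t k) ρ) 0 y := by
  have ht0 : 0 < t := by linarith
  have hB : (2 * √2 * Real.exp Real.pi) ^ (2 * m) * bd d =
      ∏ k : Idx m, (2 * √2 * Real.exp Real.pi * max 1 (Sum.elim d d k)⁻¹) := by
    rw [Fintype.prod_sum_type]
    simp only [Sum.elim_inl, Sum.elim_inr, bd, Finset.prod_mul_distrib, Finset.prod_const,
      Finset.card_univ, Fintype.card_fin, Finset.prod_pow]
    ring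
  rw [hB, phi, phi, ← Finset.prod_mul_distrib]
  refine Finset.prod_le_prod (fun k _ => ?_) (fun k _ => ?_)
  · have := wid_pos hd ht0 k
    have := hn_zero_pos (x k / wid d t k)
    simp only [Pi.zero_apply]
    positivity
  · have hdk : 0 < Sum.elim d d k := by rcases k with h | h <;> exact hd h
    refine gauss_shift_le (wid_pos hd ht0 k) hρ ?_ (le_max_left _ _) ?_
    · calc ρ / wid d t k = (ρ / t) * (Sum.elim d d k)⁻¹ := by
            rw [wid]; field_simp
        _ ≤ 2 * max 1 (Sum.elim d d k)⁻¹ := by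
            gcongr
            · rw [div_le_iff₀ ht0]; linarith
            · exact le_max_right _ _
    · exact (Real.dist_eq _ _).symm.trans_le ((dist_le_pi_dist x y k).trans hxy)

/-- Every point of `E` lies in a substantial piece of `E` at scale `ρ`. -/
def Thick (ρ : ℝ) (E : Set (Fin m → ℝ)) : Prop :=
  ∀ q ∈ E, ∃ Q ⊆ E, Q ⊆ Metric.closedBall q ρ ∧ ENNReal.ofReal ((ρ / 2) ^ m) ≤ volume Q

lemma gaussAvg_shift_le (J : Matrix (Idx m) (Fin m) ℝ) {d : Fin m → ℝ} (hd : ∀ h, 0 < d h)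
    {t ρ : ℝ} (hρ : 0 < ρ) (ht : ρ / 2 ≤ t) {x y : Idx m → ℝ} (hxy : dist x y ≤ ρ) :
    gaussAvg J (wid d t) x ≤ ENNReal.ofReal ((2 * √2 * Real.exp Real.pi) ^ (2 * m) * bd d) *
      gaussAvg J (fun k => √2 * max (wid d t k) ρ) y := by
  unfold gaussAvg
  rw [← lintegral_const_mul _ (by fun_prop)]
  refine lintegral_mono fun p => ?_
  have hb : 0 ≤ (2 * √2 * Real.exp Real.pi) ^ (2 * m) * bd d := by
    have : 0 ≤ bd d := Finset.prod_nonneg fun _ _ => sq_nonneg _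
    positivity
  rw [← ENNReal.ofReal_mul hb]
  exact ENNReal.ofReal_le_ofReal (phi_shift_le hd hρ ht (by rwa [dist_add_right]))

lemma lintegral_ball_prod_le (hm : 1 ≤ m) (u : Corner m → (Fin m → ℝ) → ℝ≥0∞)
    (hu : ∀ j, Measurable (u j)) {ρ : ℝ} {M : ℝ≥0∞}
    (hM : ∀ j z, ∫⁻ y in Metric.closedBall z ρ, u j y ^ (2 ^ (m - 1) : ℕ) ≤ M)
    (y : Idx m → ℝ) :
    ∫⁻ x in Metric.closedBall y ρ, ∏ j, u j (proj j x) ≤ M ^ 2 := by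
  have hpos : (2 ^ (m - 1) : ℕ) ≠ 0 := by positivity
  calc ∫⁻ x in Metric.closedBall y ρ, ∏ j, u j (proj j x)
      = ∫⁻ x, (Metric.closedBall y ρ).indicator (fun x => ∏ j, u j (proj j x)) x := by
        rw [lintegral_indicator Metric.isClosed_closedBall.measurableSet]
    _ ≤ ∫⁻ x, ∏ j, (Metric.closedBall (proj j y) ρ).indicator (u j) (proj j x) := by
        refine lintegral_mono fun x => ?_
        by_cases hx : x ∈ Metric.closedBall y ρ
        · rw [Set.indicator_of_mem hx]
          refine le_of_eq (Finset.prod_congr rfl fun j _ => ?_)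
          rw [Set.indicator_of_mem]
          exact (dist_proj_le j x y).trans hx
        · rw [Set.indicator_of_notMem hx]; exact zero_le
    _ ≤ ∏ j, (∫⁻ z, ((Metric.closedBall (proj j y) ρ).indicator (u j) z) ^ (2 ^ (m - 1) : ℕ)) ^
          (((2 ^ (m - 1) : ℕ) : ℝ)⁻¹) :=
        finner (fun j => (Metric.closedBall (proj j y) ρ).indicator (u j))
          fun j => (hu j).indicator Metric.isClosed_closedBall.measurableSet
    _ ≤ ∏ _j : Corner m, M ^ (((2 ^ (m - 1) : ℕ) : ℝ)⁻¹) := by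
        refine Finset.prod_le_prod' fun j _ => ?_
        gcongr
        refine le_trans (le_of_eq ?_) (hM j (proj j y))
        rw [← lintegral_indicator Metric.isClosed_closedBall.measurableSet]
        refine lintegral_congr fun z => ?_
        by_cases hz : z ∈ Metric.closedBall (proj j y) ρ
        · simp [hz]
        · simp [hz]
    _ = M ^ 2 := by
        rw [Finset.prod_const, Finset.card_univ, Fintype.card_fun, Fintype.card_fin,
          Fintype.card_fin, ← ENNReal.rpow_natCast, ← ENNReal.rpow_mul, ← ENNReal.rpow_natCast]
        congr 1
        obtain ⟨n, rfl⟩ : ∃ n, m = n + 1 := ⟨m - 1, by omega⟩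
        simp only [Nat.add_sub_cancel]
        push_cast
        rw [pow_succ]
        field_simp

set_option maxHeartbeats 1000000 in
lemma boundary_aux (hm : 1 ≤ m) {Δ : ℝ} (hΔ : 0 ≤ Δ) (J : Matrix (Idx m) (Fin m) ℝ)
    (hJ : ∀ k l, |J k l| ≤ Δ) (j₀ : Corner m) (hdet : (Amat J j₀).det ≠ 0)
    (u : Corner m → (Fin m → ℝ) → ℝ≥0∞) (hu : ∀ j, Measurable (u j)) {ρ : ℝ} (hρ : 0 < ρ)
    {M : ℝ≥0∞}
    (hM : ∀ j z, ∫⁻ y in Metric.closedBall z ρ, u j y ^ (2 ^ (m - 1) : ℕ) ≤ M)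
    {E : Set (Fin m → ℝ)} (hthick : Thick ρ E)
    {d : Fin m → ℝ} (hd : ∀ h, 0 < d h) {t : ℝ} (ht : ρ / 2 ≤ t) :
    (∫⁻ x, (proj j₀ ⁻¹' ((Amat J j₀).mulVec '' E)).indicator
      (fun x => (∏ j, u j (proj j x)) * gaussAvg J (wid d t) x) x) *
        (ENNReal.ofReal ((2 * ρ) ^ (2 * m)) * ENNReal.ofReal ((ρ / 2) ^ m)) ≤
      ENNReal.ofReal ((2 * √2 * Real.exp Real.pi) ^ (2 * m) * bd d) * M ^ 2 *
        (ENNReal.ofReal |(Amat J j₀).det|⁻¹ * ENNReal.ofReal ((2 * ((1 + m * Δ) * ρ)) ^ m)) *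
        volume E := by
  classical
  set B : ℝ≥0∞ := ENNReal.ofReal ((2 * √2 * Real.exp Real.pi) ^ (2 * m) * bd d)
  set A := Amat J j₀ with hA
  set r := (1 + m * Δ) * ρ with hr
  have hr0 : 0 ≤ r := by positivity
  set w' : Idx m → ℝ := fun k => √2 * max (wid d t k) ρ
  have hw' : ∀ k, 0 < w' k := fun k => by
    have : 0 < max (wid d t k) ρ := lt_max_of_lt_right hρ
    positivity
  set ind : (Fin m → ℝ) → (Fin m → ℝ) → ℝ≥0∞ := fun z q =>
    {q : (Fin m → ℝ) × (Fin m → ℝ) | dist q.1 (A.mulVec q.2) ≤ r}.indicator 1 (z, q) with hind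
  have hset : MeasurableSet {q : (Fin m → ℝ) × (Fin m → ℝ) | dist q.1 (A.mulVec q.2) ≤ r} := by
    refine IsClosed.measurableSet (isClosed_le ?_ continuous_const)
    fun_prop
  have hindm : Measurable (Function.uncurry ind) := by
    have : Measurable ({q : (Fin m → ℝ) × (Fin m → ℝ) | dist q.1 (A.mulVec q.2) ≤ r}.indicator
      (1 : (Fin m → ℝ) × (Fin m → ℝ) → ℝ≥0∞)) := measurable_one.indicator hset
    exact this
  set θ : (Fin m → ℝ) → ℝ≥0∞ := fun z => ∫⁻ q in E, ind z q with hθ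
  have hθm : Measurable θ := Measurable.lintegral_prod_right' (f := Function.uncurry ind) hindm
  have hlow : ∀ x y : Idx m → ℝ, x ∈ proj j₀ ⁻¹' (A.mulVec '' E) → dist y x ≤ ρ →
      ENNReal.ofReal ((ρ / 2) ^ m) ≤ θ (proj j₀ y) := by
    intro x y hx hy
    obtain ⟨q, hq, hqx⟩ := hx
    obtain ⟨Q, hQE, hQq, hQv⟩ := hthick q hq
    refine hQv.trans ?_
    calc volume Q = ∫⁻ _q in Q, 1 := by simp
      _ ≤ ∫⁻ q' in Q, ind (proj j₀ y) q' := by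
        refine setLIntegral_mono ?_ fun q' hq' => ?_
        · exact hindm.of_uncurry_left
        · simp only [hind]
          rw [Set.indicator_of_mem]
          · exact le_rfl
          · simp only [Set.mem_ofPred_eq]
            calc dist (proj j₀ y) (A.mulVec q')
                ≤ dist (proj j₀ y) (proj j₀ x) + dist (A.mulVec q) (A.mulVec q') := by
                  rw [hqx]; exact dist_triangle _ _ _
              _ ≤ ρ + m * Δ * ρ := by
                  refine add_le_add ((dist_proj_le _ _ _).trans hy) ?_
                  refine (dist_mulVec_le A hΔ (fun i k => hJ _ _) _ _).trans ?_
                  gcongr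
                  rw [dist_comm]; exact hQq hq'
              _ = r := by rw [hr]; ring
      _ ≤ θ (proj j₀ y) := lintegral_mono_set hQE
  have hpt : ∀ x, (proj j₀ ⁻¹' (A.mulVec '' E)).indicator
      (fun x => (∏ j, u j (proj j x)) * gaussAvg J (wid d t) x) x *
        (ENNReal.ofReal ((2 * ρ) ^ (2 * m)) * ENNReal.ofReal ((ρ / 2) ^ m)) ≤
      ∫⁻ y, (Metric.closedBall y ρ).indicator (fun x => ∏ j, u j (proj j x)) x *
        (B * gaussAvg J w' y * θ (proj j₀ y)) := by
    intro x
    by_cases hx : x ∈ proj j₀ ⁻¹' (A.mulVec '' E)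
    swap
    · rw [Set.indicator_of_notMem hx, zero_mul]; exact zero_le
    rw [Set.indicator_of_mem hx]
    have hvol : ENNReal.ofReal ((2 * ρ) ^ (2 * m)) = volume (Metric.closedBall x ρ) := by
      rw [Real.volume_pi_closedBall _ hρ.le]
      simp [two_mul]
    rw [hvol]
    calc _ = ∫⁻ _y in Metric.closedBall x ρ, (∏ j, u j (proj j x)) *
          (gaussAvg J (wid d t) x * ENNReal.ofReal ((ρ / 2) ^ m)) := by
          rw [setLIntegral_const]; ring
      _ ≤ ∫⁻ y in Metric.closedBall x ρ, (Metric.closedBall y ρ).indicator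
            (fun x => ∏ j, u j (proj j x)) x * (B * gaussAvg J w' y * θ (proj j₀ y)) := by
          refine setLIntegral_mono' Metric.isClosed_closedBall.measurableSet fun y hy => ?_
          have hxy : dist x y ≤ ρ := by rw [dist_comm]; exact hy
          rw [Set.indicator_of_mem (show x ∈ Metric.closedBall y ρ from hxy)]
          exact mul_le_mul' le_rfl (mul_le_mul' (gaussAvg_shift_le J hd hρ ht hxy)
            (hlow x y hx hy))
      _ ≤ _ := setLIntegral_le_lintegral _ _
  calc
    _ = ∫⁻ x, (proj j₀ ⁻¹' (A.mulVec '' E)).indicator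
      (fun x => (∏ j, u j (proj j x)) * gaussAvg J (wid d t) x) x *
        (ENNReal.ofReal ((2 * ρ) ^ (2 * m)) * ENNReal.ofReal ((ρ / 2) ^ m)) := by
        rw [lintegral_mul_const' _ _ (ENNReal.mul_ne_top ENNReal.ofReal_ne_top
          ENNReal.ofReal_ne_top)]
    _ ≤ ∫⁻ x, ∫⁻ y, (Metric.closedBall y ρ).indicator (fun x => ∏ j, u j (proj j x)) x *
        (B * gaussAvg J w' y * θ (proj j₀ y)) := lintegral_mono hpt
    _ = ∫⁻ y, ∫⁻ x, (Metric.closedBall y ρ).indicator (fun x => ∏ j, u j (proj j x)) x *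
        (B * gaussAvg J w' y * θ (proj j₀ y)) := by
        refine lintegral_lintegral_swap (Measurable.aemeasurable ?_)
        have h1 : Measurable fun q : (Idx m → ℝ) × (Idx m → ℝ) =>
            {q : (Idx m → ℝ) × (Idx m → ℝ) | dist q.1 q.2 ≤ ρ}.indicator
              (fun q => ∏ j, u j (proj j q.1)) q := by
          refine Measurable.indicator (by fun_prop) ?_
          exact (isClosed_le (by fun_prop) continuous_const).measurableSet
        exact h1.mul (by fun_prop)
    _ ≤ ∫⁻ y, M ^ 2 * (B * gaussAvg J w' y * θ (proj j₀ y)) := by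
        refine lintegral_mono fun y => ?_
        dsimp only
        rw [lintegral_mul_const, lintegral_indicator Metric.isClosed_closedBall.measurableSet]
        · gcongr
          exact lintegral_ball_prod_le hm u hu hM y
        · exact Measurable.indicator (by fun_prop) Metric.isClosed_closedBall.measurableSet
    _ = B * M ^ 2 * ∫⁻ y, gaussAvg J w' y * θ (proj j₀ y) := by
        rw [← lintegral_const_mul _ (by fun_prop)]
        refine lintegral_congr fun y => ?_
        ring
    _ = B * M ^ 2 * (ENNReal.ofReal |A.det|⁻¹ * ∫⁻ z, θ z) := by
        rw [lintegral_gaussAvg_mul J hw' j₀ hdet hθm]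
    _ = _ := by
        have : ∫⁻ z, θ z = ENNReal.ofReal ((2 * r) ^ m) * volume E := by
          simp only [hθ]
          rw [lintegral_lintegral_swap hindm.aemeasurable]
          have : ∀ q, ∫⁻ z, ind z q = ENNReal.ofReal ((2 * r) ^ m) := by
            intro q
            have : ∀ z, ind z q = (Metric.closedBall (A.mulVec q) r).indicator 1 z := by
              intro z; simp [hind, Set.indicator]
            simp_rw [this]
            rw [lintegral_indicator_one Metric.isClosed_closedBall.measurableSet,
              Real.volume_pi_closedBall _ hr0]
            simp
          simp_rw [this]
          rw [setLIntegral_const]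
        rw [this]; ring

lemma boundary (hm : 1 ≤ m) {Δ K : ℝ} (hΔ : 0 ≤ Δ) (hK : 0 ≤ K) :
    ∃ C : ℝ≥0, ∀ (J : Matrix (Idx m) (Fin m) ℝ), (∀ k l, |J k l| ≤ Δ) →
      ∀ j₀ : Corner m, (Amat J j₀).det ≠ 0 → |(Amat J j₀).det|⁻¹ ≤ Δ →
      ∀ u : Corner m → (Fin m → ℝ) → ℝ≥0∞, (∀ j, Measurable (u j)) → ∀ ρ : ℝ, 0 < ρ →
      (∀ j z, ∫⁻ y in Metric.closedBall z ρ, u j y ^ (2 ^ (m - 1) : ℕ) ≤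
        ENNReal.ofReal ((K * ρ) ^ m)) →
      ∀ E : Set (Fin m → ℝ), Thick ρ E →
      ∀ d : Fin m → ℝ, (∀ h, 0 < d h) → ∀ t : ℝ, ρ / 2 ≤ t →
      ∫⁻ x, (proj j₀ ⁻¹' ((Amat J j₀).mulVec '' E)).indicator
        (fun x => (∏ j, u j (proj j x)) * gaussAvg J (wid d t) x) x ≤
        C * ENNReal.ofReal (bd d) * volume E := by
  set c : ℝ := (2 * √2 * Real.exp Real.pi) ^ (2 * m) * (K ^ m) ^ 2 * Δ *
    (2 * (1 + m * Δ)) ^ m / (2 ^ (2 * m) * (1 / 2) ^ m) with hc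
  have hc0 : 0 ≤ c := by positivity
  refine ⟨c.toNNReal, fun J hJ j₀ hdet hdet' u hu ρ hρ hM E hT d hd t ht => ?_⟩
  have hb : 0 ≤ bd d := Finset.prod_nonneg fun _ _ => sq_nonneg _
  have key := boundary_aux hm hΔ J hJ j₀ hdet u hu hρ hM hT hd ht
  set X := ∫⁻ x, (proj j₀ ⁻¹' ((Amat J j₀).mulVec '' E)).indicator
        (fun x => (∏ j, u j (proj j x)) * gaussAvg J (wid d t) x) x
  have hpos : 0 < (2 * ρ) ^ (2 * m) * (ρ / 2) ^ m := by positivity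
  rw [← ENNReal.ofReal_mul (by positivity)] at key
  have key2 : X * ENNReal.ofReal ((2 * ρ) ^ (2 * m) * (ρ / 2) ^ m) ≤
      ((c.toNNReal : ℝ≥0∞) * ENNReal.ofReal (bd d) * volume E) *
        ENNReal.ofReal ((2 * ρ) ^ (2 * m) * (ρ / 2) ^ m) := by
    refine key.trans ?_
    have : ((c.toNNReal : ℝ≥0∞) * ENNReal.ofReal (bd d) * volume E) *
        ENNReal.ofReal ((2 * ρ) ^ (2 * m) * (ρ / 2) ^ m) =
        ENNReal.ofReal (c * bd d * ((2 * ρ) ^ (2 * m) * (ρ / 2) ^ m)) * volume E := by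
      rw [ENNReal.ofReal_mul (p := c * bd d) (by positivity), ENNReal.ofReal_mul hc0]
      change ENNReal.ofReal c * _ * _ * _ = _
      ring
    rw [this, ← ENNReal.ofReal_pow (by positivity), ← ENNReal.ofReal_mul (by positivity),
      ← ENNReal.ofReal_mul (by positivity), ← ENNReal.ofReal_mul (by positivity)]
    refine mul_le_mul' (ENNReal.ofReal_le_ofReal ?_) le_rfl
    calc _ ≤ (2 * √2 * Real.exp Real.pi) ^ (2 * m) * bd d * ((K * ρ) ^ m) ^ 2 *
          (Δ * (2 * ((1 + m * Δ) * ρ)) ^ m) := by gcongr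
      _ = _ := by
        rw [hc]
        simp only [mul_pow, div_pow]
        field_simp
        ring
  rwa [ENNReal.mul_le_mul_iff_left (ENNReal.ofReal_pos.mpr hpos).ne' ENNReal.ofReal_ne_top]
    at key2

/-! ### Integrability along the range of `J` -/

lemma integral_abs_hn_div (n : ℕ) {w : ℝ} (hw : 0 < w) :
    ∫ y : ℝ, |w⁻¹ * hn n (y / w)| = ∫ y, |hn n y| := by
  simp_rw [abs_mul, abs_of_pos (inv_pos.mpr hw)]
  rw [integral_const_mul, Measure.integral_comp_div (fun y => |hn n y|), abs_of_pos hw,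
    smul_eq_mul, inv_mul_cancel_left₀ hw.ne']

/-- The constant in `lintegral_phi_range_le`. -/
def phiConst (J : Matrix (Idx m) (Fin m) ℝ) (β : Idx m → ℕ) : ℝ :=
  (∏ h, hC (β (Sum.inl h))) * (|(Amat J fun _ => 1).det|⁻¹ * ∏ h, ∫ y, |hn (β (Sum.inr h)) y|)

lemma phiConst_nonneg (J : Matrix (Idx m) (Fin m) ℝ) (β : Idx m → ℕ) : 0 ≤ phiConst J β := by
  refine mul_nonneg (Finset.prod_nonneg fun _ _ => hC_nonneg _) (mul_nonneg (by positivity)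
    (Finset.prod_nonneg fun h _ => integral_nonneg fun _ => abs_nonneg _))

lemma lintegral_phi_range_le {J : Matrix (Idx m) (Fin m) ℝ}
    (hdet : (Amat J fun _ => 1).det ≠ 0) (β : Idx m → ℕ) {w : Idx m → ℝ} {a : ℝ} (ha : 0 < a)
    (hw : ∀ k, a ≤ w k) (x : Idx m → ℝ) :
    ∫⁻ p, ‖phi w β (x + J.mulVec p)‖ₑ ≤ ENNReal.ofReal (phiConst J β * a⁻¹ ^ m) := by
  have hw0 : ∀ k, 0 < w k := fun k => ha.trans_le (hw k)
  set ψ : (Fin m → ℝ) → ℝ := fun z =>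
    ∏ h, |(w (Sum.inr h))⁻¹ * hn (β (Sum.inr h)) (z h / w (Sum.inr h))| with hψ
  have hψc : Continuous ψ := by
    refine continuous_finsetProd _ fun h _ => Continuous.abs (continuous_const.mul ?_)
    exact (continuous_hn _).comp ((continuous_apply h).div_const _)
  have hψ0 : ∀ z, 0 ≤ ψ z := fun z => Finset.prod_nonneg fun _ _ => abs_nonneg _
  set c : ℝ := (∏ h, hC (β (Sum.inl h))) * a⁻¹ ^ m with hc
  have hc0 : 0 ≤ c := mul_nonneg (Finset.prod_nonneg fun _ _ => hC_nonneg _) (by positivity)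
  have hpt : ∀ z, ‖phi w β z‖ₑ ≤ ENNReal.ofReal c * ENNReal.ofReal (ψ (proj (fun _ => 1) z)) := by
    intro z
    rw [← ENNReal.ofReal_mul hc0, Real.enorm_eq_ofReal_abs]
    refine ENNReal.ofReal_le_ofReal ?_
    rw [phi, Finset.abs_prod, Fintype.prod_sum_type]
    refine mul_le_mul ?_ (le_of_eq rfl) (Finset.prod_nonneg fun _ _ => abs_nonneg _) hc0
    calc _ ≤ ∏ h : Fin m, a⁻¹ * hC (β (Sum.inl h)) := by
          refine Finset.prod_le_prod (fun _ _ => abs_nonneg _) fun h _ => ?_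
          rw [abs_mul, abs_of_pos (inv_pos.mpr (hw0 _))]
          have := hw (Sum.inl h)
          gcongr
          exact abs_hn_le_const _ _
      _ = c := by
          rw [Finset.prod_mul_distrib]; simp [hc, mul_comm]
  calc ∫⁻ p, ‖phi w β (x + J.mulVec p)‖ₑ
      ≤ ∫⁻ p, ENNReal.ofReal c *
        ENNReal.ofReal (ψ (proj (fun _ => 1) x + (Amat J fun _ => 1).mulVec p)) :=
        lintegral_mono fun p => hpt _
    _ = ENNReal.ofReal c * (ENNReal.ofReal |(Amat J fun _ => 1).det|⁻¹ *
          ∫⁻ z, ENNReal.ofReal (ψ z)) := by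
        rw [lintegral_const_mul' _ _ ENNReal.ofReal_ne_top, lintegral_comp_mulVec hdet
          (f := fun y => ENNReal.ofReal (ψ (proj (fun _ => 1) x + y))),
          lintegral_add_left_eq_self (fun y => ENNReal.ofReal (ψ y))]
        exact (hψc.measurable.comp (measurable_const_add _)).ennreal_ofReal
    _ = ENNReal.ofReal c * (ENNReal.ofReal |(Amat J fun _ => 1).det|⁻¹ *
          ENNReal.ofReal (∏ h, ∫ y, |hn (β (Sum.inr h)) y|)) := by
        congr 2
        rw [← ofReal_integral_eq_lintegral_ofReal _ (Filter.Eventually.of_forall hψ0)]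
        · rw [hψ, integral_fintype_prod_volume_eq_prod (fun h y =>
            |(w (Sum.inr h))⁻¹ * hn (β (Sum.inr h)) (y / w (Sum.inr h))|)]
          simp_rw [integral_abs_hn_div _ (hw0 _)]
        · exact Integrable.fintype_prod (f := fun h y =>
            |(w (Sum.inr h))⁻¹ * hn (β (Sum.inr h)) (y / w (Sum.inr h))|)
            fun h => (integrable_hn_div _ (hw0 _)).abs
    _ = _ := by
        rw [← ENNReal.ofReal_mul (by positivity), ← ENNReal.ofReal_mul hc0]
        congr 1
        rw [hc, phiConst]; ring

lemma exists_width_bound {w : Idx m → ℝ} (hw : ∀ k, 0 < w k) : ∃ a : ℝ, 0 < a ∧ ∀ k, a ≤ w k := by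
  obtain hne | hne := isEmpty_or_nonempty (Idx m)
  · exact ⟨1, one_pos, fun k => hne.elim k⟩
  · obtain ⟨k, hk⟩ := Finite.exists_min w
    exact ⟨w k, hw k, hk⟩

lemma integrable_phi_range {J : Matrix (Idx m) (Fin m) ℝ}
    (hdet : (Amat J fun _ => 1).det ≠ 0) (β : Idx m → ℕ) {w : Idx m → ℝ} (hw : ∀ k, 0 < w k)
    (x : Idx m → ℝ) : Integrable fun p => phi w β (x + J.mulVec p) := by
  obtain ⟨a, ha, haw⟩ := exists_width_bound hw
  refine ⟨?_, ?_⟩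
  · exact ((continuous_phi w β).comp (by fun_prop)).aestronglyMeasurable
  · exact (lintegral_phi_range_le hdet β ha haw x).trans_lt ENNReal.ofReal_lt_top

/-! ### Admissible tuples -/

/-- Bounded measurable functions with bounded support. -/
structure Nice (f : Corner m → (Fin m → ℝ) → ℝ) : Prop where
  meas : ∀ j, Measurable (f j)
  bdd : ∃ C, ∀ j z, |f j z| ≤ C
  supp : ∃ R, ∀ j z, f j z ≠ 0 → ‖z‖ ≤ R

/-- The product `∏_j f_j(Π_j x)`. -/
def Hprod (f : Corner m → (Fin m → ℝ) → ℝ) (x : Idx m → ℝ) : ℝ := ∏ j, f j (proj j x)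

lemma Nice.measurable_Hprod {f : Corner m → (Fin m → ℝ) → ℝ} (hf : Nice f) :
    Measurable (Hprod f) := by
  have := hf.meas
  unfold Hprod; fun_prop

lemma Nice.integrable_Hprod {f : Corner m → (Fin m → ℝ) → ℝ} (hf : Nice f) :
    Integrable (Hprod f) := by
  obtain ⟨C, hC⟩ := hf.bdd
  obtain ⟨R, hR⟩ := hf.supp
  have hb : ∀ x, ‖Hprod f x‖ ≤ ∏ _j : Corner m, C := fun x => by
    rw [Hprod, Real.norm_eq_abs, Finset.abs_prod]
    exact Finset.prod_le_prod (fun _ _ => abs_nonneg _) fun j _ => hC j _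
  have hs : ∀ x, x ∉ Metric.closedBall (0 : Idx m → ℝ) R → Hprod f x = 0 := by
    intro x hx
    by_contra h
    apply hx
    rw [mem_closedBall_zero_iff]
    have h1 : ∀ j, f j (proj j x) ≠ 0 := fun j hj =>
      h (Finset.prod_eq_zero (Finset.mem_univ j) hj)
    have h0 := hR _ _ (h1 fun _ => 0)
    have hR0 : 0 ≤ R := (norm_nonneg _).trans h0
    rw [pi_norm_le_iff_of_nonneg hR0]
    intro k
    obtain ⟨h, c, rfl⟩ := exists_slot k
    exact (norm_le_pi_norm (proj (fun _ => c) x) h).trans (hR _ _ (h1 fun _ => c))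
  have : Hprod f = (Metric.closedBall (0 : Idx m → ℝ) R).indicator (Hprod f) := by
    funext x
    by_cases hx : x ∈ Metric.closedBall (0 : Idx m → ℝ) R
    · rw [Set.indicator_of_mem hx]
    · rw [Set.indicator_of_notMem hx, hs x hx]
  rw [this, integrable_indicator_iff Metric.isClosed_closedBall.measurableSet]
  exact Measure.integrableOn_of_bounded (M := ∏ _j : Corner m, C)
    (isCompact_closedBall _ _).measure_lt_top.ne
    hf.measurable_Hprod.aestronglyMeasurable (Filter.Eventually.of_forall hb)

/-! ### The forms -/

/-- `∫ ∏_j f_j(Π_j x) ∫ φ_{w,β}(x + Jp) dp dx`. -/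
def lam (f : Corner m → (Fin m → ℝ) → ℝ) (J : Matrix (Idx m) (Fin m) ℝ) (w : Idx m → ℝ)
    (β : Idx m → ℕ) : ℝ :=
  ∫ x, Hprod f x * ∫ p, phi w β (x + J.mulVec p)

lemma measurable_phi_joint {Y : Type*} [MeasurableSpace Y] {W : Y → Idx m → ℝ}
    (hW : Measurable W) (β : Idx m → ℕ) {X : Y → Idx m → ℝ} (hX : Measurable X) :
    Measurable fun y => phi (W y) β (X y) := by
  unfold phi
  refine Finset.measurable_prod _ fun k _ => ?_
  have h1 : Measurable fun y => W y k := (measurable_pi_apply k).comp hW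
  have h2 : Measurable fun y => X y k := (measurable_pi_apply k).comp hX
  exact h1.inv.mul ((continuous_hn _).measurable.comp (h2.div h1))

/-- Joint integrability of the integrand of `lam` over a parameter space of finite measure. -/
lemma integrable_param {f : Corner m → (Fin m → ℝ) → ℝ} (hf : Nice f)
    {J : Matrix (Idx m) (Fin m) ℝ} (hdet : (Amat J fun _ => 1).det ≠ 0) (β : Idx m → ℕ)
    {Y : Type*} [MeasurableSpace Y] {ν : Measure Y} [IsFiniteMeasure ν] {W : Y → Idx m → ℝ}
    (hW : Measurable W) {a : ℝ} (ha : 0 < a) (haW : ∀ᵐ y ∂ν, ∀ k, a ≤ W y k) :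
    Integrable (fun q : Y × (Idx m → ℝ) × (Fin m → ℝ) =>
      Hprod f q.2.1 * phi (W q.1) β (q.2.1 + J.mulVec q.2.2)) (ν.prod (volume.prod volume)) := by
  have hmeas : Measurable (fun q : Y × (Idx m → ℝ) × (Fin m → ℝ) =>
      Hprod f q.2.1 * phi (W q.1) β (q.2.1 + J.mulVec q.2.2)) := by
    have h1 := hf.measurable_Hprod
    exact (h1.comp (by fun_prop)).mul
      (measurable_phi_joint (hW.comp measurable_fst) β (by fun_prop))
  refine ⟨hmeas.aestronglyMeasurable, ?_⟩
  rw [HasFiniteIntegral, lintegral_prod _ hmeas.enorm.aemeasurable]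
  have hb : ∀ᵐ y ∂ν, ∫⁻ q : (Idx m → ℝ) × (Fin m → ℝ),
      ‖Hprod f q.1 * phi (W y) β (q.1 + J.mulVec q.2)‖ₑ ∂(volume.prod volume) ≤
      (∫⁻ x, ‖Hprod f x‖ₑ) * ENNReal.ofReal (phiConst J β * a⁻¹ ^ m) := by
    filter_upwards [haW] with y hy
    have hy' : Measurable fun q : (Idx m → ℝ) × (Fin m → ℝ) =>
        Hprod f q.1 * phi (W y) β (q.1 + J.mulVec q.2) := hmeas.comp measurable_prodMk_left
    rw [lintegral_prod _ hy'.enorm.aemeasurable, ← lintegral_mul_const _ hf.measurable_Hprod.enorm]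
    refine lintegral_mono fun x => ?_
    simp only [enorm_mul]
    rw [lintegral_const_mul' _ _ enorm_ne_top]
    exact mul_le_mul' le_rfl (lintegral_phi_range_le hdet β ha hy x)
  refine (lintegral_mono_ae hb).trans_lt ?_
  rw [lintegral_const]
  exact ENNReal.mul_lt_top (ENNReal.mul_lt_top hf.integrable_Hprod.hasFiniteIntegral
    ENNReal.ofReal_lt_top) (measure_lt_top _ _)

lemma integrable_lam_prod {f : Corner m → (Fin m → ℝ) → ℝ} (hf : Nice f)
    {J : Matrix (Idx m) (Fin m) ℝ} (hdet : (Amat J fun _ => 1).det ≠ 0) (β : Idx m → ℕ)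
    {w : Idx m → ℝ} (hw : ∀ k, 0 < w k) :
    Integrable (fun q : (Idx m → ℝ) × (Fin m → ℝ) =>
      Hprod f q.1 * phi w β (q.1 + J.mulVec q.2)) (volume.prod volume) := by
  obtain ⟨a, ha, haw⟩ := exists_width_bound hw
  have := integrable_param hf hdet β (ν := Measure.dirac ()) (W := fun _ => w)
    measurable_const ha (Filter.Eventually.of_forall fun _ => haw)
  rw [Measure.dirac_prod] at this
  exact this.comp_measurable measurable_prodMk_left

/-! ### Calculus of the forms -/

lemma phi_add_single (w : Idx m → ℝ) (β : Idx m → ℕ) (k : Idx m) (n : ℕ) (x : Idx m → ℝ) :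
    phi w (β + Pi.single k n) x = ((w k)⁻¹ * hn (β k + n) (x k / w k)) *
      ∏ j ∈ Finset.univ.erase k, (w j)⁻¹ * hn (β j) (x j / w j) := by
  rw [phi, ← Finset.mul_prod_erase _ _ (Finset.mem_univ k)]
  congr 1
  · simp
  · refine Finset.prod_congr rfl fun j hj => ?_
    simp [Pi.single_eq_of_ne (Finset.ne_of_mem_erase hj)]

lemma hasDerivAt_phi_line (w : Idx m → ℝ) (β : Idx m → ℕ) (x v : Idx m → ℝ) :
    HasDerivAt (fun s : ℝ => phi w β (x + s • v))
      (∑ k, (v k * (w k)⁻¹) * phi w (β + Pi.single k 1) x) 0 := by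
  have h : ∀ k ∈ (Finset.univ : Finset (Idx m)), HasDerivAt
      (fun s : ℝ => (w k)⁻¹ * hn (β k) ((x + s • v) k / w k))
      ((w k)⁻¹ * (hn (β k + 1) (x k / w k) * (v k * (w k)⁻¹))) 0 := by
    intro k _
    have h1 : HasDerivAt (fun s : ℝ => (x + s • v) k / w k) (v k * (w k)⁻¹) 0 := by
      have := (((hasDerivAt_id (0 : ℝ)).mul_const (v k)).const_add (x k)).div_const (w k)
      refine this.congr_deriv ?_
      rw [one_mul, div_eq_mul_inv]
    have h2 := hasDerivAt_hn (β k) ((x + (0 : ℝ) • v) k / w k)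
    have h3 := (h2.comp 0 h1).const_mul (w k)⁻¹
    refine h3.congr_deriv ?_
    simp
  refine (HasDerivAt.fun_finsetProd h).congr_deriv ?_
  refine Finset.sum_congr rfl fun k _ => ?_
  rw [phi_add_single]
  simp only [zero_smul, add_zero, smul_eq_mul]
  ring

/-- Integration by parts along the range of `J`. -/
lemma sum_integral_phi_range {J : Matrix (Idx m) (Fin m) ℝ}
    (hdet : (Amat J fun _ => 1).det ≠ 0) (β : Idx m → ℕ) {w : Idx m → ℝ} (hw : ∀ k, 0 < w k)
    (x : Idx m → ℝ) (v : Fin m → ℝ) :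
    ∑ k, (J.mulVec v k * (w k)⁻¹) * ∫ p, phi w (β + Pi.single k 1) (x + J.mulVec p) = 0 := by
  have hi : ∀ k, Integrable fun p => phi w (β + Pi.single k 1) (x + J.mulVec p) := fun k =>
    integrable_phi_range hdet _ hw x
  have hs : Integrable fun p =>
      ∑ k, (J.mulVec v k * (w k)⁻¹) * phi w (β + Pi.single k 1) (x + J.mulVec p) :=
    integrable_finsetSum _ fun k _ => (hi k).const_mul _
  have key := integral_bilinear_hasLineDerivAt_right_eq_neg_left_of_integrable
    (μ := (volume : Measure (Fin m → ℝ)))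
    (f := fun p => phi w β (x + J.mulVec p))
    (f' := fun p => ∑ k, (J.mulVec v k * (w k)⁻¹) * phi w (β + Pi.single k 1) (x + J.mulVec p))
    (g := fun _ => (1 : ℝ)) (g' := fun _ => 0) (v := v) (B := ContinuousLinearMap.mul ℝ ℝ)
    (by simpa using hs) (by simp) (by simpa using integrable_phi_range hdet β hw x)
    (fun p _ => by
      have := hasDerivAt_phi_line w β (x + J.mulVec p) (J.mulVec v)
      rw [HasLineDerivAt]
      simpa [Matrix.mulVec_add, Matrix.mulVec_smul, add_assoc] using this)
    (fun p _ => by simpa [HasLineDerivAt] using hasDerivAt_const (0 : ℝ) (1 : ℝ))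
  simp only [ContinuousLinearMap.mul_apply', mul_zero, mul_one, integral_zero] at key
  rw [integral_finsetSum _ fun k _ => (hi k).const_mul _] at key
  simp_rw [integral_const_mul] at key
  linarith

lemma lam_eq_prod {f : Corner m → (Fin m → ℝ) → ℝ} (hf : Nice f)
    {J : Matrix (Idx m) (Fin m) ℝ} (hdet : (Amat J fun _ => 1).det ≠ 0) (β : Idx m → ℕ)
    {w : Idx m → ℝ} (hw : ∀ k, 0 < w k) :
    lam f J w β = ∫ q : (Idx m → ℝ) × (Fin m → ℝ), Hprod f q.1 * phi w β (q.1 + J.mulVec q.2) := by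
  rw [Measure.volume_eq_prod, integral_prod _ (integrable_lam_prod hf hdet β hw), lam]
  simp_rw [integral_const_mul]

lemma integrable_lam {f : Corner m → (Fin m → ℝ) → ℝ} (hf : Nice f)
    {J : Matrix (Idx m) (Fin m) ℝ} (hdet : (Amat J fun _ => 1).det ≠ 0) (β : Idx m → ℕ)
    {w : Idx m → ℝ} (hw : ∀ k, 0 < w k) :
    Integrable fun x => Hprod f x * ∫ p, phi w β (x + J.mulVec p) := by
  have := (integrable_lam_prod hf hdet β hw).integral_prod_left
  simpa only [integral_const_mul] using this

lemma sum_lam {f : Corner m → (Fin m → ℝ) → ℝ} (hf : Nice f)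
    {J : Matrix (Idx m) (Fin m) ℝ} (hdet : (Amat J fun _ => 1).det ≠ 0) (β : Idx m → ℕ)
    {w : Idx m → ℝ} (hw : ∀ k, 0 < w k) (v : Fin m → ℝ) :
    ∑ k, (J.mulVec v k * (w k)⁻¹) * lam f J w (β + Pi.single k 1) = 0 := by
  have e : ∀ k, (J.mulVec v k * (w k)⁻¹) * lam f J w (β + Pi.single k 1) =
      ∫ x, (J.mulVec v k * (w k)⁻¹) *
        (Hprod f x * ∫ p, phi w (β + Pi.single k 1) (x + J.mulVec p)) := fun k => by
    rw [lam, integral_const_mul]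
  simp_rw [e]
  rw [← integral_finsetSum _ fun k _ => (integrable_lam hf hdet _ hw).const_mul _]
  have : ∀ x, ∑ k, (J.mulVec v k * (w k)⁻¹) *
      (Hprod f x * ∫ p, phi w (β + Pi.single k 1) (x + J.mulVec p)) = 0 := by
    intro x
    have h := sum_integral_phi_range hdet β hw x v
    calc _ = Hprod f x * ∑ k, (J.mulVec v k * (w k)⁻¹) *
          ∫ p, phi w (β + Pi.single k 1) (x + J.mulVec p) := by
          rw [Finset.mul_sum]; exact Finset.sum_congr rfl fun k _ => by ring
      _ = 0 := by rw [h, mul_zero]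
  simp_rw [this, integral_zero]

lemma abs_lam_le {f : Corner m → (Fin m → ℝ) → ℝ} (hf : Nice f)
    {J : Matrix (Idx m) (Fin m) ℝ} (hdet : (Amat J fun _ => 1).det ≠ 0) (β : Idx m → ℕ)
    {w : Idx m → ℝ} {a : ℝ} (ha : 0 < a) (hw : ∀ k, a ≤ w k) :
    |lam f J w β| ≤ (∫ x, |Hprod f x|) * (phiConst J β * a⁻¹ ^ m) := by
  have hc : 0 ≤ phiConst J β * a⁻¹ ^ m := mul_nonneg (phiConst_nonneg J β) (by positivity)
  rw [← integral_mul_const]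
  refine (abs_integral_le_integral_abs).trans (integral_mono_of_nonneg
    (Filter.Eventually.of_forall fun x => abs_nonneg _) (hf.integrable_Hprod.abs.mul_const _)
    (Filter.Eventually.of_forall fun x => ?_))
  simp only [abs_mul]
  refine mul_le_mul_of_nonneg_left ?_ (abs_nonneg _)
  have h1 : ‖∫ p, phi w β (x + J.mulVec p)‖ₑ ≤ ENNReal.ofReal (phiConst J β * a⁻¹ ^ m) :=
    (enorm_integral_le_lintegral_enorm _).trans (lintegral_phi_range_le hdet β ha hw x)
  rw [Real.enorm_eq_ofReal_abs] at h1
  exact (ENNReal.ofReal_le_ofReal_iff hc).1 h1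

lemma measurable_lam {f : Corner m → (Fin m → ℝ) → ℝ} (hf : Nice f)
    (J : Matrix (Idx m) (Fin m) ℝ) (β : Idx m → ℕ)
    {Y : Type*} [MeasurableSpace Y] {W : Y → Idx m → ℝ} (hW : Measurable W) :
    Measurable fun y => lam f J (W y) β := by
  unfold lam
  have h1 : Measurable fun q : (Y × (Idx m → ℝ)) × (Fin m → ℝ) =>
      phi (W q.1.1) β (q.1.2 + J.mulVec q.2) :=
    measurable_phi_joint (hW.comp (by fun_prop)) β (by fun_prop)
  have h2 : Measurable fun q : Y × (Idx m → ℝ) => ∫ p, phi (W q.1) β (q.2 + J.mulVec p) :=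
    (h1.stronglyMeasurable.integral_prod_right' (ν := volume)).measurable
  have h3 : Measurable fun q : Y × (Idx m → ℝ) =>
      Hprod f q.2 * ∫ p, phi (W q.1) β (q.2 + J.mulVec p) :=
    (hf.measurable_Hprod.comp measurable_snd).mul h2
  exact (h3.stronglyMeasurable.integral_prod_right' (ν := volume)).measurable

/-! ### Varying some of the widths -/

/-- The widths in `X` multiplied by `r`. -/
def scl (X : Finset (Idx m)) (w : Idx m → ℝ) (r : ℝ) : Idx m → ℝ :=
  fun k => if k ∈ X then r * w k else w k

lemma scl_pos {X : Finset (Idx m)} {w : Idx m → ℝ} (hw : ∀ k, 0 < w k) {r : ℝ} (hr : 0 < r)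
    (k : Idx m) : 0 < scl X w r k := by
  have := hw k
  unfold scl; split_ifs <;> positivity

lemma le_scl {X : Finset (Idx m)} {w : Idx m → ℝ} {a c r : ℝ} (hc : 0 ≤ c) (hw : ∀ k, c ≤ w k)
    (ha0 : 0 ≤ a) (ha : a ≤ 1) (har : a ≤ r) (k : Idx m) : a * c ≤ scl X w r k := by
  unfold scl
  have := hw k
  split_ifs
  · exact mul_le_mul har this hc (ha0.trans har)
  · nlinarith

lemma measurable_scl (X : Finset (Idx m)) (w : Idx m → ℝ) : Measurable (scl X w) := by
  refine measurable_pi_lambda _ fun k => ?_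
  unfold scl
  split_ifs <;> fun_prop

lemma hasDerivAt_scl {X : Finset (Idx m)} {w : Idx m → ℝ} (hw : ∀ k, 0 < w k) (β : Idx m → ℕ)
    (x : Idx m → ℝ) {r : ℝ} (hr : 0 < r) :
    HasDerivAt (fun r => r⁻¹ ^ (∑ k ∈ X, β k) * phi (scl X w r) β x)
      ((2 * Real.pi)⁻¹ * ∑ k ∈ X, r⁻¹ ^ (∑ k ∈ X, β k + 1) *
        phi (scl X w r) (β + Pi.single k 2) x) r := by
  set G : Idx m → ℝ → ℝ := fun k r => (if k ∈ X then r⁻¹ ^ β k else 1) *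
    ((scl X w r k)⁻¹ * hn (β k) (x k / scl X w r k)) with hG
  have hprodX : ∀ r : ℝ, ∏ k : Idx m, (if k ∈ X then r⁻¹ ^ β k else 1) = r⁻¹ ^ (∑ k ∈ X, β k) := by
    intro r
    rw [Finset.prod_ite_mem, Finset.univ_inter, Finset.prod_pow_eq_pow_sum]
  have e1 : (fun r => r⁻¹ ^ (∑ k ∈ X, β k) * phi (scl X w r) β x) = fun r => ∏ k, G k r := by
    funext r
    rw [phi, ← hprodX, ← Finset.prod_mul_distrib]
  have hd : ∀ k ∈ (Finset.univ : Finset (Idx m)), HasDerivAt (G k)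
      (if k ∈ X then (2 * Real.pi)⁻¹ * (r⁻¹ ^ (β k + 1) *
        ((scl X w r k)⁻¹ * hn (β k + 2) (x k / scl X w r k))) else 0) r := by
    intro k _
    by_cases hk : k ∈ X
    · simp only [hG, hk, scl, if_true]
      have h1 := hasDerivAt_scaled_hn (β k) (x k) (mul_pos hr (hw k))
      have h2 : HasDerivAt (fun r => r * w k) (w k) r := by
        simpa using (hasDerivAt_id r).mul_const (w k)
      have h3 := (h1.comp r h2).const_mul (w k ^ β k)
      have hwk := (hw k).ne'
      have e : (fun r => r⁻¹ ^ β k * ((r * w k)⁻¹ * hn (β k) (x k / (r * w k)))) =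
          fun y => w k ^ β k * ((fun w => w⁻¹ ^ (β k + 1) * hn (β k) (x k / w)) ∘
            fun r => r * w k) y := by
        funext r
        simp only [Function.comp, mul_inv, pow_succ, mul_pow, inv_pow]
        field_simp
      rw [e]
      refine h3.congr_deriv ?_
      have : Real.pi ≠ 0 := Real.pi_ne_zero
      have hr' := hr.ne'
      simp only [mul_inv, pow_succ, mul_pow, inv_pow]
      field_simp
    · simp only [hG, hk, scl, if_false]
      exact hasDerivAt_const _ _
  rw [e1]
  refine (HasDerivAt.fun_finsetProd hd).congr_deriv ?_
  simp only [smul_eq_mul, mul_ite, mul_zero]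
  rw [Finset.sum_ite_mem, Finset.univ_inter, Finset.mul_sum]
  refine Finset.sum_congr rfl fun k hk => ?_
  rw [phi_add_single, pow_succ r⁻¹ (∑ k ∈ X, β k), ← hprodX,
      ← Finset.mul_prod_erase _ _ (Finset.mem_univ k), if_pos hk,
    Finset.prod_mul_distrib]
  simp only [pow_succ]
  ring

lemma continuousOn_phi_scl (X : Finset (Idx m)) {w : Idx m → ℝ} (hw : ∀ k, 0 < w k)
    (β : Idx m → ℕ) (x : Idx m → ℝ) :
    ContinuousOn (fun r => phi (scl X w r) β x) (Set.Ioi 0) := by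
  unfold phi
  refine continuousOn_finsetProd _ fun k _ => ?_
  have h1 : ContinuousOn (fun r => scl X w r k) (Set.Ioi 0) := by
    unfold scl; split_ifs <;> fun_prop
  have h2 : ∀ r ∈ Set.Ioi (0 : ℝ), scl X w r k ≠ 0 := fun r hr => (scl_pos hw hr k).ne'
  exact (h1.inv₀ h2).mul ((continuous_hn _).comp_continuousOn (continuousOn_const.div h1 h2))

lemma integral_lam_scl {f : Corner m → (Fin m → ℝ) → ℝ} (hf : Nice f)
    {J : Matrix (Idx m) (Fin m) ℝ} (hdet : (Amat J fun _ => 1).det ≠ 0) (X : Finset (Idx m))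
    (β : Idx m → ℕ) {w : Idx m → ℝ} (hw : ∀ k, 0 < w k) {a b : ℝ} (ha : 0 < a) (hab : a ≤ b) :
    b⁻¹ ^ (∑ k ∈ X, β k) * lam f J (scl X w b) β - a⁻¹ ^ (∑ k ∈ X, β k) * lam f J (scl X w a) β =
      (2 * Real.pi)⁻¹ * ∑ k ∈ X, ∫ r in Set.Ioc a b,
        r⁻¹ ^ (∑ k ∈ X, β k + 1) * lam f J (scl X w r) (β + Pi.single k 2) := by
  set n := ∑ k ∈ X, β k with hn
  have hb : 0 < b := ha.trans_le hab
  obtain ⟨c, hc, hcw⟩ := exists_width_bound hw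
  have hpos : ∀ r ∈ Set.Icc a b, 0 < r := fun r hr => ha.trans_le hr.1
  have hinteg : ∀ k, Integrable (fun q : ℝ × (Idx m → ℝ) × (Fin m → ℝ) => q.1⁻¹ ^ (n + 1) *
      (Hprod f q.2.1 * phi (scl X w q.1) (β + Pi.single k 2) (q.2.1 + J.mulVec q.2.2)))
      ((volume.restrict (Set.Ioc a b)).prod (volume.prod volume)) := by
    intro k
    have h1 := integrable_param hf hdet (β + Pi.single k 2) (ν := volume.restrict (Set.Ioc a b))
      (measurable_scl X w) (a := min a 1 * c) (by positivity) (by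
        filter_upwards [ae_restrict_mem measurableSet_Ioc] with r hr
        exact le_scl hc.le hcw (by positivity) (min_le_right _ _)
          ((min_le_left _ _).trans hr.1.le))
    refine h1.bdd_mul (c := a⁻¹ ^ (n + 1)) (by fun_prop) ?_
    have : ∀ᵐ q ∂((volume.restrict (Set.Ioc a b)).prod
        ((volume : Measure (Idx m → ℝ)).prod (volume : Measure (Fin m → ℝ)))), q.1 ∈ Set.Ioc a b :=
      Measure.quasiMeasurePreserving_fst.ae (ae_restrict_mem measurableSet_Ioc)
    filter_upwards [this] with q hq
    have hq0 : 0 < q.1 := ha.trans hq.1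
    rw [Real.norm_eq_abs, abs_of_pos (by positivity)]
    have := hq.1.le
    gcongr
  have hswap : ∀ k, ∫ r in Set.Ioc a b, r⁻¹ ^ (n + 1) * lam f J (scl X w r) (β + Pi.single k 2) =
      ∫ q : (Idx m → ℝ) × (Fin m → ℝ), ∫ r in Set.Ioc a b, r⁻¹ ^ (n + 1) *
        (Hprod f q.1 * phi (scl X w r) (β + Pi.single k 2) (q.1 + J.mulVec q.2)) := by
    intro k
    rw [Measure.volume_eq_prod, ← integral_integral_swap (hinteg k)]
    refine setIntegral_congr_fun measurableSet_Ioc fun r hr => ?_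
    rw [lam_eq_prod hf hdet _ (scl_pos hw (ha.trans hr.1)), ← integral_const_mul,
      Measure.volume_eq_prod]
  have hiq : ∀ k, Integrable fun q : (Idx m → ℝ) × (Fin m → ℝ) => ∫ r in Set.Ioc a b,
      r⁻¹ ^ (n + 1) *
        (Hprod f q.1 * phi (scl X w r) (β + Pi.single k 2) (q.1 + J.mulVec q.2)) := fun k => by
    rw [Measure.volume_eq_prod]
    exact (hinteg k).integral_prod_right
  simp_rw [hswap]
  rw [← integral_finsetSum _ fun k _ => hiq k, ← integral_const_mul,
    lam_eq_prod hf hdet _ (scl_pos hw hb), lam_eq_prod hf hdet _ (scl_pos hw ha),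
    ← integral_const_mul, ← integral_const_mul, ← integral_sub]
  · refine integral_congr_ae (Filter.Eventually.of_forall fun q => ?_)
    have hc' : ∀ k, ContinuousOn (fun r => r⁻¹ ^ (n + 1) *
        phi (scl X w r) (β + Pi.single k 2) (q.1 + J.mulVec q.2)) (Set.uIcc a b) := fun k => by
      rw [Set.uIcc_of_le hab]
      refine ContinuousOn.mul ?_ ((continuousOn_phi_scl X hw _ _).mono fun r hr => hpos r hr)
      exact (continuousOn_id.inv₀ fun r hr => (hpos r hr).ne').pow _
    have ftc := intervalIntegral.integral_eq_sub_of_hasDerivAt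
      (fun r hr => hasDerivAt_scl (X := X) hw β (q.1 + J.mulVec q.2)
        (hpos r (by rwa [Set.uIcc_of_le hab] at hr)))
      ((continuousOn_const.mul (continuousOn_finsetSum _ fun k _ => hc' k)).intervalIntegrable)
    rw [intervalIntegral.integral_const_mul, intervalIntegral.integral_finsetSum
      fun k _ => (hc' k).intervalIntegrable] at ftc
    simp_rw [intervalIntegral.integral_of_le hab] at ftc
    have e : ∀ r : ℝ, ∀ k, r⁻¹ ^ (n + 1) *
        (Hprod f q.1 * phi (scl X w r) (β + Pi.single k 2) (q.1 + J.mulVec q.2)) =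
        Hprod f q.1 * (r⁻¹ ^ (n + 1) *
          phi (scl X w r) (β + Pi.single k 2) (q.1 + J.mulVec q.2)) := fun r k => by ring
    simp only [e, integral_const_mul, ← Finset.mul_sum]
    rw [mul_left_comm (2 * Real.pi)⁻¹, ftc]
    ring
  · rw [Measure.volume_eq_prod]
    exact (integrable_lam_prod hf hdet _ (scl_pos hw hb)).const_mul _
  · rw [Measure.volume_eq_prod]
    exact (integrable_lam_prod hf hdet _ (scl_pos hw ha)).const_mul _

/-! ### Separating the two coordinates at position `i` -/

/-- The coordinates of `ℝ^{2m}` at positions other than `i`. -/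
abbrev Rest (i : Fin m) := {k : Idx m // ¬(k = Sum.inl i ∨ k = Sum.inr i)}

/-- The two coordinates at position `i`. -/
def slotEquiv (i : Fin m) : Fin 2 ≃ {k : Idx m // k = Sum.inl i ∨ k = Sum.inr i} :=
  Equiv.ofBijective (fun c => ⟨slot i c, by unfold slot; split_ifs <;> simp⟩) <| by
    constructor
    · intro c c' h
      exact (slot_inj.1 (Subtype.ext_iff.1 h)).2
    · rintro ⟨k, rfl | rfl⟩
      · exact ⟨0, rfl⟩
      · exact ⟨1, rfl⟩

/-- Assembling a point of `ℝ^{2m}` from its coordinates at position `i` and the others. -/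
def joinE (i : Fin m) : (Fin 2 → ℝ) × (Rest i → ℝ) ≃ᵐ (Idx m → ℝ) :=
  ((MeasurableEquiv.piCongrLeft (fun _ => ℝ) (slotEquiv i)).prodCongr
    (MeasurableEquiv.refl (Rest i → ℝ))).trans
    (MeasurableEquiv.piEquivPiSubtypeProd (fun _ : Idx m => ℝ)
      (fun k => k = Sum.inl i ∨ k = Sum.inr i)).symm

lemma measurePreserving_joinE (i : Fin m) : MeasurePreserving (joinE i) := by
  refine MeasurePreserving.trans (MeasurePreserving.prod
    (volume_measurePreserving_piCongrLeft (fun _ => ℝ) (slotEquiv i)) (MeasurePreserving.id _)) ?_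
  exact (volume_preserving_piEquivPiSubtypeProd (fun _ : Idx m => ℝ)
      (fun k => k = Sum.inl i ∨ k = Sum.inr i)).symm

lemma joinE_slot (i : Fin m) (c : Fin 2) (u : Fin 2 → ℝ) (z : Rest i → ℝ) :
    joinE i (u, z) (slot i c) = u c := by
  have hp : slot i c = Sum.inl i ∨ slot i c = Sum.inr i := by unfold slot; split_ifs <;> simp
  have h1 : joinE i (u, z) (slot i c) =
      MeasurableEquiv.piCongrLeft (fun _ => ℝ) (slotEquiv i) u ⟨slot i c, hp⟩ := by
    simp [joinE, MeasurableEquiv.piEquivPiSubtypeProd, Equiv.piEquivPiSubtypeProd, hp]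
    rfl
  rw [h1]
  exact Equiv.piCongrLeft_apply_apply (fun _ => ℝ) (slotEquiv i) u c

lemma joinE_rest (i : Fin m) (u : Fin 2 → ℝ) (z : Rest i → ℝ) (k : Rest i) :
    joinE i (u, z) k = z k := by
  simp [joinE, MeasurableEquiv.piEquivPiSubtypeProd, Equiv.piEquivPiSubtypeProd, k.2]
  rfl

/-- The part of `∏_j f_j(Π_j x)` that involves the coordinate `x_i^c = y`. -/
def Psi (f : Corner m → (Fin m → ℝ) → ℝ) (i : Fin m) (c : Fin 2) (y : ℝ) (z : Rest i → ℝ) : ℝ :=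
  ∏ j with j i = c, f j (proj j (joinE i (fun _ => y, z)))

lemma Hprod_joinE (f : Corner m → (Fin m → ℝ) → ℝ) (i : Fin m) (u : Fin 2 → ℝ) (z : Rest i → ℝ) :
    Hprod f (joinE i (u, z)) = ∏ c, Psi f i c (u c) z := by
  rw [Hprod, ← Finset.prod_fiberwise (s := Finset.univ) (g := fun j : Corner m => j i)]
  refine Finset.prod_congr rfl fun c _ => Finset.prod_congr rfl fun j hj => ?_
  congr 1
  funext h
  simp only [proj, sel_eq_slot]
  by_cases hh : h = i
  · subst hh
    rw [joinE_slot, joinE_slot, (Finset.mem_filter.1 hj).2]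
  · have hk : ¬(slot h (j h) = Sum.inl i ∨ slot h (j h) = Sum.inr i) := by
      rintro (h' | h')
      · exact hh (slot_inj.1 (h'.trans (slot_zero i).symm)).1
      · exact hh (slot_inj.1 (h'.trans (slot_one i).symm)).1
    exact (joinE_rest i u z ⟨_, hk⟩).trans (joinE_rest i (fun _ => u c) z ⟨_, hk⟩).symm

/-- The tuple in which position `i` of each corner is frozen at `c`. -/
def freezeF (f : Corner m → (Fin m → ℝ) → ℝ) (i : Fin m) (c : Fin 2) :
    Corner m → (Fin m → ℝ) → ℝ := fun j => f (Function.update j i c)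

/-- The matrix in which both rows at position `i` equal the row `(i, c)` of `J`. -/
def freezeJ (J : Matrix (Idx m) (Fin m) ℝ) (i : Fin m) (c : Fin 2) : Matrix (Idx m) (Fin m) ℝ :=
  fun k => if k = Sum.inl i ∨ k = Sum.inr i then J (slot i c) else J k

lemma freezeJ_slot (J : Matrix (Idx m) (Fin m) ℝ) (i : Fin m) (c c' : Fin 2) :
    freezeJ J i c (slot i c') = J (slot i c) := by
  have hp : slot i c' = Sum.inl i ∨ slot i c' = Sum.inr i := by unfold slot; split_ifs <;> simp
  rw [freezeJ, if_pos hp]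

lemma freezeJ_of_ne (J : Matrix (Idx m) (Fin m) ℝ) {i h : Fin m} (hne : h ≠ i) (c c' : Fin 2) :
    freezeJ J i c (slot h c') = J (slot h c') := by
  have hk : ¬(slot h c' = Sum.inl i ∨ slot h c' = Sum.inr i) := by
    rintro (h' | h')
    · exact hne (slot_inj.1 (h'.trans (slot_zero i).symm)).1
    · exact hne (slot_inj.1 (h'.trans (slot_one i).symm)).1
  rw [freezeJ, if_neg hk]

lemma Amat_freezeJ (J : Matrix (Idx m) (Fin m) ℝ) (i : Fin m) (c : Fin 2) (j : Corner m) :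
    Amat (freezeJ J i c) j = Amat J (Function.update j i c) := by
  ext h k
  simp only [Amat, Matrix.of_apply, sel_eq_slot]
  by_cases hh : h = i
  · subst hh; rw [freezeJ_slot, Function.update_self]
  · rw [freezeJ_of_ne _ hh, Function.update_of_ne hh]

lemma Psi_freezeF (f : Corner m → (Fin m → ℝ) → ℝ) (i : Fin m) (c c' : Fin 2) (y : ℝ)
    (z : Rest i → ℝ) : Psi (freezeF f i c) i c' y z = Psi f i c y z := by
  unfold Psi freezeF
  refine Finset.prod_bij' (fun j _ => Function.update j i c) (fun j _ => Function.update j i c')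
    (by simp) (by simp) ?_ ?_ ?_
  · intro j hj
    rw [Function.update_idem, ← (Finset.mem_filter.1 hj).2, Function.update_eq_self]
  · intro j hj
    rw [Function.update_idem, ← (Finset.mem_filter.1 hj).2, Function.update_eq_self]
  · intro j _
    congr 1
    funext h
    simp only [proj, sel_eq_slot]
    by_cases hh : h = i
    · subst hh; rw [joinE_slot, joinE_slot]
    · rw [Function.update_of_ne hh]

/-- The factor of `phi` not involving the coordinates at position `i`. -/
def restPhi (i : Fin m) (w : Idx m → ℝ) (β : Idx m → ℕ) (x : Idx m → ℝ) : ℝ :=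
  ∏ k : Rest i, (w k)⁻¹ * hn (β k) (x k / w k)

lemma phi_eq_restPhi (i : Fin m) (w : Idx m → ℝ) (β : Idx m → ℕ) (x : Idx m → ℝ) :
    phi w β x = (∏ c, (w (slot i c))⁻¹ * hn (β (slot i c)) (x (slot i c) / w (slot i c))) *
      restPhi i w β x := by
  rw [phi, ← Fintype.prod_subtype_mul_prod_subtype (fun k => k = Sum.inl i ∨ k = Sum.inr i),
    restPhi]
  congr 1
  exact (Fintype.prod_equiv (slotEquiv i) _ _ fun c => rfl).symm

lemma measurable_Psi {f : Corner m → (Fin m → ℝ) → ℝ} (hf : Nice f) (i : Fin m) (c : Fin 2) :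
    Measurable fun q : ℝ × (Rest i → ℝ) => Psi f i c q.1 q.2 := by
  unfold Psi
  refine Finset.measurable_prod _ fun j _ => (hf.meas j).comp ((measurable_proj j).comp
    ((joinE i).measurable.comp ?_))
  exact (measurable_pi_lambda _ fun _ => measurable_fst).prodMk measurable_snd

lemma exists_Psi_bound {f : Corner m → (Fin m → ℝ) → ℝ} (hf : Nice f) :
    ∃ C, ∀ i c y z, |Psi f i c y z| ≤ C := by
  obtain ⟨C, hC⟩ := hf.bdd
  refine ⟨max 1 C ^ Fintype.card (Corner m), fun i c y z => ?_⟩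
  rw [Psi, Finset.abs_prod]
  calc _ ≤ ∏ j : Corner m with j i = c, max 1 C :=
        Finset.prod_le_prod (fun _ _ => abs_nonneg _) fun j _ => (hC j _).trans (le_max_right _ _)
    _ ≤ _ := by
        rw [Finset.prod_const]
        exact pow_le_pow_right₀ (le_max_left _ _) (Finset.card_filter_le _ _)

/-- The integral in one of the coordinates at position `i`. -/
def slotInt (ψ : ℝ → ℝ) (ω : ℝ) (n : ℕ) (s : ℝ) : ℝ := ∫ y, ψ y * (ω⁻¹ * hn n ((y + s) / ω))

lemma integrable_Hprod_mul {f : Corner m → (Fin m → ℝ) → ℝ} (hf : Nice f) (w : Idx m → ℝ)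
    (hw : ∀ k, 0 < w k) (β : Idx m → ℕ) (x₀ : Idx m → ℝ) :
    Integrable fun x => Hprod f x * phi w β (x + x₀) := by
  refine hf.integrable_Hprod.mul_bdd (c := ∏ k, (w k)⁻¹ * hC (β k))
    (by fun_prop) (Filter.Eventually.of_forall fun x => ?_)
  rw [phi, Real.norm_eq_abs, Finset.abs_prod]
  refine Finset.prod_le_prod (fun _ _ => abs_nonneg _) fun k _ => ?_
  have := hw k
  rw [abs_mul, abs_of_pos (inv_pos.mpr this)]
  gcongr
  exact abs_hn_le_const _ _

section Split

variable {f : Corner m → (Fin m → ℝ) → ℝ} {w : Idx m → ℝ} (i : Fin m)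

/-- The integrand of `lam` after integrating out the coordinates at position `i`. -/
def splitInt (f : Corner m → (Fin m → ℝ) → ℝ) (J : Matrix (Idx m) (Fin m) ℝ) (w : Idx m → ℝ)
    (β : Idx m → ℕ) (i : Fin m) (z : Rest i → ℝ) (p : Fin m → ℝ) : ℝ :=
  (∏ c, slotInt (fun y => Psi f i c y z) (w (slot i c)) (β (slot i c)) (J.mulVec p (slot i c))) *
    restPhi i w β (joinE i (0, z) + J.mulVec p)

lemma integrand_joinE (J : Matrix (Idx m) (Fin m) ℝ) (β : Idx m → ℕ) (p : Fin m → ℝ)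
    (u : Fin 2 → ℝ) (z : Rest i → ℝ) :
    Hprod f (joinE i (u, z)) * phi w β (joinE i (u, z) + J.mulVec p) =
      (∏ c, Psi f i c (u c) z * ((w (slot i c))⁻¹ *
        hn (β (slot i c)) ((u c + J.mulVec p (slot i c)) / w (slot i c)))) *
      restPhi i w β (joinE i (0, z) + J.mulVec p) := by
  rw [Hprod_joinE, phi_eq_restPhi i, ← mul_assoc, ← Finset.prod_mul_distrib]
  congr 1
  · refine Finset.prod_congr rfl fun c _ => ?_
    rw [Pi.add_apply, joinE_slot]
  · refine Finset.prod_congr rfl fun k _ => ?_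
    rw [Pi.add_apply, Pi.add_apply, joinE_rest, joinE_rest]

lemma integrable_joinE (hf : Nice f) (J : Matrix (Idx m) (Fin m) ℝ)
    (hw : ∀ k, 0 < w k) (β : Idx m → ℕ) (p : Fin m → ℝ) :
    Integrable (fun q : (Fin 2 → ℝ) × (Rest i → ℝ) =>
      Hprod f (joinE i q) * phi w β (joinE i q + J.mulVec p)) (volume.prod volume) := by
  have := (measurePreserving_joinE i).integrable_comp_of_integrable
    (integrable_Hprod_mul hf w hw β (J.mulVec p))
  exact this

lemma integral_joinE_fst (J : Matrix (Idx m) (Fin m) ℝ)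
    (β : Idx m → ℕ) (p : Fin m → ℝ) (z : Rest i → ℝ) :
    ∫ u : Fin 2 → ℝ, Hprod f (joinE i (u, z)) * phi w β (joinE i (u, z) + J.mulVec p) =
      splitInt f J w β i z p := by
  simp_rw [integrand_joinE, integral_mul_const, splitInt, slotInt]
  congr 1
  exact integral_fintype_prod_volume_eq_prod (fun c y => Psi f i c y z * ((w (slot i c))⁻¹ *
        hn (β (slot i c)) ((y + J.mulVec p (slot i c)) / w (slot i c))))

lemma integrable_splitInt (hf : Nice f) (J : Matrix (Idx m) (Fin m) ℝ)
    (hw : ∀ k, 0 < w k) (β : Idx m → ℕ) (p : Fin m → ℝ) :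
    Integrable fun z => splitInt f J w β i z p := by
  have := (integrable_joinE i hf J hw β p).integral_prod_right
  simpa only [integral_joinE_fst] using this

lemma integral_splitInt (hf : Nice f) (J : Matrix (Idx m) (Fin m) ℝ)
    (hw : ∀ k, 0 < w k) (β : Idx m → ℕ) (p : Fin m → ℝ) :
    ∫ x, Hprod f x * phi w β (x + J.mulVec p) = ∫ z, splitInt f J w β i z p := by
  rw [← (measurePreserving_joinE i).integral_comp' (g := fun x =>
    Hprod f x * phi w β (x + J.mulVec p)), Measure.volume_eq_prod,
    integral_prod_symm _ (integrable_joinE i hf J hw β p)]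
  simp_rw [integral_joinE_fst]

lemma integrable_integral_splitInt (hf : Nice f) {J : Matrix (Idx m) (Fin m) ℝ}
    (hdet : (Amat J fun _ => 1).det ≠ 0) (hw : ∀ k, 0 < w k) (β : Idx m → ℕ) :
    Integrable fun p => ∫ z, splitInt f J w β i z p := by
  have := (integrable_lam_prod hf hdet β hw).integral_prod_right
  simpa only [integral_splitInt i hf J hw β] using this

lemma lam_eq_splitInt (hf : Nice f) {J : Matrix (Idx m) (Fin m) ℝ}
    (hdet : (Amat J fun _ => 1).det ≠ 0) (hw : ∀ k, 0 < w k) (β : Idx m → ℕ) :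
    lam f J w β = ∫ p, ∫ z, splitInt f J w β i z p := by
  rw [lam_eq_prod hf hdet β hw, Measure.volume_eq_prod,
    integral_prod_symm _ (integrable_lam_prod hf hdet β hw)]
  simp_rw [integral_splitInt i hf J hw β]

end Split

/-! ### Cauchy–Schwarz in one coordinate -/

lemma slotInt_succ {ψ : ℝ → ℝ} (hψ : Measurable ψ) {C : ℝ} (hb : ∀ y, |ψ y| ≤ C)
    {ω : ℝ} (hω : 0 < ω) (n : ℕ) (s : ℝ) :
    slotInt ψ ω (n + 1) s = (2 * √2 ^ n * ω⁻¹) *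
      ∫ u, hn n (√2 * (u / ω)) * slotInt ψ (ω / √2) 1 (s - u) := by
  have h2 : (0 : ℝ) < √2 := by positivity
  set g : ℝ → ℝ := fun y => (ω / √2)⁻¹ * hn 1 ((y + s) / (ω / √2)) with hg
  set f : ℝ → ℝ := fun u => hn n (√2 * (u / ω)) with hf
  have hfi : Integrable f := by
    have := (integrable_hn_comp_mul n h2.ne').comp_div hω.ne'
    exact this
  have hgi : Integrable g := (integrable_hn_div 1 (div_pos hω h2)).comp_add_right s
  have hconv := hfi.convolution_integrand (ContinuousLinearMap.mul ℝ ℝ) hgi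
  have hprod : Integrable (fun q : ℝ × ℝ => ψ q.1 * (f q.2 * g (q.1 - q.2)))
      (volume.prod volume) := by
    refine Integrable.bdd_mul (c := C) ?_ (hψ.comp measurable_fst).aestronglyMeasurable
      (Filter.Eventually.of_forall fun q => hb _)
    simpa using hconv
  have key : ∀ y, ω⁻¹ * hn (n + 1) ((y + s) / ω) = (2 * √2 ^ n * ω⁻¹) * ∫ u, f u * g (y - u) := by
    intro y
    rw [hn_succ_eq_conv]
    have e := Measure.integral_comp_div
      (fun u => hn n (√2 * u) * hn 1 (√2 * ((y + s) / ω - u))) ω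
    have e2 : ∀ u, f u * g (y - u) = (ω / √2)⁻¹ *
        (hn n (√2 * (u / ω)) * hn 1 (√2 * ((y + s) / ω - u / ω))) := by
      intro u
      have : (y - u + s) / (ω / √2) = √2 * ((y + s) / ω - u / ω) := by
        field_simp; ring
      rw [hf, hg]
      simp only [this]
      ring
    simp_rw [e2]
    rw [integral_const_mul, e, abs_of_pos hω, smul_eq_mul, pow_succ]
    field_simp
  calc slotInt ψ ω (n + 1) s = ∫ y, (2 * √2 ^ n * ω⁻¹) * ∫ u, ψ y * (f u * g (y - u)) := by
        rw [slotInt]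
        refine integral_congr_ae (Filter.Eventually.of_forall fun y => ?_)
        simp only
        rw [key, integral_const_mul]; ring
    _ = _ := by
        rw [integral_const_mul, integral_integral_swap hprod]
        congr 1
        refine integral_congr_ae (Filter.Eventually.of_forall fun u => ?_)
        simp only [slotInt]
        rw [← integral_const_mul]
        refine integral_congr_ae (Filter.Eventually.of_forall fun y => ?_)
        simp only [hg]
        rw [sub_add_eq_add_sub, ← add_sub_assoc]
        ring

/-- Cauchy–Schwarz with a weight. -/
lemma sq_lintegral_mul_le {X : Type*} [MeasurableSpace X] {μ : Measure X} {f g : X → ℝ≥0∞}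
    (hf : Measurable f) (hg : Measurable g) :
    (∫⁻ x, f x * g x ∂μ) ^ 2 ≤ (∫⁻ x, f x ∂μ) * ∫⁻ x, f x * g x ^ 2 ∂μ := by
  have h := ENNReal.lintegral_mul_norm_pow_le (μ := μ) (f := f) (g := fun x => f x * g x ^ 2)
    hf.aemeasurable (hf.mul (hg.pow_const 2)).aemeasurable (p := 1 / 2) (q := 1 / 2)
    (by norm_num) (by norm_num) (by norm_num)
  have e : ∀ x, f x ^ (1 / 2 : ℝ) * (f x * g x ^ 2) ^ (1 / 2 : ℝ) = f x * g x := by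
    intro x
    have h2 : (f x * (f x * g x ^ 2)) = (f x * g x) ^ (2 : ℝ) := by
      rw [ENNReal.rpow_two]; ring
    rw [← ENNReal.mul_rpow_of_nonneg _ _ (by norm_num), h2, ← ENNReal.rpow_mul]
    norm_num
  simp_rw [e] at h
  calc _ ≤ ((∫⁻ x, f x ∂μ) ^ (1 / 2 : ℝ) * (∫⁻ x, f x * g x ^ 2 ∂μ) ^ (1 / 2 : ℝ)) ^ 2 := by
        gcongr
    _ = _ := by
        rw [← ENNReal.mul_rpow_of_nonneg _ _ (by norm_num), ← ENNReal.rpow_two,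
          ← ENNReal.rpow_mul]
        norm_num

lemma measurable_slotInt {Z : Type*} [MeasurableSpace Z] {ψ : ℝ → Z → ℝ}
    (hψ : Measurable (Function.uncurry ψ)) (ω : ℝ) (n : ℕ) :
    Measurable fun q : Z × ℝ => slotInt (fun y => ψ y q.1) ω n q.2 := by
  unfold slotInt
  have h1 : Measurable fun q : (Z × ℝ) × ℝ => ψ q.2 q.1.1 * (ω⁻¹ * hn n ((q.2 + q.1.2) / ω)) := by
    have := (continuous_hn n).measurable
    have h2 : Measurable fun q : (Z × ℝ) × ℝ => ψ q.2 q.1.1 :=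
      hψ.comp (measurable_snd.prodMk (measurable_fst.comp measurable_fst))
    fun_prop
  exact (h1.stronglyMeasurable.integral_prod_right' (ν := volume)).measurable

/-- The constant in `slotInt_succ_sq_le`. -/
def csC (n : ℕ) : ℝ := (2 * √2 ^ n) ^ 2 * ∫ u, |hn n (√2 * u)|

lemma csC_nonneg (n : ℕ) : 0 ≤ csC n :=
  mul_nonneg (by positivity) (integral_nonneg fun _ => abs_nonneg _)

lemma slotInt_succ_sq_le {ψ : ℝ → ℝ} (hψ : Measurable ψ) {C : ℝ} (hb : ∀ y, |ψ y| ≤ C)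
    {ω : ℝ} (hω : 0 < ω) (n : ℕ) (s : ℝ) :
    ‖slotInt ψ ω (n + 1) s‖ₑ ^ 2 ≤ ENNReal.ofReal (csC n * ω⁻¹) *
      ∫⁻ u, ‖hn n (√2 * (u / ω))‖ₑ * ‖slotInt ψ (ω / √2) 1 (s - u)‖ₑ ^ 2 := by
  have h2 : (0 : ℝ) < √2 := by positivity
  have hξ : Measurable fun u => ‖slotInt ψ (ω / √2) 1 (s - u)‖ₑ := by
    have := measurable_slotInt (Z := Unit) (ψ := fun y _ => ψ y) (hψ.comp measurable_fst)
      (ω / √2) 1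
    exact (this.comp (f := fun u : ℝ => ((), s - u)) (by fun_prop)).enorm
  have hh : Measurable fun u : ℝ => ‖hn n (√2 * (u / ω))‖ₑ := by
    have := (continuous_hn n).measurable
    fun_prop
  rw [slotInt_succ hψ hb hω, enorm_mul, mul_pow]
  have hI : ∫⁻ u, ‖hn n (√2 * (u / ω))‖ₑ = ENNReal.ofReal (ω * ∫ u, |hn n (√2 * u)|) := by
    have hi : Integrable fun u : ℝ => hn n (√2 * (u / ω)) :=
      (integrable_hn_comp_mul n h2.ne').comp_div hω.ne'
    have e := Measure.integral_comp_div (fun u => |hn n (√2 * u)|) ω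
    rw [abs_of_pos hω, smul_eq_mul] at e
    rw [← e, ← ofReal_integral_norm_eq_lintegral_enorm hi]
    rfl
  have hcs : ‖∫ u, hn n (√2 * (u / ω)) * slotInt ψ (ω / √2) 1 (s - u)‖ₑ ^ 2 ≤
      ENNReal.ofReal (ω * ∫ u, |hn n (√2 * u)|) *
      ∫⁻ u, ‖hn n (√2 * (u / ω))‖ₑ * ‖slotInt ψ (ω / √2) 1 (s - u)‖ₑ ^ 2 := by
    rw [← hI]
    refine le_trans ?_ (sq_lintegral_mul_le hh hξ)
    gcongr
    refine (enorm_integral_le_lintegral_enorm _).trans_eq ?_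
    simp_rw [enorm_mul]
  refine (mul_le_mul' le_rfl hcs).trans_eq ?_
  rw [← mul_assoc]
  congr 1
  have hκ : 0 ≤ 2 * √2 ^ n * ω⁻¹ := by positivity
  rw [Real.enorm_eq_ofReal_abs, abs_of_nonneg hκ, ← ENNReal.ofReal_pow hκ,
    ← ENNReal.ofReal_mul (by positivity), csC]
  congr 1
  field_simp

/-! ### Shifting the remaining Gaussians -/

/-- The dilation factor for the widths away from position `i`. -/
def csL (m : ℕ) (K : ℝ) : ℝ := √(2 * (1 + 2 * m * K ^ 2))

lemma csL_ge_one (m : ℕ) (K : ℝ) : 1 ≤ csL m K := by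
  rw [csL, Real.one_le_sqrt]
  nlinarith [mul_nonneg (Nat.cast_nonneg (α := ℝ) m) (sq_nonneg K)]

lemma csL_pos (m : ℕ) (K : ℝ) : 0 < csL m K := one_pos.trans_le (csL_ge_one m K)

lemma hn_shift_le (hm : 1 ≤ m) {K : ℝ} (hK : 1 ≤ K) {ω : ℝ} (hω : 0 < ω) (n : ℕ) {κ : ℝ}
    (hκ : |κ| ≤ K) (X u : ℝ) :
    |ω⁻¹ * hn n ((X + u * κ) / ω)| ≤ max 1 (hC n * csL m K) *
      ((csL m K * ω)⁻¹ * hn 0 (X / (csL m K * ω))) *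
        Real.exp ((Real.pi / 2 * (u / ω) ^ 2) * (2 * m : ℝ)⁻¹) := by
  have hL := csL_pos m K
  have hm0 : (0 : ℝ) < m := by exact_mod_cast hm
  have hL2 : csL m K ^ 2 = 2 * (1 + 2 * m * K ^ 2) := by
    rw [csL, Real.sq_sqrt (by positivity)]
  rw [abs_mul, abs_of_pos (inv_pos.mpr hω)]
  have h1 := abs_hn_le n ((X + u * κ) / ω)
  have hexp : Real.exp (-(Real.pi / 2) * ((X + u * κ) / ω) ^ 2) ≤
      hn 0 (X / (csL m K * ω)) * Real.exp ((Real.pi / 2 * (u / ω) ^ 2) * (2 * m : ℝ)⁻¹) := by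
    rw [hn_zero, ← Real.exp_add, Real.exp_le_exp]
    set a := X / ω with ha
    set b := u / ω with hb
    have e1 : (X + u * κ) / ω = a + b * κ := by rw [ha, hb]; field_simp
    have e2 : X / (csL m K * ω) = a / csL m K := by rw [ha]; field_simp
    rw [e1, e2, div_pow, hL2]
    have hδ : (0 : ℝ) < 2 * m * K ^ 2 := by positivity
    set δ : ℝ := 2 * m * K ^ 2 with hδdef
    have hm' : (2 * m : ℝ)⁻¹ = K ^ 2 / δ := by rw [hδdef]; field_simp
    have hκ2 : κ ^ 2 ≤ K ^ 2 := sq_le_sq' (by linarith [abs_le.1 hκ]) (abs_le.1 hκ).2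
    have main : a ^ 2 / (1 + δ) - b ^ 2 * (K ^ 2 / δ) ≤ (a + b * κ) ^ 2 := by
      have h3 : a ^ 2 / (1 + δ) - (b * κ) ^ 2 / δ ≤ (a + b * κ) ^ 2 := by
        set y := b * κ
        have : (a + y) ^ 2 - (a ^ 2 / (1 + δ) - y ^ 2 / δ) =
            (δ * a + (1 + δ) * y) ^ 2 / (δ * (1 + δ)) := by
          field_simp; ring
        have h4 : 0 ≤ (δ * a + (1 + δ) * y) ^ 2 / (δ * (1 + δ)) := by positivity
        linarith
      have h5 : (b * κ) ^ 2 / δ ≤ b ^ 2 * (K ^ 2 / δ) := by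
        rw [mul_pow, mul_div_assoc]
        gcongr
      linarith
    rw [hm']
    have hpi := Real.pi_pos
    have e3 : -Real.pi * (a ^ 2 / (2 * (1 + δ))) = -(Real.pi / 2) * (a ^ 2 / (1 + δ)) := by
      field_simp
    rw [e3]
    nlinarith
  calc ω⁻¹ * |hn n ((X + u * κ) / ω)| ≤ ω⁻¹ * (hC n * (hn 0 (X / (csL m K * ω)) *
        Real.exp ((Real.pi / 2 * (u / ω) ^ 2) * (2 * m : ℝ)⁻¹))) := by
        refine mul_le_mul_of_nonneg_left ?_ (by positivity)
        exact h1.trans (mul_le_mul_of_nonneg_left hexp (hC_nonneg n))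
    _ = (hC n * csL m K) * ((csL m K * ω)⁻¹ * hn 0 (X / (csL m K * ω))) *
        Real.exp ((Real.pi / 2 * (u / ω) ^ 2) * (2 * m : ℝ)⁻¹) := by
        field_simp
    _ ≤ _ := by
        have := (hn_zero_pos (X / (csL m K * ω))).le
        gcongr
        exact le_max_right _ _

/-- The compatibility between the widths, orders and shift directions away from position `i`. -/
def RestCompat (i : Fin m) (K ω : ℝ) (w w' : Idx m → ℝ) (β : Idx m → ℕ) (κ : Idx m → ℝ) : Prop :=
  ∀ k : Rest i, (β k = 0 ∧ κ k = 0 ∧ w' k = w k) ∨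
    (w k = ω ∧ |κ k| ≤ K ∧ w' k = csL m K * ω)

/-- The constant in `restPhi_shift_le`. -/
def restC (m : ℕ) (K : ℝ) (β : Idx m → ℕ) : ℝ := ∏ k, max 1 (hC (β k) * csL m K)

lemma restC_nonneg (K : ℝ) (β : Idx m → ℕ) : 0 ≤ restC m K β :=
  Finset.prod_nonneg fun _ _ => zero_le_one.trans (le_max_left _ _)

lemma restPhi_zero_nonneg (i : Fin m) {w : Idx m → ℝ} (hw : ∀ k, 0 < w k) (x : Idx m → ℝ) :
    0 ≤ restPhi i w 0 x := by
  refine Finset.prod_nonneg fun k _ => ?_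
  have := hw k
  have := (hn_zero_pos (x k / w k)).le
  simp only [Pi.zero_apply]
  positivity

lemma restPhi_shift_le (hm : 1 ≤ m) (i : Fin m) {K : ℝ} (hK : 1 ≤ K) {ω : ℝ} (hω : 0 < ω)
    {w w' : Idx m → ℝ} (hw : ∀ k, 0 < w k) (hw' : ∀ k, 0 < w' k) {β : Idx m → ℕ} {κ : Idx m → ℝ}
    (hc : RestCompat i K ω w w' β κ) (x : Idx m → ℝ) (u : ℝ) :
    |restPhi i w β (x + u • κ)| ≤ restC m K β * restPhi i w' 0 x *
      Real.exp (Real.pi / 2 * (u / ω) ^ 2) := by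
  have hm0 : (0 : ℝ) < m := by exact_mod_cast hm
  set θ : ℝ := Real.pi / 2 * (u / ω) ^ 2 with hθ
  have hθ0 : 0 ≤ θ := by positivity
  have hpt : ∀ k : Rest i, |(w k)⁻¹ * hn (β k) ((x + u • κ) k / w k)| ≤
      max 1 (hC (β k) * csL m K) * ((w' k)⁻¹ * hn 0 (x k / w' k)) *
        Real.exp (θ * (2 * m : ℝ)⁻¹) := by
    intro k
    rcases hc k with ⟨h1, h2, h3⟩ | ⟨h1, h2, h3⟩
    · have hpos : 0 ≤ (w k)⁻¹ * hn 0 (x k / w k) :=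
        mul_nonneg (inv_nonneg.mpr (hw k).le) (hn_zero_pos _).le
      have e : (x + u • κ) k = x k := by simp [h2]
      rw [e, h1, h3, abs_of_nonneg hpos]
      have ha : (1 : ℝ) ≤ max 1 (hC 0 * csL m K) := le_max_left _ _
      have hb : 1 ≤ Real.exp (θ * (2 * m : ℝ)⁻¹) := Real.one_le_exp (by positivity)
      nlinarith [mul_le_mul ha hb zero_le_one (by linarith)]
    · rw [h1, h3]
      exact hn_shift_le hm hK hω (β k) h2 (x k) u
  have hcard : Fintype.card (Rest i) ≤ 2 * m := by
    refine (Fintype.card_subtype_le _).trans_eq ?_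
    simp [two_mul]
  rw [restPhi, Finset.abs_prod]
  calc _ ≤ ∏ k : Rest i, (max 1 (hC (β k) * csL m K) * ((w' k)⁻¹ * hn 0 (x k / w' k)) *
        Real.exp (θ * (2 * m : ℝ)⁻¹)) :=
        Finset.prod_le_prod (fun _ _ => abs_nonneg _) fun k _ => hpt k
    _ = (∏ k : Rest i, max 1 (hC (β k) * csL m K)) * restPhi i w' 0 x *
        Real.exp (θ * (2 * m : ℝ)⁻¹) ^ Fintype.card (Rest i) := by
        rw [Finset.prod_mul_distrib, Finset.prod_mul_distrib, Finset.prod_const, Finset.card_univ]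
        rfl
    _ ≤ _ := by
        refine mul_le_mul (mul_le_mul_of_nonneg_right ?_ (restPhi_zero_nonneg i hw' x)) ?_
          (by positivity) (mul_nonneg (restC_nonneg K β) (restPhi_zero_nonneg i hw' x))
        · rw [restC, ← Fintype.prod_subtype_mul_prod_subtype
            (fun k => k = Sum.inl i ∨ k = Sum.inr i)]
          refine le_mul_of_one_le_left (Finset.prod_nonneg fun _ _ =>
            zero_le_one.trans (le_max_left _ _)) ?_
          exact Finset.one_le_prod fun _ _ => le_max_left _ _
        · rw [← Real.exp_nat_mul, Real.exp_le_exp]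
          have : (Fintype.card (Rest i) : ℝ) ≤ 2 * m := by exact_mod_cast hcard
          calc (Fintype.card (Rest i) : ℝ) * (θ * (2 * m : ℝ)⁻¹)
              ≤ (2 * m) * (θ * (2 * m : ℝ)⁻¹) := by
                gcongr
            _ = θ := by field_simp

/-! ### Cauchy–Schwarz for the forms -/

/-- One derivative in each of the two coordinates at position `i`. -/
def pairB (i : Fin m) : Idx m → ℕ := fun k => if k = Sum.inl i ∨ k = Sum.inr i then 1 else 0

lemma pairB_slot (i : Fin m) (c : Fin 2) : pairB i (slot i c) = 1 := by
  have hp : slot i c = Sum.inl i ∨ slot i c = Sum.inr i := by unfold slot; split_ifs <;> simp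
  rw [pairB, if_pos hp]

lemma restPhi_pairB (i : Fin m) (w : Idx m → ℝ) (x : Idx m → ℝ) :
    restPhi i w (pairB i) x = restPhi i w 0 x :=
  Finset.prod_congr rfl fun k _ => by rw [pairB, if_neg k.2, Pi.zero_apply]

lemma restPhi_congr (i : Fin m) (w : Idx m → ℝ) (β : Idx m → ℕ) {x y : Idx m → ℝ}
    (h : ∀ k : Rest i, x k = y k) : restPhi i w β x = restPhi i w β y :=
  Finset.prod_congr rfl fun k _ => by rw [h k]

lemma mulVec_freezeJ_slot (J : Matrix (Idx m) (Fin m) ℝ) (i : Fin m) (c c' : Fin 2)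
    (p : Fin m → ℝ) : (freezeJ J i c).mulVec p (slot i c') = J.mulVec p (slot i c) := by
  simp only [Matrix.mulVec, freezeJ_slot]

lemma mulVec_freezeJ_rest (J : Matrix (Idx m) (Fin m) ℝ) (i : Fin m) (c : Fin 2)
    (p : Fin m → ℝ) (k : Rest i) : (freezeJ J i c).mulVec p k = J.mulVec p k := by
  have : freezeJ J i c k = J k := by rw [freezeJ, if_neg k.2]
  simp only [Matrix.mulVec, this]

lemma splitInt_freeze (f : Corner m → (Fin m → ℝ) → ℝ) (J : Matrix (Idx m) (Fin m) ℝ)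
    (i : Fin m) (c : Fin 2) {w : Idx m → ℝ} {σ : ℝ} (hσ : ∀ c, w (slot i c) = σ)
    (z : Rest i → ℝ) (p : Fin m → ℝ) :
    splitInt (freezeF f i c) (freezeJ J i c) w (pairB i) i z p =
      (slotInt (fun y => Psi f i c y z) σ 1 (J.mulVec p (slot i c))) ^ 2 *
        restPhi i w 0 (joinE i (0, z) + J.mulVec p) := by
  simp only [splitInt, Psi_freezeF, hσ, pairB_slot, mulVec_freezeJ_slot, Finset.prod_const,
    Finset.card_univ, Fintype.card_fin, restPhi_pairB]
  congr 1
  refine restPhi_congr _ _ _ fun k => ?_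
  rw [Pi.add_apply, Pi.add_apply, mulVec_freezeJ_rest]

lemma Nice.freezeF {f : Corner m → (Fin m → ℝ) → ℝ} (hf : Nice f) (i : Fin m) (c : Fin 2) :
    Nice (freezeF f i c) := by
  obtain ⟨h1, ⟨C, hC⟩, R, hR⟩ := hf
  exact ⟨fun j => h1 _, ⟨C, fun j => hC _⟩, R, fun j => hR _⟩

/-- The frozen forms are integrals of squares. -/
lemma ofReal_lam_freeze {f : Corner m → (Fin m → ℝ) → ℝ} (hf : Nice f)
    {J : Matrix (Idx m) (Fin m) ℝ} (hdet : ∀ j, (Amat J j).det ≠ 0) (i : Fin m) (c : Fin 2)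
    {w : Idx m → ℝ} (hw : ∀ k, 0 < w k) {σ : ℝ} (hσ : ∀ c, w (slot i c) = σ) :
    0 ≤ lam (freezeF f i c) (freezeJ J i c) w (pairB i) ∧
    ENNReal.ofReal (lam (freezeF f i c) (freezeJ J i c) w (pairB i)) =
      ∫⁻ p, ∫⁻ z, ‖slotInt (fun y => Psi f i c y z) σ 1 (J.mulVec p (slot i c))‖ₑ ^ 2 *
        ENNReal.ofReal (restPhi i w 0 (joinE i (0, z) + J.mulVec p)) := by
  have hdet' : (Amat (freezeJ J i c) fun _ => 1).det ≠ 0 := by rw [Amat_freezeJ]; exact hdet _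
  have hnn : ∀ z p, 0 ≤ splitInt (freezeF f i c) (freezeJ J i c) w (pairB i) i z p := by
    intro z p
    rw [splitInt_freeze f J i c hσ]
    exact mul_nonneg (sq_nonneg _) (restPhi_zero_nonneg i hw _)
  have hnn2 : ∀ p, 0 ≤ ∫ z, splitInt (freezeF f i c) (freezeJ J i c) w (pairB i) i z p :=
    fun p => integral_nonneg fun z => hnn z p
  rw [lam_eq_splitInt i (hf.freezeF i c) hdet' hw]
  refine ⟨integral_nonneg hnn2, ?_⟩
  rw [ofReal_integral_eq_lintegral_ofReal
      (integrable_integral_splitInt i (hf.freezeF i c) hdet' hw _)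
      (Filter.Eventually.of_forall hnn2)]
  refine lintegral_congr fun p => ?_
  rw [ofReal_integral_eq_lintegral_ofReal (integrable_splitInt i (hf.freezeF i c) _ hw _ p)
    (Filter.Eventually.of_forall fun z => hnn z p)]
  refine lintegral_congr fun z => ?_
  rw [splitInt_freeze f J i c hσ, ENNReal.ofReal_mul (sq_nonneg _), ← sq_abs,
    ENNReal.ofReal_pow (abs_nonneg _), Real.enorm_eq_ofReal_abs]

lemma measurable_restPhi (i : Fin m) (w : Idx m → ℝ) (β : Idx m → ℕ) :
    Measurable (restPhi i w β) := by
  unfold restPhi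
  refine Finset.measurable_prod _ fun k _ => ?_
  have := (continuous_hn (β k)).measurable
  fun_prop

lemma lintegral_exp_div {ω : ℝ} (hω : 0 < ω) :
    ∫⁻ u : ℝ, ENNReal.ofReal (Real.exp (-(Real.pi / 2) * (u / ω) ^ 2)) =
      ENNReal.ofReal (√2 * ω) := by
  have hpi := Real.pi_pos
  have hi : Integrable fun u : ℝ => Real.exp (-(Real.pi / 2) * (u / ω) ^ 2) :=
    (integrable_exp_neg_mul_sq (by positivity : 0 < Real.pi / 2)).comp_div hω.ne'
  rw [← ofReal_integral_eq_lintegral_ofReal hi (Filter.Eventually.of_forall fun _ =>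
    (Real.exp_pos _).le), Measure.integral_comp_div
      (fun u : ℝ => Real.exp (-(Real.pi / 2) * u ^ 2)), integral_gaussian, abs_of_pos hω,
      smul_eq_mul, mul_comm]
  congr 3
  field_simp

/-- The one-sided estimate behind the Cauchy–Schwarz inequality. -/
lemma lintegral_slot_sq_le (hm : 1 ≤ m) (J : Matrix (Idx m) (Fin m) ℝ) (i : Fin m) (c : Fin 2)
    {K : ℝ} (hK : 1 ≤ K) {ω : ℝ} (hω : 0 < ω) {w w' : Idx m → ℝ} (hw : ∀ k, 0 < w k)
    (hw' : ∀ k, 0 < w' k) {β : Idx m → ℕ} {v : Fin m → ℝ} (hv : J.mulVec v (slot i c) = 1)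
    (hc : RestCompat i K ω w w' β (J.mulVec v)) {ψ : ℝ → ℝ} (hψ : Measurable ψ) {B : ℝ}
    (hb : ∀ y, |ψ y| ≤ B) (n : ℕ) (x : Idx m → ℝ) :
    ∫⁻ p, ‖slotInt ψ ω (n + 1) (J.mulVec p (slot i c))‖ₑ ^ 2 *
        ‖restPhi i w β (x + J.mulVec p)‖ₑ ≤
      ENNReal.ofReal (csC n * hC n * restC m K β * √2) *
        ∫⁻ p, ‖slotInt ψ (ω / √2) 1 (J.mulVec p (slot i c))‖ₑ ^ 2 *
          ENNReal.ofReal (restPhi i w' 0 (x + J.mulVec p)) := by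
  set s := slot i c with hs
  set ξ : ℝ → ℝ≥0∞ := fun σ => ‖slotInt ψ (ω / √2) 1 σ‖ₑ ^ 2 with hξ
  set F : ℝ → ℝ≥0∞ := fun u => ‖hn n (√2 * (u / ω))‖ₑ with hF
  set R : (Fin m → ℝ) → ℝ≥0∞ := fun p => ‖restPhi i w β (x + J.mulVec p)‖ₑ with hR
  have hξm : Measurable ξ := by
    have := measurable_slotInt (Z := Unit) (ψ := fun y _ => ψ y) (hψ.comp measurable_fst)
      (ω / √2) 1
    exact (this.comp (f := fun u : ℝ => ((), u)) (by fun_prop)).enorm.pow_const 2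
  have hFm : Measurable F := by
    have := (continuous_hn n).measurable
    fun_prop
  have hRm : Measurable R := by
    have := measurable_restPhi i w β
    exact (this.comp (by fun_prop)).enorm
  have hJm : Measurable fun p : Fin m → ℝ => J.mulVec p s :=
    (measurable_pi_apply s).comp (measurable_mulVec J)
  calc _ ≤ ∫⁻ p, ∫⁻ u, ENNReal.ofReal (csC n * ω⁻¹) * (F u * ξ (J.mulVec p s - u) * R p) := by
        refine lintegral_mono fun p => ?_
        refine (mul_le_mul' (slotInt_succ_sq_le hψ hb hω n _) le_rfl).trans_eq ?_
        rw [lintegral_const_mul _ (by fun_prop), lintegral_mul_const _ (by fun_prop), mul_assoc]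
    _ = ∫⁻ u, ∫⁻ p, ENNReal.ofReal (csC n * ω⁻¹) * (F u * ξ (J.mulVec p s - u) * R p) := by
        refine lintegral_lintegral_swap (Measurable.aemeasurable ?_)
        unfold Function.uncurry
        fun_prop
    _ = ∫⁻ u, ∫⁻ p, ENNReal.ofReal (csC n * ω⁻¹) * (F u * ξ (J.mulVec p s) * R (p + u • v)) := by
        refine lintegral_congr fun u => ?_
        rw [← lintegral_add_right_eq_self _ (u • v)]
        refine lintegral_congr fun p => ?_
        rw [Matrix.mulVec_add, Matrix.mulVec_smul, Pi.add_apply, Pi.smul_apply, hv, smul_eq_mul,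
          mul_one, add_sub_cancel_right]
    _ = ∫⁻ p, ∫⁻ u, ENNReal.ofReal (csC n * ω⁻¹) * (F u * ξ (J.mulVec p s) * R (p + u • v)) := by
        refine lintegral_lintegral_swap (Measurable.aemeasurable ?_)
        unfold Function.uncurry
        fun_prop
    _ ≤ ∫⁻ p, ∫⁻ u, ENNReal.ofReal (csC n * ω⁻¹) * (ξ (J.mulVec p s) *
          ENNReal.ofReal (restPhi i w' 0 (x + J.mulVec p))) *
          (ENNReal.ofReal (hC n * restC m K β) *
            ENNReal.ofReal (Real.exp (-(Real.pi / 2) * (u / ω) ^ 2))) := by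
        refine lintegral_mono fun p => lintegral_mono fun u => ?_
        have h1 : F u * R (p + u • v) ≤ ENNReal.ofReal (restPhi i w' 0 (x + J.mulVec p)) *
            (ENNReal.ofReal (hC n * restC m K β) *
            ENNReal.ofReal (Real.exp (-(Real.pi / 2) * (u / ω) ^ 2))) := by
          have hr0 := restPhi_zero_nonneg i hw' (x + J.mulVec p)
          have hC0 : 0 ≤ hC n * restC m K β := mul_nonneg (hC_nonneg n) (restC_nonneg K β)
          rw [← ENNReal.ofReal_mul hC0, ← ENNReal.ofReal_mul hr0]
          simp only [hF, hR]
          rw [Real.enorm_eq_ofReal_abs, Real.enorm_eq_ofReal_abs,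
            ← ENNReal.ofReal_mul (abs_nonneg _)]
          refine ENNReal.ofReal_le_ofReal ?_
          have h2 := restPhi_shift_le hm i hK hω hw hw' hc (x + J.mulVec p) u
          have h3 := abs_hn_le n (√2 * (u / ω))
          have e : x + J.mulVec (p + u • v) = x + J.mulVec p + u • J.mulVec v := by
            rw [Matrix.mulVec_add, Matrix.mulVec_smul, add_assoc]
          rw [e]
          refine (mul_le_mul h3 h2 (abs_nonneg _) (mul_nonneg (hC_nonneg n)
            (Real.exp_pos _).le)).trans_eq ?_
          have e2 : Real.exp (-(Real.pi / 2) * (u / ω) ^ 2) =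
              Real.exp (-(Real.pi / 2) * (√2 * (u / ω)) ^ 2) *
                Real.exp (Real.pi / 2 * (u / ω) ^ 2) := by
            rw [← Real.exp_add]
            congr 1
            rw [mul_pow, Real.sq_sqrt (by norm_num)]
            ring
          rw [e2]
          ring
        calc _ = ENNReal.ofReal (csC n * ω⁻¹) * (ξ (J.mulVec p s) * (F u * R (p + u • v))) := by
              ring
          _ ≤ ENNReal.ofReal (csC n * ω⁻¹) * (ξ (J.mulVec p s) *
              (ENNReal.ofReal (restPhi i w' 0 (x + J.mulVec p)) *
              (ENNReal.ofReal (hC n * restC m K β) *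
              ENNReal.ofReal (Real.exp (-(Real.pi / 2) * (u / ω) ^ 2))))) :=
              mul_le_mul' le_rfl (mul_le_mul' le_rfl h1)
          _ = _ := by ring
    _ = ∫⁻ p, ENNReal.ofReal (csC n * hC n * restC m K β * √2) * (ξ (J.mulVec p s) *
          ENNReal.ofReal (restPhi i w' 0 (x + J.mulVec p))) := by
        refine lintegral_congr fun p => ?_
        have hme : Measurable fun u : ℝ =>
            ENNReal.ofReal (Real.exp (-(Real.pi / 2) * (u / ω) ^ 2)) := by fun_prop
        rw [lintegral_const_mul _ (hme.const_mul _), lintegral_const_mul _ hme,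
          lintegral_exp_div hω]
        have e : ENNReal.ofReal (csC n * hC n * restC m K β * √2) =
            ENNReal.ofReal (csC n * ω⁻¹) * (ENNReal.ofReal (hC n * restC m K β) *
              ENNReal.ofReal (√2 * ω)) := by
          have h1 : 0 ≤ csC n * ω⁻¹ := mul_nonneg (csC_nonneg n) (by positivity)
          have h2 : 0 ≤ hC n * restC m K β := mul_nonneg (hC_nonneg n) (restC_nonneg K β)
          rw [← ENNReal.ofReal_mul h2, ← ENNReal.ofReal_mul h1]
          congr 1
          field_simp
        rw [e]
        ring
    _ = _ := by
        rw [lintegral_const_mul]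
        have := measurable_restPhi i w' 0
        fun_prop

lemma lintegral_sum_swap {P Z : Type*} [MeasureSpace P] [MeasureSpace Z]
    [SFinite (volume : Measure P)] [SFinite (volume : Measure Z)] {ι : Type*} [Fintype ι]
    {G : ι → P × Z → ℝ≥0∞} (hG : ∀ c, Measurable (G c)) :
    ∫⁻ p, ∫⁻ z, ∑ c, G c (p, z) = ∑ c, ∫⁻ z, ∫⁻ p, G c (p, z) := by
  have h1 : ∀ p, ∫⁻ z, ∑ c, G c (p, z) = ∑ c, ∫⁻ z, G c (p, z) := fun p =>
    lintegral_finsetSum _ fun c _ => (hG c).comp measurable_prodMk_left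
  simp_rw [h1]
  rw [lintegral_finsetSum _ fun c _ => (hG c).lintegral_prod_right']
  exact Finset.sum_congr rfl fun c _ => lintegral_lintegral_swap (hG c).aemeasurable

set_option maxHeartbeats 1000000 in
/-- The Cauchy–Schwarz inequality for a form with derivatives in both coordinates at `i`. -/
lemma abs_lam_le_freeze (hm : 1 ≤ m) {f : Corner m → (Fin m → ℝ) → ℝ} (hf : Nice f)
    {J : Matrix (Idx m) (Fin m) ℝ} (hdet : ∀ j, (Amat J j).det ≠ 0) (i : Fin m)
    {K : ℝ} (hK : 1 ≤ K) {ω : ℝ} (hω : 0 < ω) {w w' : Idx m → ℝ} (hw : ∀ k, 0 < w k)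
    (hw' : ∀ k, 0 < w' k) (hwi : ∀ c, w (slot i c) = ω) (hwi' : ∀ c, w' (slot i c) = ω / √2)
    {n : Fin 2 → ℕ} {β : Idx m → ℕ} (hβ : ∀ c, β (slot i c) = n c + 1)
    (hv : ∀ c, ∃ v, J.mulVec v (slot i c) = 1 ∧ RestCompat i K ω w w' β (J.mulVec v)) :
    ENNReal.ofReal |lam f J w β| ≤ ∑ c, ENNReal.ofReal (csC (n c) * hC (n c) * restC m K β * √2) *
      ENNReal.ofReal (lam (freezeF f i c) (freezeJ J i c) w' (pairB i)) := by
  obtain ⟨B, hB⟩ := exists_Psi_bound hf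
  have hPm : ∀ c, ∀ z : Rest i → ℝ, Measurable fun y => Psi f i c y z := fun c z =>
    (measurable_Psi hf i c).comp (measurable_id.prodMk measurable_const)
  have hSm : ∀ c ω n, Measurable fun q : (Fin m → ℝ) × (Rest i → ℝ) =>
      ‖slotInt (fun y => Psi f i c y q.2) ω n (J.mulVec q.1 (slot i c))‖ₑ ^ 2 := by
    intro c ω n
    have h1 := measurable_slotInt (ψ := fun y z => Psi f i c y z) (measurable_Psi hf i c) ω n
    have h2 : Measurable fun q : (Fin m → ℝ) × (Rest i → ℝ) => (q.2, J.mulVec q.1 (slot i c)) :=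
      measurable_snd.prodMk
        ((measurable_pi_apply _).comp ((measurable_mulVec J).comp measurable_fst))
    exact (h1.comp h2).enorm.pow_const 2
  have hXm : Measurable fun q : (Fin m → ℝ) × (Rest i → ℝ) =>
      joinE i ((0 : Fin 2 → ℝ), q.2) + J.mulVec q.1 :=
    ((joinE i).measurable.comp (measurable_const.prodMk measurable_snd)).add
      ((measurable_mulVec J).comp measurable_fst)
  have hRm : ∀ w β, Measurable fun q : (Fin m → ℝ) × (Rest i → ℝ) =>
      restPhi i w β (joinE i ((0 : Fin 2 → ℝ), q.2) + J.mulVec q.1) := fun w β =>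
    (measurable_restPhi i w β).comp hXm
  rw [lam_eq_splitInt i hf (hdet _) hw, ← Real.enorm_eq_ofReal_abs]
  calc _ ≤ ∫⁻ p, ∫⁻ z, ‖splitInt f J w β i z p‖ₑ :=
        (enorm_integral_le_lintegral_enorm _).trans
          (lintegral_mono fun p => enorm_integral_le_lintegral_enorm _)
    _ ≤ ∫⁻ p, ∫⁻ z, ∑ c, ‖slotInt (fun y => Psi f i c y z) ω (n c + 1)
          (J.mulVec p (slot i c))‖ₑ ^ 2 * ‖restPhi i w β (joinE i (0, z) + J.mulVec p)‖ₑ := by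
        refine lintegral_mono fun p => lintegral_mono fun z => ?_
        rw [splitInt, enorm_mul, ← Finset.sum_mul]
        refine mul_le_mul' ?_ le_rfl
        simp only [Fin.prod_univ_two, Fin.sum_univ_two, hwi, hβ, enorm_mul]
        generalize ‖slotInt (fun y => Psi f i 0 y z) ω (n 0 + 1) (J.mulVec p (slot i 0))‖ₑ = a
        generalize ‖slotInt (fun y => Psi f i 1 y z) ω (n 1 + 1) (J.mulVec p (slot i 1))‖ₑ = b
        rcases le_total a b with h | h
        · calc a * b ≤ b * b := mul_le_mul' h le_rfl
            _ = b ^ 2 := (sq b).symm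
            _ ≤ _ := le_add_self
        · calc a * b ≤ a * a := mul_le_mul' le_rfl h
            _ = a ^ 2 := (sq a).symm
            _ ≤ _ := le_self_add
    _ = ∑ c, ∫⁻ z, ∫⁻ p, ‖slotInt (fun y => Psi f i c y z) ω (n c + 1)
          (J.mulVec p (slot i c))‖ₑ ^ 2 * ‖restPhi i w β (joinE i (0, z) + J.mulVec p)‖ₑ := by
        have hmeas : ∀ c, Measurable fun q : (Fin m → ℝ) × (Rest i → ℝ) =>
            ‖slotInt (fun y => Psi f i c y q.2) ω (n c + 1) (J.mulVec q.1 (slot i c))‖ₑ ^ 2 *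
            ‖restPhi i w β (joinE i ((0 : Fin 2 → ℝ), q.2) + J.mulVec q.1)‖ₑ := fun c =>
          (hSm c _ _).mul (hRm w β).enorm
        exact lintegral_sum_swap hmeas
    _ ≤ _ := by
        refine Finset.sum_le_sum fun c _ => ?_
        obtain ⟨v, hv1, hv2⟩ := hv c
        have hmeas : Measurable fun q : (Fin m → ℝ) × (Rest i → ℝ) =>
            ‖slotInt (fun y => Psi f i c y q.2) (ω / √2) 1 (J.mulVec q.1 (slot i c))‖ₑ ^ 2 *
            ENNReal.ofReal (restPhi i w' 0 (joinE i ((0 : Fin 2 → ℝ), q.2) + J.mulVec q.1)) :=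
          (hSm c _ _).mul (hRm w' 0).ennreal_ofReal
        refine (lintegral_mono fun z => lintegral_slot_sq_le hm J i c hK hω hw hw' hv1 hv2
          (hPm c z) (fun y => hB i c y z) (n c) (joinE i (0, z))).trans_eq ?_
        rw [lintegral_const_mul, (ofReal_lam_freeze hf hdet i c hw' hwi').2]
        · congr 1
          exact (lintegral_lintegral_swap hmeas.aemeasurable).symm
        · exact (hmeas.comp measurable_swap).lintegral_prod_right'

/-! ### Localised configurations -/

/-- The functions `F_j` localised to `A_j E`. -/
def loc (J : Matrix (Idx m) (Fin m) ℝ) (F : Corner m → (Fin m → ℝ) → ℝ) (E : Set (Fin m → ℝ)) :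
    Corner m → (Fin m → ℝ) → ℝ := fun j => ((Amat J j).mulVec '' E).indicator (F j)

/-- The data of the induction: `J`, `F` are symmetric in the directions of `S`, the sets `E n` live
at scale `ρ 2^n`, increase up to index `N`, and the localised functions are normalised. -/
structure IsConfig (Δ K : ℝ) (S : Finset (Fin m)) (J : Matrix (Idx m) (Fin m) ℝ)
    (F : Corner m → (Fin m → ℝ) → ℝ) (E : ℕ → Set (Fin m → ℝ)) (ρ : ℝ) (N : ℕ) : Prop where
  one_le : 1 ≤ Δ
  entry : ∀ k l, |J k l| ≤ Δ
  det_ne : ∀ j, (Amat J j).det ≠ 0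
  det_inv : ∀ j, |(Amat J j).det|⁻¹ ≤ Δ
  symmJ : ∀ h ∈ S, ∀ c c', J (slot h c) = J (slot h c')
  measF : ∀ j, Measurable (F j)
  bddF : ∃ C, ∀ j z, |F j z| ≤ C
  symmF : ∀ h ∈ S, ∀ j c, F (Function.update j h c) = F j
  measE : ∀ n, MeasurableSet (E n)
  bddE : ∀ n, ∃ R, ∀ q ∈ E n, ‖q‖ ≤ R
  mono : ∀ n < N, E n ⊆ E (n + 1)
  scale : 0 < ρ
  thick : ∀ n, Thick (ρ * 2 ^ n) (E n)
  thickDiff : ∀ n, Thick (ρ * 2 ^ (n + 1)) (E (n + 1) \ E n)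
  normal : ∀ n j z, ∫⁻ y in Metric.closedBall z (ρ * 2 ^ n),
      ‖loc J F (E n) j y‖ₑ ^ (2 ^ (m - 1) : ℕ)
    ≤ ENNReal.ofReal ((K * (ρ * 2 ^ n)) ^ m)

lemma measurableSet_mulVec_image {A : Matrix (Fin m) (Fin m) ℝ} (hA : A.det ≠ 0)
    {E : Set (Fin m → ℝ)} (hE : MeasurableSet E) : MeasurableSet (A.mulVec '' E) := by
  have hu : IsUnit A.det := isUnit_iff_ne_zero.2 hA
  have : A.mulVec '' E = (A⁻¹).mulVec ⁻¹' E := by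
    ext y
    constructor
    · rintro ⟨q, hq, rfl⟩
      rw [Set.mem_preimage, Matrix.mulVec_mulVec, Matrix.nonsing_inv_mul _ hu, Matrix.one_mulVec]
      exact hq
    · intro hy
      refine ⟨_, hy, ?_⟩
      rw [Matrix.mulVec_mulVec, Matrix.mul_nonsing_inv _ hu, Matrix.one_mulVec]
  rw [this]
  exact measurable_mulVec _ hE

lemma mulVec_injective {A : Matrix (Fin m) (Fin m) ℝ} (hA : A.det ≠ 0) :
    Function.Injective A.mulVec :=
  Matrix.mulVec_injective_iff_isUnit.2
    ((Matrix.isUnit_iff_isUnit_det A).2 (isUnit_iff_ne_zero.2 hA))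

section Config

variable {Δ K : ℝ} {S : Finset (Fin m)} {J : Matrix (Idx m) (Fin m) ℝ}
  {F : Corner m → (Fin m → ℝ) → ℝ} {E : ℕ → Set (Fin m → ℝ)} {ρ : ℝ} {N : ℕ}

lemma nice_loc (hΔ : 0 ≤ Δ) (hdet : ∀ j, (Amat J j).det ≠ 0) (hJ : ∀ k l, |J k l| ≤ Δ)
    (hF : ∀ j, Measurable (F j)) (hb : ∃ C, ∀ j z, |F j z| ≤ C) {A : Set (Fin m → ℝ)}
    (hA : MeasurableSet A) (hAb : ∃ R, ∀ q ∈ A, ‖q‖ ≤ R) : Nice (loc J F A) := by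
  obtain ⟨C, hC⟩ := hb
  obtain ⟨R, hR⟩ := hAb
  refine ⟨fun j => (hF j).indicator (measurableSet_mulVec_image (hdet j) hA), ⟨C, fun j z => ?_⟩,
    m * Δ * R, fun j z hz => ?_⟩
  · by_cases hz : z ∈ (Amat J j).mulVec '' A
    · rw [loc, Set.indicator_of_mem hz]; exact hC j z
    · rw [loc, Set.indicator_of_notMem hz, abs_zero]; exact (abs_nonneg _).trans (hC j z)
  · obtain ⟨q, hq, rfl⟩ : z ∈ (Amat J j).mulVec '' A := by
      by_contra h
      exact hz (Set.indicator_of_notMem h _)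
    have h0 : 0 ≤ m * Δ := by positivity
    have := dist_mulVec_le (Amat J j) hΔ (fun i k => hJ _ _) q 0
    rw [Matrix.mulVec_zero, dist_zero_right, dist_zero_right] at this
    exact this.trans (mul_le_mul_of_nonneg_left (hR q hq) h0)

lemma IsConfig.nice (h : IsConfig Δ K S J F E ρ N) (n : ℕ) : Nice (loc J F (E n)) :=
  nice_loc (zero_le_one.trans h.one_le) h.det_ne h.entry h.measF h.bddF (h.measE n) (h.bddE n)

lemma freezeF_loc (J : Matrix (Idx m) (Fin m) ℝ) (F : Corner m → (Fin m → ℝ) → ℝ)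
    (A : Set (Fin m → ℝ)) (i : Fin m) (c : Fin 2) :
    freezeF (loc J F A) i c = loc (freezeJ J i c) (freezeF F i c) A := by
  funext j
  simp only [freezeF, loc, Amat_freezeJ]

lemma IsConfig.freeze (h : IsConfig Δ K S J F E ρ N) (i : Fin m) (c : Fin 2) :
    IsConfig Δ K (insert i S) (freezeJ J i c) (freezeF F i c) E ρ N where
  one_le := h.one_le
  entry k l := by
    unfold freezeJ
    split_ifs <;> exact h.entry _ _
  det_ne j := by rw [Amat_freezeJ]; exact h.det_ne _
  det_inv j := by rw [Amat_freezeJ]; exact h.det_inv _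
  symmJ h' hh c₁ c₂ := by
    by_cases e : h' = i
    · subst e; rw [freezeJ_slot, freezeJ_slot]
    · rw [freezeJ_of_ne _ e, freezeJ_of_ne _ e]
      exact h.symmJ h' ((Finset.mem_insert.1 hh).resolve_left e) _ _
  measF j := h.measF _
  bddF := h.bddF.imp fun C hC j => hC _
  symmF h' hh j c' := by
    unfold freezeF
    by_cases e : h' = i
    · subst e; rw [Function.update_idem]
    · rw [Function.update_comm e, h.symmF h' ((Finset.mem_insert.1 hh).resolve_left e)]
  measE := h.measE
  bddE := h.bddE
  mono := h.mono
  scale := h.scale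
  thick := h.thick
  thickDiff := h.thickDiff
  normal n j z := by
    rw [← freezeF_loc]
    exact h.normal n _ z

lemma freezeF_eq_self {f : Corner m → (Fin m → ℝ) → ℝ} {i : Fin m}
    (h : ∀ j c, f (Function.update j i c) = f j) (c : Fin 2) : freezeF f i c = f :=
  funext fun j => h j c

lemma freezeJ_eq_self {i : Fin m} (h : ∀ c c', J (slot i c) = J (slot i c')) (c : Fin 2) :
    freezeJ J i c = J := by
  funext k
  obtain ⟨h', c', rfl⟩ := exists_slot k
  by_cases e : h' = i
  · subst e; rw [freezeJ_slot]; exact h _ _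
  · rw [freezeJ_of_ne _ e]

/-- The widths `d` are all equal to `e` off `S` and at most `e` on `S`. -/
structure Good (S : Finset (Fin m)) (d : Fin m → ℝ) (e : ℝ) : Prop where
  pos : ∀ h, 0 < d h
  epos : 0 < e
  le : ∀ h ∈ S, d h ≤ e
  eq : ∀ h ∉ S, d h = e

/-- The form of index `n` at scale `t`. -/
def lamC (J : Matrix (Idx m) (Fin m) ℝ) (F : Corner m → (Fin m → ℝ) → ℝ)
    (E : ℕ → Set (Fin m → ℝ)) (d : Fin m → ℝ) (β : Idx m → ℕ) (n : ℕ) (t : ℝ) : ℝ :=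
  lam (loc J F (E n)) J (wid d t) β

lemma measurable_wid (d : Fin m → ℝ) : Measurable (wid d) := by
  unfold wid; fun_prop

lemma IsConfig.measurable_lamC (h : IsConfig Δ K S J F E ρ N) (d : Fin m → ℝ) (β : Idx m → ℕ)
    (n : ℕ) : Measurable (lamC J F E d β n) :=
  measurable_lam (h.nice n) J β (measurable_wid d)

/-- The sum over scales of `∫ |u_n(t)| dt/t`. -/
def nrm (ρ : ℝ) (N : ℕ) (u : ℕ → ℝ → ℝ) : ℝ≥0∞ :=
  ∑ n ∈ Finset.range (N + 1), ∫⁻ t in Set.Ioc (ρ * 2 ^ n / 2) (ρ * 2 ^ n),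
    ENNReal.ofReal |u n t| * ENNReal.ofReal t⁻¹

lemma nrm_le_sum {ι : Type*} {s : Finset ι} {c : ι → ℝ≥0∞} {u : ℕ → ℝ → ℝ} {v : ι → ℕ → ℝ → ℝ}
    (hρ : 0 < ρ) (hv : ∀ i n, Measurable (v i n))
    (h : ∀ n, ∀ t > 0, ENNReal.ofReal |u n t| ≤ ∑ i ∈ s, c i * ENNReal.ofReal |v i n t|) :
    nrm ρ N u ≤ ∑ i ∈ s, c i * nrm ρ N (v i) := by
  unfold nrm
  simp_rw [Finset.mul_sum]
  rw [Finset.sum_comm]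
  refine Finset.sum_le_sum fun n _ => ?_
  calc _ ≤ ∫⁻ t in Set.Ioc (ρ * 2 ^ n / 2) (ρ * 2 ^ n),
        ∑ i ∈ s, c i * (ENNReal.ofReal |v i n t| * ENNReal.ofReal t⁻¹) := by
        refine setLIntegral_mono' measurableSet_Ioc fun t ht => ?_
        have h0 : 0 < t := lt_trans (by positivity) ht.1
        simp_rw [← mul_assoc]
        rw [← Finset.sum_mul]
        exact mul_le_mul' (h n t h0) le_rfl
    _ = _ := by
        have hm : ∀ i, Measurable fun t => ENNReal.ofReal |v i n t| * ENNReal.ofReal t⁻¹ :=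
            fun i => by
          have h1 : Measurable fun t => |v i n t| := (hv i n).abs
          exact h1.ennreal_ofReal.mul measurable_inv.ennreal_ofReal
        rw [lintegral_finsetSum _ fun i _ => (hm i).const_mul _]
        exact Finset.sum_congr rfl fun i _ => lintegral_const_mul _ (hm i)

/-- The bound for all forms with derivatives `β`. -/
def Bounded (Δ K : ℝ) (S : Finset (Fin m)) (β : Idx m → ℕ) : Prop :=
  ∃ C : ℝ≥0, ∀ J F E ρ N, IsConfig Δ K S J F E ρ N → ∀ d e, Good S d e →
    nrm ρ N (lamC J F E d β) ≤ C * ENNReal.ofReal (bd d) * volume (E N)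

/-- `β` only contains derivatives in directions off `S`. -/
def Off (S : Finset (Fin m)) (β : Idx m → ℕ) : Prop := ∀ h ∈ S, ∀ c, β (slot h c) = 0

lemma Off.add {β β' : Idx m → ℕ} (h : Off S β) (h' : Off S β') : Off S (β + β') :=
  fun i hi c => by rw [Pi.add_apply, h i hi, h' i hi]

lemma off_single {h : Fin m} (hh : h ∉ S) (c : Fin 2) (n : ℕ) : Off S (Pi.single (slot h c) n) :=
  fun i hi c' => by
    rw [Pi.single_eq_of_ne]
    exact fun e => hh ((slot_inj.1 e).1 ▸ hi)

/-- A weighted combination of bounded forms is bounded. -/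
lemma Bounded.of_le {ι : Type*} {s : Finset ι} (c : ι → ℝ≥0) {β : Idx m → ℕ} {γ : ι → Idx m → ℕ}
    (hγ : ∀ i ∈ s, Bounded Δ K S (γ i))
    (h : ∀ J F E ρ N, IsConfig Δ K S J F E ρ N → ∀ d e, Good S d e → ∀ n, ∀ t > 0,
      ENNReal.ofReal |lamC J F E d β n t| ≤
        ∑ i ∈ s, c i * ENNReal.ofReal |lamC J F E d (γ i) n t|) :
    Bounded Δ K S β := by
  classical
  choose! C hC using hγ
  refine ⟨∑ i ∈ s, c i * C i, fun J F E ρ N hc d e hd => ?_⟩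
  refine (nrm_le_sum hc.scale (fun i n => hc.measurable_lamC d (γ i) n)
    (h J F E ρ N hc d e hd)).trans ?_
  rw [ENNReal.ofNNReal_finsetSum, Finset.sum_mul, Finset.sum_mul]
  refine Finset.sum_le_sum fun i hi => ?_
  rw [ENNReal.coe_mul, mul_assoc, mul_assoc, ← mul_assoc (C i : ℝ≥0∞)]
  exact mul_le_mul' le_rfl (hC i hi J F E ρ N hc d e hd)

/-! ### Solving for shifts -/

/-- The bound on `J A_j⁻¹`. -/
def shiftC (m : ℕ) (Δ : ℝ) : ℝ := max 1 (m * (Δ * (Δ * (m.factorial * Δ ^ m))))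

lemma exists_shift (hΔ : 1 ≤ Δ) (hJ : ∀ k l, |J k l| ≤ Δ) (j : Corner m)
    (hdet : (Amat J j).det ≠ 0) (hinv : |(Amat J j).det|⁻¹ ≤ Δ) (i : Fin m) :
    ∃ v, (∀ h, J.mulVec v (sel j h) = Pi.single (M := fun _ => ℝ) i 1 h) ∧
      ∀ k, |J.mulVec v k| ≤ shiftC m Δ := by
  have hu : IsUnit (Amat J j).det := isUnit_iff_ne_zero.2 hdet
  refine ⟨(Amat J j)⁻¹.mulVec (Pi.single i 1), fun h => ?_, fun k => ?_⟩
  · have : (Amat J j).mulVec ((Amat J j)⁻¹.mulVec (Pi.single i 1)) = Pi.single i 1 := by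
      rw [Matrix.mulVec_mulVec, Matrix.mul_nonsing_inv _ hu, Matrix.one_mulVec]
    exact congrFun this h
  · have hadj : ∀ l, |(Amat J j).adjugate l i| ≤ m.factorial * Δ ^ m := by
      intro l
      rw [Matrix.adjugate_apply]
      have := Matrix.det_le (abv := (AbsoluteValue.abs : AbsoluteValue ℝ ℝ)) (x := Δ)
        (A := (Amat J j).updateRow i (Pi.single l 1)) (fun a b => by
          rw [AbsoluteValue.abs_apply]
          by_cases ha : a = i
          · subst ha
            rw [Matrix.updateRow_self]
            by_cases hb : b = l
            · subst hb; simpa using hΔ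
            · rw [Pi.single_eq_of_ne hb, abs_zero]; linarith
          · rw [Matrix.updateRow_ne ha]; exact hJ _ _)
      rwa [AbsoluteValue.abs_apply, Fintype.card_fin, nsmul_eq_mul] at this
    have hv : ∀ l, |(Amat J j)⁻¹.mulVec (Pi.single i 1) l| ≤ Δ * (m.factorial * Δ ^ m) := by
      intro l
      rw [Matrix.mulVec_single_one, Matrix.col_apply, Matrix.inv_def, Matrix.smul_apply,
          smul_eq_mul,
        abs_mul, Ring.inverse_eq_inv', abs_inv]
      exact mul_le_mul hinv (hadj l) (abs_nonneg _) (by linarith)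
    refine le_trans ?_ (le_max_right _ _)
    rw [Matrix.mulVec, dotProduct]
    refine (Finset.abs_sum_le_sum_abs _ _).trans ?_
    refine (Finset.sum_le_card_nsmul _ _ (Δ * (Δ * (m.factorial * Δ ^ m))) fun l _ => ?_).trans ?_
    · rw [abs_mul]
      exact mul_le_mul (hJ _ _) (hv l) (abs_nonneg _) (by linarith)
    · simp

end Config

section Reduction

variable {Δ K : ℝ} {S : Finset (Fin m)} {J : Matrix (Idx m) (Fin m) ℝ}
  {F : Corner m → (Fin m → ℝ) → ℝ} {E : ℕ → Set (Fin m → ℝ)} {ρ : ℝ} {N : ℕ}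

lemma wid_slot (d : Fin m → ℝ) (t : ℝ) (h : Fin m) (c : Fin 2) : wid d t (slot h c) = t * d h := by
  unfold slot wid
  split_ifs <;> rfl

/-- The bound for the squares in the symmetrised directions. -/
def PairBounded (Δ K : ℝ) (S : Finset (Fin m)) : Prop :=
  ∀ i ∈ S, Bounded Δ K S (pairB i)

lemma IsConfig.exists_shift (h : IsConfig Δ K S J F E ρ N) (j : Corner m) (i : Fin m) :
    ∃ v, (∀ h', J.mulVec v (sel j h') = Pi.single (M := fun _ => ℝ) i 1 h') ∧
      (∀ k, |J.mulVec v k| ≤ shiftC m Δ) ∧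
      ∀ h' ∈ S, ∀ c, J.mulVec v (slot h' c) = Pi.single (M := fun _ => ℝ) i 1 h' := by
  obtain ⟨v, h1, h2⟩ := SBL.exists_shift h.one_le h.entry j (h.det_ne j) (h.det_inv j) i
  refine ⟨v, h1, h2, fun b hb c => ?_⟩
  rw [← h1 b, sel_eq_slot]
  simp only [Matrix.mulVec, h.symmJ b hb c (j b)]

/-! ### The Cauchy–Schwarz reduction -/

/-- The widths after an application of Cauchy–Schwarz in direction `i`. -/
def csD (S : Finset (Fin m)) (i : Fin m) (L e : ℝ) (d : Fin m → ℝ) : Fin m → ℝ :=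
  fun h => if h ∈ S then d h else if h = i then e / √2 else L * e

lemma good_csD {d : Fin m → ℝ} {e : ℝ} (hd : Good S d e) (i : Fin m) {L : ℝ} (hL : 1 ≤ L) :
    Good (insert i S) (csD S i L e d) (L * e) := by
  have he := hd.epos
  have h2 : e / √2 ≤ e := div_le_self he.le (Real.one_le_sqrt.2 (by norm_num))
  have hLe : e ≤ L * e := le_mul_of_one_le_left he.le hL
  refine ⟨fun h => ?_, by positivity, fun h hh => ?_, fun h hh => ?_⟩
  · unfold csD
    have := hd.pos h
    split_ifs <;> positivity
  · unfold csD
    split_ifs with h1 h2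
    · exact (hd.le h h1).trans hLe
    · linarith
    · exact absurd (Finset.mem_insert.1 hh) (by tauto)
  · rw [Finset.mem_insert, not_or] at hh
    rw [csD, if_neg hh.2, if_neg hh.1]

lemma bd_csD_le {d : Fin m → ℝ} {e : ℝ} (hd : Good S d e) (i : Fin m) {L : ℝ} (hL : 1 ≤ L) :
    bd (csD S i L e d) ≤ 2 ^ m * bd d := by
  unfold bd
  have : (2 : ℝ) ^ m = ∏ _h : Fin m, (2 : ℝ) := by simp
  rw [this, ← Finset.prod_mul_distrib]
  refine Finset.prod_le_prod (fun _ _ => by positivity) fun h _ => ?_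
  have he := hd.epos
  have hs : √2 ^ 2 = 2 := Real.sq_sqrt (by norm_num)
  have hs1 : 1 ≤ √2 := Real.one_le_sqrt.2 (by norm_num)
  have key : max 1 (csD S i L e d h)⁻¹ ≤ √2 * max 1 (d h)⁻¹ := by
    have h1 : 1 ≤ √2 * max 1 (d h)⁻¹ := by
      nlinarith [le_max_left 1 (d h)⁻¹]
    refine max_le h1 ?_
    have hm := le_max_right 1 (d h)⁻¹
    have hp : 0 < (d h)⁻¹ := inv_pos.2 (hd.pos h)
    unfold csD
    split_ifs with h1 h2
    · nlinarith
    · rw [hd.eq h h1] at hm ⊢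
      rw [inv_div, div_eq_mul_inv]
      exact mul_le_mul_of_nonneg_left hm (by positivity)
    · rw [hd.eq h h1] at hm hp ⊢
      have : (L * e)⁻¹ ≤ e⁻¹ := inv_anti₀ he (le_mul_of_one_le_left he.le hL)
      nlinarith
  calc _ ≤ (√2 * max 1 (d h)⁻¹) ^ 2 := pow_le_pow_left₀ (by positivity) key 2
    _ = _ := by rw [mul_pow, hs]

/-- Forms with derivatives in both coordinates of a direction off `S` are controlled by the squares
of frozen configurations. -/
lemma bounded_of_pair (hm : 1 ≤ m) {i : Fin m} (hi : i ∉ S) (hP : PairBounded Δ K (insert i S))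
    {β : Idx m → ℕ} (hβ : Off S β) (h1 : ∀ c, 1 ≤ β (slot i c)) : Bounded Δ K S β := by
  obtain ⟨C, hPC⟩ := hP i (Finset.mem_insert_self i S)
  set K' := shiftC m Δ with hK'
  have hK1 : 1 ≤ K' := le_max_left _ _
  set L := csL m K' with hL
  have hL1 : 1 ≤ L := csL_ge_one m K'
  set A : Fin 2 → ℝ := fun c => csC (β (slot i c) - 1) * hC (β (slot i c) - 1) * restC m K' β * √2
    with hA
  refine ⟨∑ c, (A c).toNNReal * (C * 2 ^ m), fun J F E ρ N hc d e hd => ?_⟩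
  have hg := good_csD hd i hL1
  have he := hd.epos
  have key : ∀ n, ∀ t > 0, ENNReal.ofReal |lamC J F E d β n t| ≤ ∑ c, ENNReal.ofReal (A c) *
      ENNReal.ofReal |lamC (freezeJ J i c) (freezeF F i c) E (csD S i L e d) (pairB i) n t| := by
    intro n t ht
    refine (abs_lam_le_freeze hm (hc.nice n) hc.det_ne i hK1 (ω := t * e) (by positivity)
      (wid_pos hd.pos ht) (wid_pos (hg.pos) ht) (fun c => by rw [wid_slot, hd.eq i hi])
      (fun c => ?_) (n := fun c => β (slot i c) - 1) (fun c => (Nat.sub_add_cancel (h1 c)).symm)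
      (fun c => ?_)).trans ?_
    · rw [wid_slot, csD, if_neg hi, if_pos rfl, mul_div_assoc]
    · obtain ⟨v, hv1, hv2, hv3⟩ := hc.exists_shift (fun _ => c) i
      refine ⟨v, (hv1 i).trans (Pi.single_eq_same _ _), fun k => ?_⟩
      obtain ⟨h, c', hk⟩ := exists_slot (k : Idx m)
      have hne : h ≠ i := by
        rintro rfl
        apply k.2
        rw [hk]
        unfold slot; split_ifs <;> simp
      rw [hk]
      by_cases hh : h ∈ S
      · left
        refine ⟨hβ h hh c', by rw [hv3 h hh, Pi.single_eq_of_ne hne], ?_⟩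
        rw [wid_slot, wid_slot, csD, if_pos hh]
      · right
        refine ⟨by rw [wid_slot, hd.eq h hh], hv2 _, ?_⟩
        rw [wid_slot, csD, if_neg hh, if_neg hne]
        ring
    · refine Finset.sum_le_sum fun c _ => mul_le_mul' le_rfl (ENNReal.ofReal_le_ofReal ?_)
      rw [freezeF_loc]
      exact le_abs_self _
  refine (nrm_le_sum hc.scale (fun c n => (hc.freeze i c).measurable_lamC _ _ n) key).trans ?_
  rw [ENNReal.ofNNReal_finsetSum, Finset.sum_mul, Finset.sum_mul]
  refine Finset.sum_le_sum fun c _ => ?_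
  refine (mul_le_mul' le_rfl (hPC _ _ E ρ N (hc.freeze i c) _ _ hg)).trans ?_
  have hb : ENNReal.ofReal (bd (csD S i L e d)) ≤ 2 ^ m * ENNReal.ofReal (bd d) := by
    refine (ENNReal.ofReal_le_ofReal (bd_csD_le hd i hL1)).trans_eq ?_
    rw [ENNReal.ofReal_mul (by positivity), ENNReal.ofReal_pow (by norm_num)]
    simp
  calc _ ≤ ENNReal.ofReal (A c) * (C * (2 ^ m * ENNReal.ofReal (bd d)) * volume (E N)) :=
        mul_le_mul' le_rfl (mul_le_mul' (mul_le_mul' le_rfl hb) le_rfl)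
    _ = _ := by
        rw [ENNReal.ofReal]
        push_cast
        ring

/-! ### Exchanging directions -/

/-- Integration by parts along the range of `J` exchanges a derivative at `(h, j h)` for derivatives
at the opposite coordinates. -/
lemma bounded_of_exchange {β : Idx m → ℕ} (j : Corner m) {i : Fin m} (hi : i ∉ S)
    (hγ : ∀ h ∉ S, Bounded Δ K S (β + Pi.single (slot h (1 - j h)) 1)) :
    Bounded Δ K S (β + Pi.single (sel j i) 1) := by
  refine Bounded.of_le (s := Sᶜ) (fun _ => (shiftC m Δ).toNNReal)
    (γ := fun h => β + Pi.single (slot h (1 - j h)) 1)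
    (fun h hh => hγ h (Finset.mem_compl.1 hh)) ?_
  intro J F E ρ N hc d e hd n t ht
  obtain ⟨v, hv1, hv2, hv3⟩ := hc.exists_shift j i
  have hw := wid_pos hd.pos ht
  have h0 := sum_lam (hc.nice n) (hc.det_ne _) β hw v
  have he := hd.epos
  set G : Idx m → ℝ := fun k => lam (loc J F (E n)) J (wid d t) (β + Pi.single k 1) with hG
  have hsplit : ∀ f : Idx m → ℝ, ∑ k, f k = ∑ h, (f (slot h (j h)) + f (slot h (1 - j h))) := by
    intro f
    rw [Fintype.sum_sum_type, ← Finset.sum_add_distrib]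
    refine Finset.sum_congr rfl fun h _ => ?_
    have : j h = 0 ∨ j h = 1 := by omega
    rcases this with e | e <;> rw [e]
    · rfl
    · exact add_comm _ _
  rw [hsplit, Finset.sum_add_distrib] at h0
  have e1 : ∑ h, J.mulVec v (slot h (j h)) * (wid d t (slot h (j h)))⁻¹ * G (slot h (j h)) =
      (t * e)⁻¹ * G (sel j i) := by
    rw [Finset.sum_eq_single i]
    · have := hv1 i
      rw [Pi.single_eq_same] at this
      rw [wid_slot, hd.eq i hi, ← sel_eq_slot, this, one_mul]
    · intro h _ hne
      have := hv1 h
      rw [Pi.single_eq_of_ne hne, sel_eq_slot] at this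
      rw [this]; ring
    · simp
  have e2 : ∑ h, J.mulVec v (slot h (1 - j h)) * (wid d t (slot h (1 - j h)))⁻¹ *
      G (slot h (1 - j h)) =
      (t * e)⁻¹ * ∑ h ∈ Sᶜ, J.mulVec v (slot h (1 - j h)) * G (slot h (1 - j h)) := by
    rw [Finset.mul_sum, ← Finset.sum_subset (Finset.subset_univ Sᶜ)]
    · refine Finset.sum_congr rfl fun h hh => ?_
      rw [wid_slot, hd.eq h (Finset.mem_compl.1 hh)]
      ring
    · intro h _ hh
      have hh' : h ∈ S := by simpa using hh
      rw [hv3 h hh', Pi.single_eq_of_ne (fun e : h = i => hi (e ▸ hh'))]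
      ring
  have h3 : G (sel j i) = - ∑ h ∈ Sᶜ, J.mulVec v (slot h (1 - j h)) * G (slot h (1 - j h)) := by
    have h4 := (congrArg₂ (· + ·) e1 e2).symm.trans h0
    simp only [← mul_add] at h4
    have h5 : (t * e)⁻¹ ≠ 0 := by positivity
    linarith [(mul_eq_zero.1 h4).resolve_left h5]
  have h4 : |lamC J F E d (β + Pi.single (sel j i) 1) n t| ≤
      ∑ h ∈ Sᶜ, shiftC m Δ * |G (slot h (1 - j h))| := by
    change |G (sel j i)| ≤ _
    rw [h3, abs_neg]
    refine (Finset.abs_sum_le_sum_abs _ _).trans (Finset.sum_le_sum fun h _ => ?_)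
    rw [abs_mul]
    exact mul_le_mul_of_nonneg_right (hv2 _) (abs_nonneg _)
  have hs : 0 ≤ shiftC m Δ := zero_le_one.trans (le_max_left _ _)
  refine (ENNReal.ofReal_le_ofReal h4).trans_eq ?_
  rw [ENNReal.ofReal_sum_of_nonneg fun h _ => mul_nonneg hs (abs_nonneg _)]
  exact Finset.sum_congr rfl fun h _ => ENNReal.ofReal_mul hs

/-- If the number of derivatives exceeds the number of directions off `S`, exchanges produce two
derivatives in the same direction. -/
lemma bounded_of_card (hm : 1 ≤ m) (hP : ∀ i ∉ S, PairBounded Δ K (insert i S)) (U : Finset (Fin m))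
    (hU : U ⊆ Sᶜ) (β : Idx m → ℕ) (hβ : Off S β) (hβU : ∀ h ∈ U, 1 ≤ β (slot h 0))
    (hcard : Sᶜ.card < ∑ k, β k) : Bounded Δ K S β := by
  by_cases hpair : ∃ i ∉ S, ∀ c, 1 ≤ β (slot i c)
  · obtain ⟨i, hi, h1⟩ := hpair
    exact bounded_of_pair hm hi (hP i hi) hβ h1
  have hlt : ∑ k, (if k ∈ U.image (slot · 0) then 1 else 0) < ∑ k, β k := by
    refine lt_of_le_of_lt ?_ hcard
    rw [Finset.sum_boole, Nat.cast_id]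
    refine le_trans ?_ (Finset.card_le_card hU)
    refine (Finset.card_le_card ?_).trans (Finset.card_image_le (s := U) (f := (slot · 0)))
    intro k hk
    exact (Finset.mem_filter.1 hk).2
  obtain ⟨k, -, hk⟩ := Finset.exists_lt_of_sum_lt hlt
  obtain ⟨i, c, rfl⟩ := exists_slot k
  have hi : i ∉ S := fun h => by
    rw [hβ i h c] at hk
    exact absurd hk (Nat.not_lt_zero _)
  have hβ1 : 1 ≤ β (slot i c) := (Nat.zero_le _).trans_lt hk
  have hins : ∀ h ∉ S, h ∉ U → (Sᶜ \ insert h U).card < (Sᶜ \ U).card := fun h h1 h2 => by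
    refine Finset.card_lt_card ⟨fun x hx => ?_, fun hx => ?_⟩
    · simp only [Finset.mem_sdiff, Finset.mem_insert, not_or] at hx ⊢
      exact ⟨hx.1, hx.2.2⟩
    · have := hx (Finset.mem_sdiff.2 ⟨Finset.mem_compl.2 h1, h2⟩)
      simp at this
  have hsub : ∀ h ∉ S, insert h U ⊆ Sᶜ := fun h hh =>
    Finset.insert_subset (Finset.mem_compl.2 hh) hU
  by_cases hnew : i ∉ U ∧ c = 0
  · obtain ⟨h1, rfl⟩ := hnew
    have := hins i hi h1
    exact bounded_of_card hm hP (insert i U) (hsub i hi) β hβ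
      (fun h hh => (Finset.mem_insert.1 hh).elim (fun e => e ▸ hβ1) (hβU h)) hcard
  set j : Corner m := fun h => if h ∈ U then 0 else 1 with hj
  have hji : sel j i = slot i c := by
    rw [sel_eq_slot]
    congr 1
    have hc : c = 0 ∨ c = 1 := by omega
    by_cases h : i ∈ U
    · rw [hj]
      simp only [h, if_true]
      rcases hc with e | e
      · exact e.symm
      · exfalso
        subst e
        refine hpair ⟨i, hi, fun c' => ?_⟩
        have hc' : c' = 0 ∨ c' = 1 := by omega
        rcases hc' with rfl | rfl
        exacts [hβU i h, hβ1]
    · rw [hj]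
      simp only [h, if_false]
      rcases hc with e | e
      · exact absurd ⟨h, e⟩ hnew
      · exact e.symm
  set β' : Idx m → ℕ := β - Pi.single (slot i c) 1 with hβ'
  have hββ : β = β' + Pi.single (sel j i) 1 := by
    rw [hji]
    refine (tsub_add_cancel_of_le fun k => ?_).symm
    by_cases e : k = slot i c
    · subst e; simpa using hβ1
    · rw [Pi.single_eq_of_ne e]; exact Nat.zero_le _
  have hoff : Off S β' := fun h hh c' => by
    have := hβ h hh c'
    rw [hββ, Pi.add_apply] at this
    omega
  have hβ'U : ∀ h ∈ U, 1 ≤ β' (slot h 0) := fun h hh => by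
    rw [hβ', Pi.sub_apply]
    by_cases e : slot h 0 = slot i c
    · rw [e, Pi.single_eq_same, ← e]
      rw [← e, if_pos (Finset.mem_image_of_mem _ hh)] at hk
      omega
    · rw [Pi.single_eq_of_ne e]; exact hβU h hh
  have hsum : ∀ k, ∑ l, (β' + Pi.single k 1 : Idx m → ℕ) l = ∑ l, β l := fun k => by
    rw [hββ]
    simp [Finset.sum_add_distrib]
  rw [hββ]
  refine bounded_of_exchange j hi fun h hh => ?_
  by_cases hhU : h ∈ U
  · have e : slot h (1 - j h) = slot h 1 := by simp [hj, hhU]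
    rw [e]
    refine bounded_of_pair hm hh (hP h hh) (hoff.add (off_single hh _ _)) fun c' => ?_
    have hc' : c' = 0 ∨ c' = 1 := by omega
    rcases hc' with rfl | rfl
    · exact (hβ'U h hhU).trans (Nat.le_add_right _ _)
    · rw [Pi.add_apply, Pi.single_eq_same]; exact Nat.le_add_left _ _
  · have e : slot h (1 - j h) = slot h 0 := by simp [hj, hhU]
    rw [e]
    have := hins h hh hhU
    refine bounded_of_card hm hP (insert h U) (hsub h hh) _ (hoff.add (off_single hh _ _))
      (fun h' hh' => ?_) ((hsum _).symm ▸ hcard)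
    rcases Finset.mem_insert.1 hh' with rfl | h2
    · rw [Pi.add_apply, Pi.single_eq_same]; exact Nat.le_add_left _ _
    · exact (hβ'U h' h2).trans (Nat.le_add_right _ _)
termination_by (Sᶜ \ U).card

end Reduction

section Scaling

variable {Δ K : ℝ} {S : Finset (Fin m)} {J : Matrix (Idx m) (Fin m) ℝ}
  {F : Corner m → (Fin m → ℝ) → ℝ} {E : ℕ → Set (Fin m → ℝ)} {ρ : ℝ} {N : ℕ}

/-! ### Scaling the widths off `S` -/

/-- The coordinates in directions off `S`. -/
def offX (S : Finset (Fin m)) : Finset (Idx m) :=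
  (Sᶜ ×ˢ Finset.univ).image fun p : Fin m × Fin 2 => slot p.1 p.2

lemma slot_mem_offX {h : Fin m} {c : Fin 2} : slot h c ∈ offX S ↔ h ∉ S := by
  simp only [offX, Finset.mem_image, Finset.mem_product, Finset.mem_compl, Finset.mem_univ,
      and_true,
    slot_inj, Prod.exists]
  exact ⟨fun ⟨a, b, h1, h2, _⟩ => h2 ▸ h1, fun h' => ⟨h, c, h', rfl, rfl⟩⟩

/-- The widths off `S` multiplied by `r`. -/
def sclD (S : Finset (Fin m)) (d : Fin m → ℝ) (r : ℝ) : Fin m → ℝ :=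
  fun h => if h ∈ S then d h else r * d h

lemma scl_wid (d : Fin m → ℝ) (t r : ℝ) : scl (offX S) (wid d t) r = wid (sclD S d r) t := by
  funext k
  obtain ⟨h, c, rfl⟩ := exists_slot k
  simp only [scl, slot_mem_offX, wid_slot, sclD]
  split_ifs <;> first | rfl | ring

lemma good_sclD {d : Fin m → ℝ} {e : ℝ} (hd : Good S d e) {r : ℝ} (hr : 1 ≤ r) :
    Good S (sclD S d r) (r * e) := by
  have he := hd.epos
  have hle : e ≤ r * e := le_mul_of_one_le_left he.le hr
  refine ⟨fun h => ?_, by positivity, fun h hh => ?_, fun h hh => ?_⟩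
  · have := hd.pos h
    unfold sclD
    split_ifs <;> positivity
  · rw [sclD, if_pos hh]; exact (hd.le h hh).trans hle
  · rw [sclD, if_neg hh, hd.eq h hh]

lemma bd_sclD_le {d : Fin m → ℝ} {e : ℝ} (hd : Good S d e) {r : ℝ} (hr : 1 ≤ r) :
    bd (sclD S d r) ≤ bd d := by
  refine Finset.prod_le_prod (fun _ _ => by positivity) fun h _ =>
    pow_le_pow_left₀ (by positivity) (max_le_max le_rfl (inv_anti₀ (hd.pos h) ?_)) 2
  have := hd.pos h
  unfold sclD
  split_ifs
  · exact le_rfl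
  · exact le_mul_of_one_le_left this.le hr

lemma lam_le_lintegral_scl {f : Corner m → (Fin m → ℝ) → ℝ} (hf : Nice f)
    (hdet : (Amat J fun _ => 1).det ≠ 0) (X : Finset (Idx m))
    (β : Idx m → ℕ) (hβ : 1 ≤ ∑ k ∈ X, β k) {w : Idx m → ℝ} (hw : ∀ k, 0 < w k) :
    ENNReal.ofReal |lam f J w β| ≤ ∑ k ∈ X, ∫⁻ r in Set.Ioi (1 : ℝ),
      ENNReal.ofReal (r⁻¹ ^ (∑ k ∈ X, β k + 1)) *
        ENNReal.ofReal |lam f J (scl X w r) (β + Pi.single k 2)| := by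
  set n := ∑ k ∈ X, β k
  obtain ⟨c, hc, hcw⟩ := exists_width_bound hw
  set C := (∫ x, |Hprod f x|) * (phiConst J β * c⁻¹ ^ m)
  set T := ∑ k ∈ X, ∫⁻ r in Set.Ioi (1 : ℝ), ENNReal.ofReal (r⁻¹ ^ (n + 1)) *
        ENNReal.ofReal |lam f J (scl X w r) (β + Pi.single k 2)|
  have hbound : ∀ R : ℝ, 1 ≤ R →
      ENNReal.ofReal |lam f J w β| ≤ ENNReal.ofReal (R⁻¹ ^ n * C) + T := by
    intro R hR
    have hR0 : 0 < R := one_pos.trans_le hR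
    have h := integral_lam_scl hf hdet X β hw one_pos hR
    have h1 : scl X w 1 = w := by funext k; simp [scl]
    rw [h1, inv_one, one_pow, one_mul] at h
    have h2 : |lam f J (scl X w R) β| ≤ C :=
      abs_lam_le hf hdet β hc fun k => by
        simpa using le_scl (X := X) (a := 1) hc.le hcw zero_le_one le_rfl hR k
    have h3 : |lam f J w β| ≤ R⁻¹ ^ n * C + ∑ k ∈ X, |∫ r in Set.Ioc 1 R,
        r⁻¹ ^ (n + 1) * lam f J (scl X w r) (β + Pi.single k 2)| := by
      have h4 : lam f J w β = R⁻¹ ^ n * lam f J (scl X w R) β - (2 * Real.pi)⁻¹ *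
          ∑ k ∈ X, ∫ r in Set.Ioc 1 R, r⁻¹ ^ (n + 1) * lam f J (scl X w r) (β + Pi.single k 2) := by
        linarith
      rw [h4]
      refine (abs_sub _ _).trans (add_le_add ?_ ?_)
      · rw [abs_mul, abs_of_nonneg (by positivity)]
        exact mul_le_mul_of_nonneg_left h2 (by positivity)
      · rw [abs_mul, abs_of_nonneg (by positivity)]
        refine (mul_le_of_le_one_left (abs_nonneg _) (inv_le_one_of_one_le₀ ?_)).trans
          (Finset.abs_sum_le_sum_abs _ _)
        linarith [Real.pi_gt_three]
    refine (ENNReal.ofReal_le_ofReal h3).trans ?_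
    refine ENNReal.ofReal_add_le.trans (add_le_add le_rfl ?_)
    rw [ENNReal.ofReal_sum_of_nonneg fun _ _ => abs_nonneg _]
    refine Finset.sum_le_sum fun k _ => ?_
    rw [← Real.enorm_eq_ofReal_abs]
    refine (enorm_integral_le_lintegral_enorm _).trans ?_
    refine le_trans ?_ (lintegral_mono_set (fun x hx => hx.1 : Set.Ioc 1 R ⊆ Set.Ioi 1))
    refine setLIntegral_mono' measurableSet_Ioc fun r hr => ?_
    have hr0 : 0 < r := one_pos.trans hr.1
    rw [enorm_mul, Real.enorm_eq_ofReal_abs, Real.enorm_eq_ofReal_abs,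
      abs_of_nonneg (by positivity : 0 ≤ r⁻¹ ^ (n + 1))]
  have hlim : Filter.Tendsto (fun R : ℝ => ENNReal.ofReal (R⁻¹ ^ n * C) + T) Filter.atTop
      (nhds (ENNReal.ofReal (0 * C) + T)) := by
    refine Filter.Tendsto.add (ENNReal.tendsto_ofReal (Filter.Tendsto.mul_const _ ?_))
      tendsto_const_nhds
    have := (tendsto_inv_atTop_zero (𝕜 := ℝ)).pow n
    rwa [zero_pow (by omega)] at this
  rw [zero_mul, ENNReal.ofReal_zero, zero_add] at hlim
  exact ge_of_tendsto hlim ((Filter.eventually_ge_atTop 1).mono fun R hR => hbound R hR)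

lemma lintegral_inv_pow_lt_top {n : ℕ} (hn1 : 1 ≤ n) :
    ∫⁻ r in Set.Ioi (1 : ℝ), ENNReal.ofReal (r⁻¹ ^ (n + 1)) < ∞ := by
  have h := integrableOn_Ioi_rpow_of_lt (a := -2) (c := 1) (by norm_num) one_pos
  refine lt_of_le_of_lt (setLIntegral_mono' measurableSet_Ioi fun r hr => ?_) h.lintegral_lt_top
  have hr1 : (1 : ℝ) < r := hr
  refine ENNReal.ofReal_le_ofReal ?_
  have h2 : r ^ (-2 : ℝ) = r⁻¹ ^ 2 := by
    rw [Real.rpow_neg (by linarith), inv_pow]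
    norm_num
  rw [h2]
  exact pow_le_pow_of_le_one (by positivity) (inv_le_one_of_one_le₀ hr1.le) (by omega)

/-- Raising the number of derivatives by two by integrating in the widths off `S`. -/
lemma bounded_of_add_two {β : Idx m → ℕ} (hβ : Off S β) (hβ1 : 1 ≤ ∑ k, β k)
    (h : ∀ k ∈ offX S, Bounded Δ K S (β + Pi.single k 2)) : Bounded Δ K S β := by
  choose! C hC using h
  have hsum : ∑ k ∈ offX S, β k = ∑ k, β k := by
    refine Finset.sum_subset (Finset.subset_univ _) fun k _ hk => ?_
    obtain ⟨i, c, rfl⟩ := exists_slot k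
    rw [slot_mem_offX, not_not] at hk
    exact hβ i hk c
  set n := ∑ k, β k with hn'
  set I := ∫⁻ r in Set.Ioi (1 : ℝ), ENNReal.ofReal (r⁻¹ ^ (n + 1)) with hI
  have hIfin : I ≠ ∞ := (lintegral_inv_pow_lt_top hβ1).ne
  refine ⟨∑ k ∈ offX S, C k * I.toNNReal, fun J F E ρ N hc d e hd => ?_⟩
  set μ : ℕ → Measure ℝ := fun l => volume.restrict (Set.Ioc (ρ * 2 ^ l / 2) (ρ * 2 ^ l))
  set G : Idx m → ℕ → ℝ × ℝ → ℝ≥0∞ := fun k l q => ENNReal.ofReal (q.2⁻¹ ^ (n + 1)) *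
    (ENNReal.ofReal |lamC J F E (sclD S d q.2) (β + Pi.single k 2) l q.1| * ENNReal.ofReal q.1⁻¹)
    with hG
  have hGm : ∀ k l, Measurable (G k l) := by
    intro k l
    have h1 : Measurable fun q : ℝ × ℝ => lamC J F E (sclD S d q.2) (β + Pi.single k 2) l q.1 := by
      refine measurable_lam (hc.nice l) J _ ?_
      refine measurable_pi_lambda _ fun k' => ?_
      obtain ⟨i, c, rfl⟩ := exists_slot k'
      simp only [wid_slot, sclD]
      split_ifs <;> fun_prop
    have h2 : Measurable fun q : ℝ × ℝ =>
      |lamC J F E (sclD S d q.2) (β + Pi.single k 2) l q.1| := h1.abs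
    exact ((measurable_snd.inv.pow_const _).ennreal_ofReal).mul
      (h2.ennreal_ofReal.mul measurable_fst.inv.ennreal_ofReal)
  have hpt : ∀ l, ∫⁻ t, ENNReal.ofReal |lamC J F E d β l t| * ENNReal.ofReal t⁻¹ ∂μ l ≤
      ∑ k ∈ offX S, ∫⁻ r in Set.Ioi (1 : ℝ), ∫⁻ t, G k l (t, r) ∂μ l := by
    intro l
    calc ∫⁻ t, ENNReal.ofReal |lamC J F E d β l t| * ENNReal.ofReal t⁻¹ ∂μ l
        ≤ ∫⁻ t, (∑ k ∈ offX S, ∫⁻ r in Set.Ioi (1 : ℝ), G k l (t, r)) ∂μ l := by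
          refine setLIntegral_mono' measurableSet_Ioc fun t ht => ?_
          have hρ := hc.scale
          have ht0 : 0 < t := lt_trans (by positivity) ht.1
          have h1 := lam_le_lintegral_scl (hc.nice l) (hc.det_ne _) (offX S) β (hsum ▸ hβ1)
            (wid_pos hd.pos ht0)
          refine (mul_le_mul' h1 le_rfl).trans_eq ?_
          rw [Finset.sum_mul]
          refine Finset.sum_congr rfl fun k _ => ?_
          rw [← lintegral_mul_const' _ _ ENNReal.ofReal_ne_top]
          refine lintegral_congr fun r => ?_
          rw [hsum, scl_wid, mul_assoc]
          rfl
      _ = _ := by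
          rw [lintegral_finsetSum _ fun k _ => (hGm k l).lintegral_prod_right']
          exact Finset.sum_congr rfl fun k _ =>
            lintegral_lintegral_swap (f := fun t r => G k l (t, r)) (hGm k l).aemeasurable
  calc nrm ρ N (lamC J F E d β)
      ≤ ∑ l ∈ Finset.range (N + 1), ∑ k ∈ offX S,
          ∫⁻ r in Set.Ioi (1 : ℝ), ∫⁻ t, G k l (t, r) ∂μ l :=
        Finset.sum_le_sum fun l _ => hpt l
    _ = ∑ k ∈ offX S, ∫⁻ r in Set.Ioi (1 : ℝ), ENNReal.ofReal (r⁻¹ ^ (n + 1)) *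
          nrm ρ N (lamC J F E (sclD S d r) (β + Pi.single k 2)) := by
        rw [Finset.sum_comm]
        refine Finset.sum_congr rfl fun k _ => ?_
        have hm' : ∀ l, Measurable fun r => ∫⁻ t, G k l (t, r) ∂μ l := fun l =>
          ((hGm k l).comp measurable_swap).lintegral_prod_right'
        rw [← lintegral_finsetSum _ fun l _ => hm' l]
        refine lintegral_congr fun r => ?_
        rw [nrm, Finset.mul_sum]
        refine Finset.sum_congr rfl fun l _ => ?_
        rw [← lintegral_const_mul' _ _ ENNReal.ofReal_ne_top]
    _ ≤ ∑ k ∈ offX S, ∫⁻ r in Set.Ioi (1 : ℝ), ENNReal.ofReal (r⁻¹ ^ (n + 1)) *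
          (C k * ENNReal.ofReal (bd d) * volume (E N)) := by
        refine Finset.sum_le_sum fun k hk => setLIntegral_mono' measurableSet_Ioi fun r hr => ?_
        have hr1 : (1 : ℝ) ≤ r := le_of_lt hr
        refine mul_le_mul' le_rfl ((hC k hk J F E ρ N hc _ _ (good_sclD hd hr1)).trans ?_)
        exact mul_le_mul' (mul_le_mul' le_rfl (ENNReal.ofReal_le_ofReal (bd_sclD_le hd hr1))) le_rfl
    _ = _ := by
        rw [ENNReal.ofNNReal_finsetSum, Finset.sum_mul, Finset.sum_mul]
        refine Finset.sum_congr rfl fun k _ => ?_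
        rw [lintegral_mul_const _ (measurable_inv.pow_const _).ennreal_ofReal, ← hI,
          ENNReal.coe_mul, ENNReal.coe_toNNReal hIfin]
        ring

/-- All forms with at least two derivatives off `S` are bounded. -/
lemma bounded_of_two_le (hm : 1 ≤ m) (hP : ∀ i ∉ S, PairBounded Δ K (insert i S))
    (β : Idx m → ℕ) (hβ : Off S β) (hβ1 : 1 ≤ ∑ k, β k) : Bounded Δ K S β := by
  by_cases hcard : Sᶜ.card < ∑ k, β k
  · exact bounded_of_card hm hP ∅ (Finset.empty_subset _) β hβ (by simp) hcard
  · refine bounded_of_add_two hβ hβ1 fun k hk => ?_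
    have hs : ∑ l, (β + Pi.single k 2 : Idx m → ℕ) l = ∑ l, β l + 2 := by
      simp only [Pi.add_apply, Finset.sum_add_distrib, Finset.sum_pi_single', Finset.mem_univ,
          if_true]
    have : Sᶜ.card - ∑ l, (β + Pi.single k 2 : Idx m → ℕ) l < Sᶜ.card + 1 - ∑ l, β l := by omega
    obtain ⟨i, c, rfl⟩ := exists_slot k
    exact bounded_of_two_le hm hP _ (hβ.add (off_single (slot_mem_offX.1 hk) _ _)) (by omega)
termination_by Sᶜ.card + 1 - ∑ k, β k
decreasing_by omega

end Scaling

section Telescoping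

variable {Δ K : ℝ} {S : Finset (Fin m)} {J : Matrix (Idx m) (Fin m) ℝ}
  {F : Corner m → (Fin m → ℝ) → ℝ} {E : ℕ → Set (Fin m → ℝ)} {ρ : ℝ} {N : ℕ}

/-! ### Boundary terms -/

lemma enorm_Hprod_sub_le (hdet : ∀ j, (Amat J j).det ≠ 0) {A B : Set (Fin m → ℝ)} (hBA : B ⊆ A)
    (x : Idx m → ℝ) :
    ‖Hprod (loc J F A) x - Hprod (loc J F B) x‖ₑ ≤
      ∑ j₀, (proj j₀ ⁻¹' ((Amat J j₀).mulVec '' (A \ B))).indicator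
        (fun x => ∏ j, ‖loc J F A j (proj j x)‖ₑ) x := by
  by_cases h : ∃ j₀, proj j₀ x ∈ (Amat J j₀).mulVec '' (A \ B)
  · obtain ⟨j₀, hj⟩ := h
    have hB : Hprod (loc J F B) x = 0 := by
      refine Finset.prod_eq_zero (Finset.mem_univ j₀) (Set.indicator_of_notMem ?_ _)
      rintro ⟨q, hq, e⟩
      obtain ⟨q', hq', e'⟩ := hj
      exact hq'.2 (mulVec_injective (hdet j₀) (e.trans e'.symm) ▸ hq)
    rw [hB, sub_zero]
    refine le_trans ?_ (Finset.single_le_sum (fun _ _ => zero_le) (Finset.mem_univ j₀))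
    rw [Set.indicator_of_mem (by exact hj), Hprod, Real.enorm_eq_ofReal_abs, Finset.abs_prod,
      ENNReal.ofReal_prod_of_nonneg fun _ _ => abs_nonneg _]
    simp_rw [Real.enorm_eq_ofReal_abs, le_rfl]
  · push Not at h
    have : Hprod (loc J F A) x = Hprod (loc J F B) x := by
      refine Finset.prod_congr rfl fun j _ => ?_
      by_cases hB : proj j x ∈ (Amat J j).mulVec '' B
      · rw [loc, loc, Set.indicator_of_mem hB, Set.indicator_of_mem (Set.image_mono hBA hB)]
      · rw [loc, loc, Set.indicator_of_notMem hB, Set.indicator_of_notMem]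
        rintro ⟨q, hq, e⟩
        exact h j ⟨q, ⟨hq, fun hq' => hB ⟨q, hq', e⟩⟩, e⟩
    rw [this, sub_self, enorm_zero]
    exact zero_le

lemma exists_lam_sub_le (hm : 1 ≤ m) (hΔ : 1 ≤ Δ) (hK : 0 ≤ K) : ∃ C : ℝ≥0,
    ∀ J : Matrix (Idx m) (Fin m) ℝ, (∀ k l, |J k l| ≤ Δ) → (∀ j, (Amat J j).det ≠ 0) →
    (∀ j, |(Amat J j).det|⁻¹ ≤ Δ) → ∀ F : Corner m → (Fin m → ℝ) → ℝ, ∀ A B : Set (Fin m → ℝ),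
    MeasurableSet A → MeasurableSet B → Nice (loc J F A) → Nice (loc J F B) → B ⊆ A → ∀ ρ, 0 < ρ →
        Thick ρ (A \ B) →
    (∀ j z, ∫⁻ y in Metric.closedBall z ρ, ‖loc J F A j y‖ₑ ^ (2 ^ (m - 1) : ℕ) ≤
      ENNReal.ofReal ((K * ρ) ^ m)) →
    ∀ d : Fin m → ℝ, (∀ h, 0 < d h) → ∀ t, ρ / 2 ≤ t →
    ENNReal.ofReal |lam (loc J F A) J (wid d t) 0 - lam (loc J F B) J (wid d t) 0| ≤
      C * ENNReal.ofReal (bd d) * volume (A \ B) := by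
  obtain ⟨C, hbC⟩ := boundary hm (zero_le_one.trans hΔ) hK
  refine ⟨∑ _j : Corner m, C,
    fun J hJ hdet hinv F A B hAm hBm hA hB hBA ρ hρ hth hnorm d hd t ht => ?_⟩
  have hw := wid_pos hd (lt_of_lt_of_le (by positivity) ht : 0 < t)
  have hmu : ∀ j, Measurable fun y => ‖loc J F A j y‖ₑ := fun j => (hA.meas j).enorm
  rw [lam, lam, ← integral_sub (integrable_lam hA (hdet _) _ hw) (integrable_lam hB (hdet _) _ hw),
    ← Real.enorm_eq_ofReal_abs]
  calc _ ≤ ∫⁻ x, ‖Hprod (loc J F A) x - Hprod (loc J F B) x‖ₑ * gaussAvg J (wid d t) x := by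
        refine (enorm_integral_le_lintegral_enorm _).trans (lintegral_mono fun x => ?_)
        simp only
        rw [← sub_mul, enorm_mul]
        refine mul_le_mul' le_rfl ((enorm_integral_le_lintegral_enorm _).trans
          (lintegral_mono fun p => ?_))
        rw [Real.enorm_eq_ofReal_abs, abs_of_pos (phi_zero_pos hw _)]
    _ ≤ ∫⁻ x, ∑ j₀, (proj j₀ ⁻¹' ((Amat J j₀).mulVec '' (A \ B))).indicator
          (fun x => (∏ j, ‖loc J F A j (proj j x)‖ₑ) * gaussAvg J (wid d t) x) x := by
        refine lintegral_mono fun x => ?_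
        refine (mul_le_mul' (enorm_Hprod_sub_le hdet hBA x) le_rfl).trans_eq ?_
        rw [Finset.sum_mul]
        refine Finset.sum_congr rfl fun j₀ _ => ?_
        by_cases hx : x ∈ proj j₀ ⁻¹' ((Amat J j₀).mulVec '' (A \ B))
        · rw [Set.indicator_of_mem hx, Set.indicator_of_mem hx]
        · rw [Set.indicator_of_notMem hx, Set.indicator_of_notMem hx, zero_mul]
    _ ≤ ∑ j₀, ∫⁻ x, (proj j₀ ⁻¹' ((Amat J j₀).mulVec '' (A \ B))).indicator
          (fun x => (∏ j, ‖loc J F A j (proj j x)‖ₑ) * gaussAvg J (wid d t) x) x := by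
        rw [lintegral_finsetSum _ fun j₀ _ => Measurable.indicator ?_ ?_]
        · have h1 : ∀ j, Measurable fun x : Idx m → ℝ => ‖loc J F A j (proj j x)‖ₑ :=
            fun j => (hmu j).comp (by fun_prop)
          exact (Finset.measurable_prod _ fun j _ => h1 j).mul (measurable_gaussAvg J _)
        · exact (show Measurable (proj j₀) by fun_prop)
            (measurableSet_mulVec_image (hdet j₀) (hAm.diff hBm))
    _ ≤ ∑ _j : Corner m, C * ENNReal.ofReal (bd d) * volume (A \ B) :=
        Finset.sum_le_sum fun j₀ _ => hbC J hJ j₀ (hdet j₀) (hinv j₀)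
          (fun j y => ‖loc J F A j y‖ₑ) hmu ρ hρ hnorm _ hth d hd t ht
    _ = _ := by
        rw [ENNReal.ofNNReal_finsetSum, Finset.sum_mul, Finset.sum_mul]

lemma lam_loc_empty (w : Idx m → ℝ) (β : Idx m → ℕ) : lam (loc J F ∅) J w β = 0 := by
  have : ∀ x, Hprod (loc J F ∅) x = 0 := fun x =>
    Finset.prod_eq_zero (Finset.mem_univ (fun _ => 0)) (by simp [loc])
  simp [lam, this]

lemma IsConfig.volume_add_sum (h : IsConfig Δ K S J F E ρ N) :
    ∀ n ≤ N, volume (E 0) + ∑ k ∈ Finset.range n, volume (E (k + 1) \ E k) = volume (E n) := by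
  intro n
  induction n with
  | zero => simp
  | succ n ih =>
    intro hle
    rw [Finset.sum_range_succ, ← add_assoc, ih (by omega)]
    have := measure_inter_add_sdiff (μ := volume) (E (n + 1)) (h.measE n)
    rwa [Set.inter_eq_right.2 (h.mono n (by omega))] at this

lemma sum_sub_telescope (a b : ℕ → ℝ) (N : ℕ) :
    ∑ n ∈ Finset.range (N + 1), (b n - a n) =
      b N - a 0 - ∑ n ∈ Finset.range N, (a (n + 1) - b n) := by
  induction N with
  | zero => simp
  | succ N ih =>
    rw [Finset.sum_range_succ, ih, Finset.sum_range_succ _ N]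
    ring

/-- The boundary terms of the telescoping sum are bounded. -/
lemma exists_telescope_le (hm : 1 ≤ m) (hΔ : 1 ≤ Δ) (hK : 0 ≤ K) : ∃ C : ℝ≥0,
    ∀ S J F E ρ N, IsConfig (m := m) Δ K S J F E ρ N → ∀ d : Fin m → ℝ, (∀ h, 0 < d h) →
    ENNReal.ofReal |∑ n ∈ Finset.range (N + 1),
      (lamC J F E d 0 n (ρ * 2 ^ n) - lamC J F E d 0 n (ρ * 2 ^ n / 2))| ≤
      C * ENNReal.ofReal (bd d) * volume (E N) := by
  obtain ⟨C, hbC⟩ := exists_lam_sub_le hm hΔ hK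
  refine ⟨2 * C, fun S J F E ρ N hc d hd => ?_⟩
  have hρ := hc.scale
  have hemp : Nice (loc J F ∅) := nice_loc (zero_le_one.trans hΔ) hc.det_ne hc.entry hc.measF
    hc.bddF MeasurableSet.empty ⟨0, by simp⟩
  have hone : ∀ n t, ρ * 2 ^ n / 2 ≤ t → ENNReal.ofReal |lamC J F E d 0 n t| ≤
      C * ENNReal.ofReal (bd d) * volume (E n) := fun n t ht => by
    have := hbC J hc.entry hc.det_ne hc.det_inv F (E n) ∅ (hc.measE n) .empty (hc.nice n) hemp
        (Set.empty_subset _)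
      (ρ * 2 ^ n) (by positivity) (by simpa using hc.thick n) (hc.normal n) d hd t ht
    rwa [lam_loc_empty, sub_zero, Set.sdiff_empty] at this
  have hdiff : ∀ n < N, ENNReal.ofReal |lamC J F E d 0 (n + 1) (ρ * 2 ^ (n + 1) / 2) -
      lamC J F E d 0 n (ρ * 2 ^ n)| ≤
      C * ENNReal.ofReal (bd d) * volume (E (n + 1) \ E n) := fun n hlt => by
    have e : ρ * 2 ^ n = ρ * 2 ^ (n + 1) / 2 := by rw [pow_succ]; ring
    rw [e]
    exact hbC J hc.entry hc.det_ne hc.det_inv F (E (n + 1)) (E n) (hc.measE _) (hc.measE _)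
        (hc.nice _) (hc.nice _)
      (hc.mono n hlt) (ρ * 2 ^ (n + 1)) (by positivity) (hc.thickDiff n) (hc.normal _) d hd _ le_rfl
  rw [sum_sub_telescope (fun n => lamC J F E d 0 n (ρ * 2 ^ n / 2))
    (fun n => lamC J F E d 0 n (ρ * 2 ^ n))]
  set B := C * ENNReal.ofReal (bd d)
  have hle : ∀ a b c : ℝ, ENNReal.ofReal |a - b - c| ≤
      ENNReal.ofReal |a| + (ENNReal.ofReal |b| + ENNReal.ofReal |c|) := fun a b c => by
    rw [← ENNReal.ofReal_add (abs_nonneg _) (abs_nonneg _),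
      ← ENNReal.ofReal_add (abs_nonneg _) (by positivity)]
    refine ENNReal.ofReal_le_ofReal ?_
    linarith [abs_sub (a - b) c, abs_sub a b]
  calc _ ≤ B * volume (E N) + (B * volume (E 0) +
        ∑ n ∈ Finset.range N, B * volume (E (n + 1) \ E n)) := by
        refine (hle _ _ _).trans (add_le_add (hone N _ ?_) (add_le_add (hone 0 _ le_rfl) ?_))
        · have : 0 < ρ * 2 ^ N := by positivity
          linarith
        · refine (ENNReal.ofReal_le_ofReal (Finset.abs_sum_le_sum_abs _ _)).trans ?_
          rw [ENNReal.ofReal_sum_of_nonneg fun _ _ => abs_nonneg _]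
          exact Finset.sum_le_sum fun n hlt => hdiff n (Finset.mem_range.1 hlt)
    _ = _ := by
        rw [← Finset.mul_sum, ← mul_add, hc.volume_add_sum N le_rfl, ENNReal.coe_mul]
        simp only [B, ENNReal.coe_ofNat]
        ring

end Telescoping

section Pairs

variable {Δ K : ℝ} {S : Finset (Fin m)} {J : Matrix (Idx m) (Fin m) ℝ}
  {F : Corner m → (Fin m → ℝ) → ℝ} {E : ℕ → Set (Fin m → ℝ)} {ρ : ℝ} {N : ℕ}

/-! ### The squares in symmetrised directions -/

lemma IsConfig.lamC_pairB_nonneg (hc : IsConfig Δ K S J F E ρ N) {i : Fin m} (hi : i ∈ S)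
    {d : Fin m → ℝ} (hd : ∀ h, 0 < d h) (n : ℕ) {t : ℝ} (ht : 0 < t) :
    0 ≤ lamC J F E d (pairB i) n t := by
  have := (ofReal_lam_freeze (hc.nice n) hc.det_ne i 0 (wid_pos hd ht) fun c => wid_slot d t i c).1
  rwa [freezeF_loc, freezeJ_eq_self (hc.symmJ i hi), freezeF_eq_self (hc.symmF i hi)] at this

lemma pairB_eq (i : Fin m) : pairB i = Pi.single (slot i 0) 1 + Pi.single (slot i 1) 1 := by
  funext k
  obtain ⟨h, c, rfl⟩ := exists_slot k
  by_cases e : h = i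
  · subst e
    rw [pairB_slot]
    have hc : c = 0 ∨ c = 1 := by omega
    rcases hc with rfl | rfl <;> simp
  · have h1 : ∀ c', slot h c ≠ slot i c' := fun c' h' => e (slot_inj.1 h').1
    have hno : ¬(slot h c = Sum.inl i ∨ slot h c = Sum.inr i) := not_or.2 ⟨h1 0, h1 1⟩
    rw [Pi.add_apply, Pi.single_eq_of_ne (h1 0), Pi.single_eq_of_ne (h1 1), pairB, if_neg hno,
      add_zero]

/-- A symmetrised direction is exchanged for directions off `S`. -/
lemma IsConfig.exists_exchange (hc : IsConfig Δ K S J F E ρ N) {d : Fin m → ℝ} {e : ℝ}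
    (hd : Good S d e) {i : Fin m} (hi : i ∈ S) : ∃ a : Fin m → ℝ, (∀ h, |a h| ≤ shiftC m Δ) ∧
      ∀ n, ∀ t > 0, ∀ β : Idx m → ℕ,
        lamC J F E d (β + Pi.single (slot i 0) 1) n t +
          lamC J F E d (β + Pi.single (slot i 1) 1) n t =
        ∑ h ∈ Sᶜ, a h * lamC J F E d (β + Pi.single (slot h 0) 1) n t := by
  obtain ⟨v, hv1, hv2, hv3⟩ := hc.exists_shift (fun _ => 1) i
  have he := hd.epos
  have hdi := hd.pos i
  have hs : 0 ≤ shiftC m Δ := zero_le_one.trans (le_max_left _ _)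
  have hr : d i / e ≤ 1 := (div_le_one he).2 (hd.le i hi)
  refine ⟨fun h => -(J.mulVec v (slot h 0) * (d i / e)), fun h => ?_, fun n t ht β => ?_⟩
  · rw [abs_neg, abs_mul, abs_of_pos (by positivity : 0 < d i / e)]
    exact (mul_le_of_le_one_right (abs_nonneg _) hr).trans (hv2 _)
  have h0 := sum_lam (hc.nice n) (hc.det_ne _) β (wid_pos hd.pos ht) v
  set G : Idx m → ℝ := fun k => lam (loc J F (E n)) J (wid d t) (β + Pi.single k 1) with hG
  change G (slot i 0) + G (slot i 1) = ∑ h ∈ Sᶜ, -(J.mulVec v (slot h 0) * (d i / e)) * G (slot h 0)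
  have hsplit : ∀ f : Idx m → ℝ, ∑ k, f k = ∑ h, (f (slot h 0) + f (slot h 1)) := by
    intro f
    rw [Fintype.sum_sum_type, ← Finset.sum_add_distrib]
    rfl
  rw [hsplit, ← Finset.sum_add_sum_compl S] at h0
  have e1 : ∑ h ∈ S, (J.mulVec v (slot h 0) * (wid d t (slot h 0))⁻¹ * G (slot h 0) +
      J.mulVec v (slot h 1) * (wid d t (slot h 1))⁻¹ * G (slot h 1)) =
      (t * d i)⁻¹ * (G (slot i 0) + G (slot i 1)) := by
    rw [Finset.sum_eq_single i]
    · rw [hv3 i hi, hv3 i hi, wid_slot, wid_slot, Pi.single_eq_same]; ring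
    · intro h hh hne
      rw [hv3 h hh, hv3 h hh, Pi.single_eq_of_ne hne]; ring
    · exact fun h => absurd hi h
  have e2 : ∑ h ∈ Sᶜ, (J.mulVec v (slot h 0) * (wid d t (slot h 0))⁻¹ * G (slot h 0) +
      J.mulVec v (slot h 1) * (wid d t (slot h 1))⁻¹ * G (slot h 1)) =
      -((t * d i)⁻¹ * ∑ h ∈ Sᶜ, -(J.mulVec v (slot h 0) * (d i / e)) * G (slot h 0)) := by
    rw [Finset.mul_sum, ← Finset.sum_neg_distrib]
    refine Finset.sum_congr rfl fun h hh => ?_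
    have hh' := Finset.mem_compl.1 hh
    have h1 := hv1 h
    rw [Pi.single_eq_of_ne (fun e' : h = i => hh' (e' ▸ hi)), sel_eq_slot] at h1
    rw [h1, wid_slot, hd.eq h hh']
    field_simp
    ring
  have h4 := (congrArg₂ (· + ·) e1 e2).symm.trans h0
  have h5 : (t * d i)⁻¹ ≠ 0 := by positivity
  have h6 : (t * d i)⁻¹ * (G (slot i 0) + G (slot i 1) -
      ∑ h ∈ Sᶜ, -(J.mulVec v (slot h 0) * (d i / e)) * G (slot h 0)) = 0 := by
    rw [mul_sub, sub_eq_add_neg]; exact h4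
  linarith [(mul_eq_zero.1 h6).resolve_left h5]

/-- The complete square in a symmetrised direction only involves directions off `S`. -/
lemma IsConfig.abs_square_le (hc : IsConfig Δ K S J F E ρ N) {d : Fin m → ℝ} {e : ℝ}
    (hd : Good S d e) {i : Fin m} (hi : i ∈ S) (n : ℕ) {t : ℝ} (ht : 0 < t) :
    |lamC J F E d (Pi.single (slot i 0) 2) n t + 2 * lamC J F E d (pairB i) n t +
      lamC J F E d (Pi.single (slot i 1) 2) n t| ≤
    ∑ q ∈ Sᶜ ×ˢ Sᶜ, shiftC m Δ ^ 2 *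
      |lamC J F E d (Pi.single (slot q.1 0) 1 + Pi.single (slot q.2 0) 1) n t| := by
  obtain ⟨a, ha, hex⟩ := hc.exists_exchange hd hi
  set G : (Idx m → ℕ) → ℝ := fun β => lamC J F E d β n t with hG
  set u : Fin m → Fin 2 → Idx m → ℕ := fun h c => Pi.single (slot h c) 1 with hu
  have h2 : ∀ c, (Pi.single (slot i c) 2 : Idx m → ℕ) = u i c + u i c := fun c => by
    rw [hu, ← Pi.single_add]
  have key : G (Pi.single (slot i 0) 2) + 2 * G (pairB i) + G (Pi.single (slot i 1) 2) =
      ∑ q ∈ Sᶜ ×ˢ Sᶜ, a q.1 * a q.2 * G (u q.1 0 + u q.2 0) := by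
    have h3 : ∀ β, G (β + u i 0) + G (β + u i 1) = ∑ h ∈ Sᶜ, a h * G (β + u h 0) := hex n t ht
    rw [h2, h2, pairB_eq, Finset.sum_product]
    change G (u i 0 + u i 0) + 2 * G (u i 0 + u i 1) + G (u i 1 + u i 1) = _
    calc _ = (G (u i 0 + u i 0) + G (u i 0 + u i 1)) + (G (u i 1 + u i 0) + G (u i 1 + u i 1)) := by
          rw [add_comm (u i 1) (u i 0)]; ring
      _ = ∑ h ∈ Sᶜ, a h * (G (u h 0 + u i 0) + G (u h 0 + u i 1)) := by
          rw [h3, h3, ← Finset.sum_add_distrib]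
          refine Finset.sum_congr rfl fun h _ => ?_
          rw [add_comm (u i 0), add_comm (u i 1)]; ring
      _ = _ := by
          refine Finset.sum_congr rfl fun h _ => ?_
          rw [h3, Finset.mul_sum]
          exact Finset.sum_congr rfl fun h' _ => by ring
  change |G _ + 2 * G _ + G _| ≤ _
  rw [key]
  refine (Finset.abs_sum_le_sum_abs _ _).trans (Finset.sum_le_sum fun q _ => ?_)
  rw [abs_mul, abs_mul, sq]
  exact mul_le_mul_of_nonneg_right (mul_le_mul (ha _) (ha _) (abs_nonneg _)
    ((abs_nonneg _).trans (ha q.1))) (abs_nonneg _)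

lemma IsConfig.integrableOn_lamC (hc : IsConfig Δ K S J F E ρ N) {d : Fin m → ℝ}
    (hd : ∀ h, 0 < d h) (β : Idx m → ℕ) (n : ℕ) {a b : ℝ} (ha : 0 < a) :
    IntegrableOn (fun t => t⁻¹ * lamC J F E d β n t) (Set.Ioc a b) := by
  obtain ⟨c, hc0, hcw⟩ := exists_width_bound (wid_pos hd one_pos)
  refine Measure.integrableOn_of_bounded (M := a⁻¹ * ((∫ x, |Hprod (loc J F (E n)) x|) *
    (phiConst J β * (a * c)⁻¹ ^ m))) (by simp)
    (measurable_inv.mul (hc.measurable_lamC d β n)).aestronglyMeasurable ?_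
  filter_upwards [ae_restrict_mem measurableSet_Ioc] with t ht
  have ht0 : 0 < t := ha.trans ht.1
  rw [Real.norm_eq_abs, abs_mul, abs_of_pos (inv_pos.2 ht0)]
  refine mul_le_mul (inv_anti₀ ha ht.1.le) (abs_lam_le (hc.nice n) (hc.det_ne _) β (by positivity)
    fun k => ?_) (abs_nonneg _) (by positivity)
  have h1 := hcw k
  simp only [wid, one_mul] at h1 ⊢
  exact mul_le_mul ht.1.le h1 hc0.le ht0.le

lemma IsConfig.integral_lamC (hc : IsConfig Δ K S J F E ρ N) {d : Fin m → ℝ}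
    (hd : ∀ h, 0 < d h) (n : ℕ) {a b : ℝ} (ha : 0 < a) (hab : a ≤ b) :
    ∑ k, ∫ t in Set.Ioc a b, t⁻¹ * lamC J F E d (Pi.single k 2) n t =
      2 * Real.pi * (lamC J F E d 0 n b - lamC J F E d 0 n a) := by
  have h := integral_lam_scl (hc.nice n) (hc.det_ne _) Finset.univ 0 (wid_pos hd one_pos) ha hab
  have hs : ∀ r, scl Finset.univ (wid d 1) r = wid d r := fun r => by
    funext k; simp [scl, wid]
  simp only [hs, Pi.zero_apply, Finset.sum_const_zero, pow_zero, one_mul, zero_add, pow_one] at h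
  change lamC J F E d 0 n b - lamC J F E d 0 n a = _ at h
  rw [h]
  have := Real.pi_ne_zero
  field_simp
  rfl

/-- The part of the telescoping identity which only involves directions off `S`. -/
def offPart (S : Finset (Fin m)) (J : Matrix (Idx m) (Fin m) ℝ) (F : Corner m → (Fin m → ℝ) → ℝ)
    (E : ℕ → Set (Fin m → ℝ)) (d : Fin m → ℝ) (n : ℕ) (t : ℝ) : ℝ :=
  2 * ∑ i ∈ S, lamC J F E d (pairB i) n t + ∑ k, lamC J F E d (Pi.single k 2) n t

lemma sum_single (k : Idx m) (n : ℕ) : ∑ l, (Pi.single k n : Idx m → ℕ) l = n := by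
  rw [Finset.sum_eq_single k (fun l _ h => Pi.single_eq_of_ne h _)
      (fun h => absurd (Finset.mem_univ k) h),
    Pi.single_eq_same]

lemma exists_offPart_le (hm : 1 ≤ m) (hP : ∀ i ∉ S, PairBounded Δ K (insert i S)) : ∃ C : ℝ≥0,
    ∀ J F E ρ N, IsConfig Δ K S J F E ρ N → ∀ d e, Good S d e →
      nrm ρ N (offPart S J F E d) ≤ C * ENNReal.ofReal (bd d) * volume (E N) := by
  set s : Finset ((Fin m × Fin m) ⊕ Idx m) := (Sᶜ ×ˢ Sᶜ).disjSum (offX S)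
  set γ : (Fin m × Fin m) ⊕ Idx m → Idx m → ℕ := Sum.elim
    (fun q => Pi.single (slot q.1 0) 1 + Pi.single (slot q.2 0) 1) (fun k => Pi.single k 2) with hγ
  set c : (Fin m × Fin m) ⊕ Idx m → ℝ :=
    Sum.elim (fun _ => m * shiftC m Δ ^ 2) (fun _ => 1) with hc'
  have hc0 : ∀ x, 0 ≤ c x := by
    rintro (q | k)
    · exact mul_nonneg (Nat.cast_nonneg _) (sq_nonneg _)
    · exact zero_le_one
  have hB : ∀ x ∈ s, Bounded Δ K S (γ x) := by
    intro x hx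
    rcases Finset.mem_disjSum.1 hx with ⟨q, hq, rfl⟩ | ⟨k, hk, rfl⟩
    · rw [Finset.mem_product, Finset.mem_compl, Finset.mem_compl] at hq
      refine bounded_of_two_le hm hP _ ((off_single hq.1 _ _).add (off_single hq.2 _ _)) ?_
      change 1 ≤ ∑ k, (Pi.single (slot q.1 0) 1 + Pi.single (slot q.2 0) 1 : Idx m → ℕ) k
      simp only [Pi.add_apply, Finset.sum_add_distrib, sum_single]
      norm_num
    · obtain ⟨h, c', rfl⟩ := exists_slot k
      refine bounded_of_two_le hm hP _ (off_single (slot_mem_offX.1 hk) _ _) ?_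
      exact one_le_two.trans (sum_single (slot h c') 2).ge
  choose! C hbC using hB
  refine ⟨∑ x ∈ s, (c x).toNNReal * C x, fun J F E ρ N hc d e hd => ?_⟩
  have hpt : ∀ n, ∀ t > 0, ENNReal.ofReal |offPart S J F E d n t| ≤
      ∑ x ∈ s, ENNReal.ofReal (c x) * ENNReal.ofReal |lamC J F E d (γ x) n t| := by
    intro n t ht
    have h1 : offPart S J F E d n t = ∑ i ∈ S, (lamC J F E d (Pi.single (slot i 0) 2) n t +
        2 * lamC J F E d (pairB i) n t + lamC J F E d (Pi.single (slot i 1) 2) n t) +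
        ∑ k ∈ offX S, lamC J F E d (Pi.single k 2) n t := by
      have e1 : ∀ f : Idx m → ℝ, ∑ k, f k = ∑ i ∈ S, (f (slot i 0) + f (slot i 1)) +
          ∑ k ∈ offX S, f k := by
        intro f
        have e2 : ∑ k ∈ offX S, f k = ∑ i ∈ Sᶜ, (f (slot i 0) + f (slot i 1)) := by
          rw [offX, Finset.sum_image, Finset.sum_product]
          · simp
          · rintro ⟨a, b⟩ _ ⟨a', b'⟩ _ h
            exact Prod.ext (slot_inj.1 h).1 (slot_inj.1 h).2
        rw [e2, Finset.sum_add_sum_compl, Fintype.sum_sum_type, ← Finset.sum_add_distrib]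
        rfl
      rw [offPart, e1 (fun k => lamC J F E d (Pi.single k 2) n t), Finset.mul_sum, ← add_assoc,
        ← Finset.sum_add_distrib]
      congr 1
      exact Finset.sum_congr rfl fun i _ => by ring
    have h2 : |offPart S J F E d n t| ≤ ∑ x ∈ s, c x * |lamC J F E d (γ x) n t| := by
      rw [h1, Finset.sum_disjSum]
      refine (abs_add_le _ _).trans (add_le_add ?_ ?_)
      · refine (Finset.abs_sum_le_sum_abs _ _).trans ?_
        refine (Finset.sum_le_sum fun i hi => hc.abs_square_le hd hi n ht).trans ?_
        rw [Finset.sum_const, nsmul_eq_mul, Finset.mul_sum]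
        refine Finset.sum_le_sum fun q _ => ?_
        simp only [hγ, hc', Sum.elim_inl, mul_assoc]
        refine mul_le_mul_of_nonneg_right ?_ (by positivity)
        exact_mod_cast (Finset.card_le_univ S).trans_eq (Fintype.card_fin m)
      · refine (Finset.abs_sum_le_sum_abs _ _).trans_eq ?_
        simp [hγ, hc']
    refine (ENNReal.ofReal_le_ofReal h2).trans_eq ?_
    rw [ENNReal.ofReal_sum_of_nonneg fun x _ => mul_nonneg (hc0 x) (abs_nonneg _)]
    exact Finset.sum_congr rfl fun x _ => ENNReal.ofReal_mul (hc0 x)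
  refine (nrm_le_sum hc.scale (fun x n => hc.measurable_lamC d (γ x) n) hpt).trans ?_
  rw [ENNReal.ofNNReal_finsetSum, Finset.sum_mul, Finset.sum_mul]
  refine Finset.sum_le_sum fun x hx => ?_
  rw [ENNReal.coe_mul, mul_assoc, mul_assoc, ← mul_assoc (C x : ℝ≥0∞)]
  exact mul_le_mul' le_rfl (hbC x hx J F E ρ N hc d e hd)

/-- The inductive step: bounds for larger symmetry sets imply the bound for `S`. -/
lemma pairBounded_of_insert (hm : 1 ≤ m) (hΔ : 1 ≤ Δ) (hK : 0 ≤ K)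
    (hP : ∀ i ∉ S, PairBounded Δ K (insert i S)) : PairBounded Δ K S := by
  intro i hi
  obtain ⟨C₁, h₁⟩ := exists_offPart_le hm hP
  obtain ⟨C₂, h₂⟩ := exists_telescope_le hm hΔ hK
  refine ⟨C₁ + (2 * Real.pi).toNNReal * C₂, fun J F E ρ N hc d e hd => ?_⟩
  have hρ := hc.scale
  set I : ℕ → Set ℝ := fun n => Set.Ioc (ρ * 2 ^ n / 2) (ρ * 2 ^ n) with hI
  have ha : ∀ n : ℕ, 0 < ρ * 2 ^ n / 2 := fun n => by positivity
  have hpos : ∀ n, ∀ t ∈ I n, 0 < t := fun n t ht => (ha n).trans ht.1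
  have hinteg : ∀ β n, IntegrableOn (fun t => t⁻¹ * lamC J F E d β n t) (I n) := fun β n =>
    hc.integrableOn_lamC hd.pos β n (ha n)
  set P : ℕ → ℝ := fun n => ∫ t in I n, t⁻¹ * lamC J F E d (pairB i) n t with hPdef
  have hP0 : ∀ i ∈ S, ∀ n, 0 ≤ ∫ t in I n, t⁻¹ * lamC J F E d (pairB i) n t := fun i hi n =>
    setIntegral_nonneg measurableSet_Ioc fun t ht =>
      mul_nonneg (inv_nonneg.2 (hpos n t ht).le) (hc.lamC_pairB_nonneg hi hd.pos n (hpos n t ht))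
  have hoffint : ∀ n, ∫ t in I n, t⁻¹ * offPart S J F E d n t =
      2 * (∑ i ∈ S, ∫ t in I n, t⁻¹ * lamC J F E d (pairB i) n t) +
      2 * Real.pi * (lamC J F E d 0 n (ρ * 2 ^ n) - lamC J F E d 0 n (ρ * 2 ^ n / 2)) := by
    intro n
    rw [← hc.integral_lamC hd.pos n (ha n) (by linarith [ha n]),
      ← integral_finsetSum _ fun i _ => hinteg _ n, ← integral_finsetSum _ fun i _ => hinteg _ n,
      ← integral_const_mul, ← integral_add]
    · refine integral_congr_ae (Filter.Eventually.of_forall fun t => ?_)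
      simp only [offPart, ← Finset.mul_sum]
      ring
    · exact (integrable_finsetSum _ fun i _ => hinteg _ n).const_mul _
    · exact integrable_finsetSum _ fun i _ => hinteg _ n
  set B := ∑ n ∈ Finset.range (N + 1),
      (lamC J F E d 0 n (ρ * 2 ^ n) - lamC J F E d 0 n (ρ * 2 ^ n / 2)) with hB
  have hreal : ∑ n ∈ Finset.range (N + 1), P n ≤
      ∑ n ∈ Finset.range (N + 1), |∫ t in I n, t⁻¹ * offPart S J F E d n t| +
        2 * Real.pi * |B| := by
    have h3 : ∀ n, P n ≤ (∫ t in I n, t⁻¹ * offPart S J F E d n t) -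
        2 * Real.pi * (lamC J F E d 0 n (ρ * 2 ^ n) - lamC J F E d 0 n (ρ * 2 ^ n / 2)) := by
      intro n
      have h := Finset.single_le_sum (f := fun i => ∫ t in I n, t⁻¹ * lamC J F E d (pairB i) n t)
        (fun i hi => hP0 i hi n) hi
      have h0 := hP0 i hi n
      change (∫ t in I n, t⁻¹ * lamC J F E d (pairB i) n t) ≤ _ at h
      rw [hoffint n]
      change (∫ t in I n, t⁻¹ * lamC J F E d (pairB i) n t) ≤ _
      linarith
    have h4 := Finset.sum_le_sum fun n (_ : n ∈ Finset.range (N + 1)) => h3 n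
    rw [Finset.sum_sub_distrib, ← Finset.mul_sum, ← hB] at h4
    have h5 := Finset.sum_le_sum fun n (_ : n ∈ Finset.range (N + 1)) =>
      le_abs_self (∫ t in I n, t⁻¹ * offPart S J F E d n t)
    have h6 : -(2 * Real.pi * B) ≤ 2 * Real.pi * |B| := by
      nlinarith [neg_abs_le B, Real.pi_pos]
    linarith
  have hnrm : nrm ρ N (lamC J F E d (pairB i)) =
      ENNReal.ofReal (∑ n ∈ Finset.range (N + 1), P n) := by
    rw [ENNReal.ofReal_sum_of_nonneg fun n _ => hP0 i hi n]
    refine Finset.sum_congr rfl fun n _ => ?_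
    rw [ofReal_integral_eq_lintegral_ofReal (hinteg _ n)]
    · refine setLIntegral_congr_fun measurableSet_Ioc fun t ht => ?_
      have ht0 := hpos n t ht
      rw [abs_of_nonneg (hc.lamC_pairB_nonneg hi hd.pos n ht0), mul_comm,
        ENNReal.ofReal_mul (inv_nonneg.2 ht0.le)]
    · filter_upwards [ae_restrict_mem measurableSet_Ioc] with t ht
      exact mul_nonneg (inv_nonneg.2 (hpos n t ht).le)
        (hc.lamC_pairB_nonneg hi hd.pos n (hpos n t ht))
  rw [hnrm]
  calc _ ≤ ENNReal.ofReal (∑ n ∈ Finset.range (N + 1), |∫ t in I n, t⁻¹ * offPart S J F E d n t|) +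
        ENNReal.ofReal (2 * Real.pi) * ENNReal.ofReal |B| := by
        rw [← ENNReal.ofReal_mul (by positivity)]
        exact (ENNReal.ofReal_le_ofReal hreal).trans ENNReal.ofReal_add_le
    _ ≤ nrm ρ N (offPart S J F E d) + ENNReal.ofReal (2 * Real.pi) * ENNReal.ofReal |B| := by
        refine add_le_add ?_ le_rfl
        rw [ENNReal.ofReal_sum_of_nonneg fun _ _ => abs_nonneg _]
        refine Finset.sum_le_sum fun n _ => ?_
        rw [← Real.enorm_eq_ofReal_abs]
        refine (enorm_integral_le_lintegral_enorm _).trans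
          (setLIntegral_mono' measurableSet_Ioc fun t ht => le_of_eq ?_)
        rw [enorm_mul, Real.enorm_eq_ofReal_abs, Real.enorm_eq_ofReal_abs,
          abs_of_pos (inv_pos.2 (hpos n t ht)), mul_comm]
    _ ≤ C₁ * ENNReal.ofReal (bd d) * volume (E N) +
        ENNReal.ofReal (2 * Real.pi) * (C₂ * ENNReal.ofReal (bd d) * volume (E N)) :=
        add_le_add (h₁ J F E ρ N hc d e hd) (mul_le_mul' le_rfl (h₂ S J F E ρ N hc d hd.pos))
    _ = _ := by
        rw [ENNReal.coe_add, ENNReal.coe_mul, ← ENNReal.ofReal.eq_1 (2 * Real.pi)]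
        ring

theorem pairBounded (hm : 1 ≤ m) (hΔ : 1 ≤ Δ) (hK : 0 ≤ K) (S : Finset (Fin m)) :
    PairBounded Δ K S := by
  induction h : Sᶜ.card using Nat.strong_induction_on generalizing S with
  | _ n ih =>
    refine pairBounded_of_insert hm hΔ hK fun i hi => ih _ ?_ (insert i S) rfl
    rw [← h, Finset.compl_insert]
    exact Finset.card_erase_lt_of_mem (Finset.mem_compl.2 hi)

end Pairs

/-! ### Dyadic cubes and convex trees -/

/-- The dyadic cube of side `2^k` containing `q`. -/
def cubeAt (k : ℤ) (q : Fin m → ℝ) : ℤ × (Fin m → ℤ) := (k, fun i => ⌊q i / 2 ^ k⌋)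

lemma mem_dC_iff {Q : ℤ × (Fin m → ℤ)} {q : Fin m → ℝ} : q ∈ dC Q ↔ Q = cubeAt Q.1 q := by
  have h2 : (0 : ℝ) < 2 ^ Q.1 := by positivity
  have : ∀ i, ((2 : ℝ) ^ Q.1 * (Q.2 i : ℝ) ≤ q i ∧ q i < (2 : ℝ) ^ Q.1 * ((Q.2 i : ℝ) + 1)) ↔
      Q.2 i = ⌊q i / 2 ^ Q.1⌋ := by
    intro i
    rw [eq_comm, Int.floor_eq_iff, le_div_iff₀' h2, div_lt_iff₀' h2]
  simp only [dC, Set.mem_ofPred_eq, this]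
  constructor
  · exact fun h => Prod.ext rfl (funext h)
  · exact fun h i => congrFun (congrArg Prod.snd h) i

lemma mem_dC_cubeAt (k : ℤ) (q : Fin m → ℝ) : q ∈ dC (cubeAt k q) := mem_dC_iff.2 rfl

lemma cubeAt_congr {k k' : ℤ} (hk : k ≤ k') {q x : Fin m → ℝ} (h : cubeAt k q = cubeAt k x) :
    cubeAt k' q = cubeAt k' x := by
  obtain ⟨n, rfl⟩ := Int.le.dest hk
  have h1 : ∀ y : Fin m → ℝ, ∀ i, ⌊y i / 2 ^ (k + (n : ℤ))⌋ = ⌊y i / 2 ^ k⌋ / (2 ^ n : ℕ) := by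
    intro y i
    rw [← Int.floor_div_natCast, zpow_add₀ two_ne_zero, div_div]
    norm_num
  refine Prod.ext rfl (funext fun i => ?_)
  change ⌊q i / 2 ^ (k + (n : ℤ))⌋ = ⌊x i / 2 ^ (k + (n : ℤ))⌋
  rw [h1, h1, show ⌊q i / 2 ^ k⌋ = ⌊x i / 2 ^ k⌋ from congrFun (congrArg Prod.snd h) i]

lemma dC_cubeAt_subset {k k' : ℤ} (hk : k ≤ k') (q : Fin m → ℝ) :
    dC (cubeAt k q) ⊆ dC (cubeAt k' q) := by
  intro x hx
  have h := mem_dC_iff.1 hx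
  exact mem_dC_iff.2 (cubeAt_congr hk h)

lemma dC_eq_pi (Q : ℤ × (Fin m → ℤ)) : dC Q = Set.univ.pi fun i =>
    Set.Ico ((2 : ℝ) ^ Q.1 * (Q.2 i : ℝ)) ((2 : ℝ) ^ Q.1 * ((Q.2 i : ℝ) + 1)) := by
  ext x; simp [dC]

lemma measurableSet_dC (Q : ℤ × (Fin m → ℤ)) : MeasurableSet (dC Q) := by
  rw [dC_eq_pi]
  exact MeasurableSet.univ_pi fun i => measurableSet_Ico

lemma volume_dC (Q : ℤ × (Fin m → ℤ)) : volume (dC Q) = ENNReal.ofReal (((2 : ℝ) ^ Q.1) ^ m) := by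
  rw [dC_eq_pi, Real.volume_pi_Ico]
  have : ∀ i, (2 : ℝ) ^ Q.1 * ((Q.2 i : ℝ) + 1) - (2 : ℝ) ^ Q.1 * (Q.2 i : ℝ) = 2 ^ Q.1 :=
      fun i => by ring
  simp only [this, Finset.prod_const, Finset.card_univ, Fintype.card_fin]
  rw [ENNReal.ofReal_pow (by positivity)]

lemma dC_subset_closedBall {Q : ℤ × (Fin m → ℤ)} {q : Fin m → ℝ} (hq : q ∈ dC Q) :
    dC Q ⊆ Metric.closedBall q (2 ^ Q.1) := by
  intro x hx
  refine (dist_pi_le_iff (by positivity)).2 fun i => ?_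
  have h1 := hx i
  have h2 := hq i
  rw [Real.dist_eq, abs_le]
  constructor <;> linarith

lemma mem_Tkset {T : Set (ℤ × (Fin m → ℤ))} {k : ℤ} {q : Fin m → ℝ} :
    q ∈ Tkset T k ↔ cubeAt k q ∈ T := by
  simp only [Tkset, Set.mem_iUnion, Set.mem_ofPred_eq, exists_prop]
  constructor
  · rintro ⟨Q, ⟨hQ, rfl⟩, hq⟩
    rwa [← mem_dC_iff.1 hq]
  · exact fun h => ⟨_, ⟨h, rfl⟩, mem_dC_cubeAt k q⟩

lemma measurableSet_Tkset (T : Set (ℤ × (Fin m → ℤ))) (k : ℤ) : MeasurableSet (Tkset T k) :=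
  MeasurableSet.biUnion (Set.to_countable _) fun Q _ => measurableSet_dC Q

lemma thick_Tkset (T : Set (ℤ × (Fin m → ℤ))) (k : ℤ) : Thick (2 ^ k) (Tkset T k) := by
  intro q hq
  refine ⟨dC (cubeAt k q), fun x hx => ?_, dC_subset_closedBall (mem_dC_cubeAt k q), ?_⟩
  · rw [mem_Tkset] at hq ⊢
    exact (show cubeAt k q = cubeAt k x from mem_dC_iff.1 hx) ▸ hq
  · rw [volume_dC]
    refine ENNReal.ofReal_le_ofReal (pow_le_pow_left₀ (by positivity) (half_le_self ?_) m)
    positivity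

lemma thick_Tkset_sdiff (T : Set (ℤ × (Fin m → ℤ))) (k : ℤ) :
    Thick (2 ^ (k + 1)) (Tkset T (k + 1) \ Tkset T k) := by
  rintro q ⟨hq, hq'⟩
  have h2 : (2 : ℝ) ^ (k + 1) = 2 ^ k * 2 := zpow_add_one₀ two_ne_zero k
  rw [mem_Tkset] at hq hq'
  refine ⟨dC (cubeAt k q), fun x hx => ?_,
    (dC_subset_closedBall (mem_dC_cubeAt k q)).trans (Metric.closedBall_subset_closedBall ?_), ?_⟩
  · have h := mem_dC_iff.1 hx
    refine ⟨mem_Tkset.2 ?_, fun hx' => hq' ?_⟩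
    · rwa [← cubeAt_congr (Int.le_add_one le_rfl) h]
    · rw [mem_Tkset] at hx'
      exact (show cubeAt k q = cubeAt k x from h) ▸ hx'
  · change (2 : ℝ) ^ k ≤ _
    rw [h2]
    exact le_mul_of_one_le_right (by positivity) one_le_two
  · rw [volume_dC, h2, mul_div_cancel_right₀ _ two_ne_zero]
    rfl

section Tree

variable {T : Set (ℤ × (Fin m → ℤ))} {Qt : ℤ × (Fin m → ℤ)}

lemma ConvexTree.scale_le (hT : ConvexTree T Qt) (hm : 1 ≤ m) {Q : ℤ × (Fin m → ℤ)} (hQ : Q ∈ T) :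
    Q.1 ≤ Qt.1 := by
  have h := measure_mono (μ := volume) (hT.2.1 Q hQ)
  rw [volume_dC, volume_dC, ENNReal.ofReal_le_ofReal_iff (by positivity),
    pow_le_pow_iff_left₀ (by positivity) (by positivity) (by omega)] at h
  exact (zpow_le_zpow_iff_right₀ one_lt_two).1 h

lemma ConvexTree.Tkset_eq_empty (hT : ConvexTree T Qt) (hm : 1 ≤ m) {k : ℤ} (hk : Qt.1 < k) :
    Tkset T k = ∅ := by
  refine Set.eq_empty_of_forall_notMem fun q hq => ?_
  exact hk.not_ge (hT.scale_le hm (mem_Tkset.1 hq))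

lemma ConvexTree.Tkset_subset (hT : ConvexTree T Qt) (k : ℤ) : Tkset T k ⊆ dC Qt :=
  fun _ hq => hT.2.1 _ (mem_Tkset.1 hq) (mem_dC_cubeAt _ _)

lemma ConvexTree.Tkset_top (hT : ConvexTree T Qt) : Tkset T Qt.1 = dC Qt := by
  refine (hT.Tkset_subset _).antisymm fun q hq => mem_Tkset.2 ?_
  rw [← mem_dC_iff.1 hq]
  exact hT.1

lemma ConvexTree.Tkset_mono (hT : ConvexTree T Qt) {k : ℤ} (hk : k < Qt.1) :
    Tkset T k ⊆ Tkset T (k + 1) := by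
  intro q hq
  have h1 := mem_dC_iff.1 (hT.Tkset_subset k hq)
  rw [mem_Tkset] at hq ⊢
  refine hT.2.2 _ hq _ (dC_cubeAt_subset (Int.le_add_one le_rfl) q) ?_
  conv_rhs => rw [h1]
  exact dC_cubeAt_subset hk q

lemma ConvexTree.exists_bound (hT : ConvexTree T Qt) (k : ℤ) :
    ∃ R, ∀ q ∈ Tkset T k, ‖q‖ ≤ R := by
  by_cases h : (Tkset T k).Nonempty
  · obtain ⟨q₀, hq₀⟩ := h
    refine ⟨2 ^ Qt.1 + ‖q₀‖, fun q hq => ?_⟩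
    have h1 := dC_subset_closedBall (hT.Tkset_subset k hq₀) (hT.Tkset_subset k hq)
    rw [Metric.mem_closedBall, dist_eq_norm] at h1
    linarith [norm_le_norm_sub_add q q₀]
  · rw [Set.not_nonempty_iff_eq_empty] at h
    exact ⟨0, fun q hq => absurd (h ▸ hq) (Set.notMem_empty q)⟩

end Tree

/-! ### Averages and the maximal function -/

lemma box_eq_Icc (a b : Fin m → ℝ) : box a b = Set.Icc a b := by
  ext x
  simp only [box, Set.mem_ofPred_eq, Set.mem_Icc, Pi.le_def, forall_and]

lemma volume_box_pos {a b : Fin m → ℝ} (h : ∀ i, a i < b i) : 0 < (volume (box a b)).toReal := by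
  rw [box_eq_Icc, Real.volume_Icc_pi_toReal fun i => (h i).le]
  exact Finset.prod_pos fun i _ => sub_pos.2 (h i)

lemma volume_box_ne_top (a b : Fin m → ℝ) : volume (box a b) ≠ ⊤ := by
  rw [box_eq_Icc]
  exact isCompact_Icc.measure_lt_top.ne

lemma exponent_eq (hm : 1 ≤ m) : (2 : ℝ) ^ ((1 : ℤ) - (m : ℤ)) = ((2 ^ (m - 1) : ℕ) : ℝ)⁻¹ := by
  have : (1 : ℤ) - (m : ℤ) = -((m - 1 : ℕ) : ℤ) := by omega
  rw [this, _root_.zpow_neg, zpow_natCast]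
  norm_num

lemma integrableOn_box_pow {F : (Fin m → ℝ) → ℝ} (hF : Measurable F) {B : ℝ} (hB : ∀ z, |F z| ≤ B)
    (p : ℕ) (a b : Fin m → ℝ) : IntegrableOn (fun x => |F x| ^ p) (box a b) := by
  refine Measure.integrableOn_of_bounded (M := B ^ p) (volume_box_ne_top a b)
    (by fun_prop) (Filter.Eventually.of_forall fun x => ?_)
  rw [Real.norm_eq_abs, abs_of_nonneg (by positivity)]
  exact pow_le_pow_left₀ (abs_nonneg _) (hB x) p

lemma avg_le_of_bounded (hm : 1 ≤ m) {F : (Fin m → ℝ) → ℝ} (hF : Measurable F) {B : ℝ}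
    (hB : ∀ z, |F z| ≤ B) {a b : Fin m → ℝ} (h : ∀ i, a i < b i) : avg (box a b) F ≤ B := by
  have hv := volume_box_pos h
  have hB0 : 0 ≤ B := (abs_nonneg _).trans (hB 0)
  have hp : (2 ^ (m - 1) : ℕ) ≠ 0 := by positivity
  have h0 : 0 ≤ ∫ x in box a b, |F x| ^ (2 ^ (m - 1) : ℕ) := integral_nonneg fun x => by positivity
  have h1 : ∫ x in box a b, |F x| ^ (2 ^ (m - 1) : ℕ) ≤
      (volume (box a b)).toReal * B ^ (2 ^ (m - 1) : ℕ) := by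
    have := setIntegral_mono (μ := volume) (integrableOn_box_pow hF hB (2 ^ (m - 1)) a b)
      (integrableOn_const (C := B ^ (2 ^ (m - 1) : ℕ)) (volume_box_ne_top a b))
      fun x => pow_le_pow_left₀ (abs_nonneg _) (hB x) _
    rwa [setIntegral_const, smul_eq_mul] at this
  rw [avg, exponent_eq hm, Real.rpow_inv_le_iff_of_pos (by positivity) hB0
    (by positivity), Real.rpow_natCast, inv_mul_le_iff₀ hv]
  exact h1

lemma ecc_mem_Icc (hm : 1 ≤ m) {a b : Fin m → ℝ} (h : ∀ i, a i < b i) :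
    0 ≤ ecc a b ∧ ecc a b ≤ 1 := by
  have : Nonempty (Fin m) := ⟨⟨0, hm⟩⟩
  have h0 : 0 ≤ ⨅ i, (b i - a i) := le_ciInf fun i => (sub_pos.2 (h i)).le
  have h1 : ⨅ i, (b i - a i) ≤ ⨆ i, (b i - a i) :=
    (ciInf_le (Set.finite_range _).bddBelow ⟨0, hm⟩).trans
      (le_ciSup (Set.finite_range fun i => b i - a i).bddAbove ⟨0, hm⟩)
  exact ⟨div_nonneg h0 (h0.trans h1), div_le_one_of_le₀ h1 (h0.trans h1)⟩

lemma MalTree_ne_top (hm : 1 ≤ m) {α : ℝ} (hα : 0 ≤ α) {F : (Fin m → ℝ) → ℝ} (hF : Measurable F)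
    {B : ℝ} (hB : ∀ z, |F z| ≤ B) (A : Matrix (Fin m) (Fin m) ℝ) (T : Set (ℤ × (Fin m → ℤ))) :
    MalTree α F A T ≠ ⊤ := by
  refine ne_top_of_le_ne_top (ENNReal.ofReal_ne_top (r := B)) ?_
  refine iSup₂_le fun Q _ => iSup_le fun a => iSup_le fun b => iSup_le fun h => iSup_le fun _ => ?_
  have he := ecc_mem_Icc hm h
  refine ENNReal.ofReal_le_ofReal ((mul_le_of_le_one_left ?_ ?_).trans
    (avg_le_of_bounded hm hF hB h))
  · exact Real.rpow_nonneg (mul_nonneg (inv_nonneg.2 ENNReal.toReal_nonneg)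
      (integral_nonneg fun x => by positivity)) _
  · exact Real.rpow_le_one (Real.rpow_nonneg he.1 _) (Real.rpow_le_one he.1 he.2 hα) (by positivity)

/-- The maximal function controls averages over balls meeting the image of the tree. -/
lemma lintegral_box_le_of_Mal_le (hm : 1 ≤ m) {α : ℝ} {F : (Fin m → ℝ) → ℝ} (hF : Measurable F)
    {B : ℝ} (hB : ∀ z, |F z| ≤ B) {S : Set (Fin m → ℝ)} {μ : ℝ} (hμ : 0 ≤ μ)
    (hM : Mal α F S ≤ ENNReal.ofReal μ) {z : Fin m → ℝ} {c : ℝ} (hc : 0 < c)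
    (hS : S ⊆ Metric.closedBall z c) :
    ∫⁻ y in Metric.closedBall z c, ‖F y‖ₑ ^ (2 ^ (m - 1) : ℕ) ≤
      ENNReal.ofReal ((2 * c) ^ m * μ ^ (2 ^ (m - 1) : ℕ)) := by
  have : Nonempty (Fin m) := ⟨⟨0, hm⟩⟩
  have hbox : box (fun i => z i - c) (fun i => z i + c) = Metric.closedBall z c := by
    ext x
    simp only [box, Set.mem_ofPred_eq, Metric.mem_closedBall, dist_pi_le_iff hc.le, Real.dist_eq,
      abs_le]
    refine forall_congr' fun i => and_congr ?_ ?_ <;> constructor <;> intro h <;> linarith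
  have hlt : ∀ i, z i - c < z i + c := fun i => by linarith
  have hecc : ecc (fun i => z i - c) (fun i => z i + c) = 1 := by
    have : ∀ i, z i + c - (z i - c) = 2 * c := fun i => by ring
    simp only [ecc, this, ciInf_const, ciSup_const]
    exact div_self (by positivity)
  have hv : (volume (Metric.closedBall z c)).toReal = (2 * c) ^ m := by
    rw [Real.volume_pi_closedBall _ hc.le, Fintype.card_fin, ENNReal.toReal_ofReal (by positivity)]
  have h1 : ENNReal.ofReal (avg (Metric.closedBall z c) F) ≤ ENNReal.ofReal μ := by
    refine le_trans ?_ hM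
    refine le_trans ?_ (le_iSup_of_le (fun i => z i - c) (le_iSup_of_le (fun i => z i + c)
      (le_iSup_of_le hlt (le_iSup_of_le (hbox ▸ hS) le_rfl))))
    rw [hecc, hbox, Real.one_rpow, Real.one_rpow, one_mul]
  have h2 := (ENNReal.ofReal_le_ofReal_iff hμ).1 h1
  have h0 : 0 ≤ ∫ x in Metric.closedBall z c, |F x| ^ (2 ^ (m - 1) : ℕ) :=
    integral_nonneg fun x => by positivity
  rw [avg, exponent_eq hm, hv, Real.rpow_inv_le_iff_of_pos (by positivity) hμ (by positivity),
    Real.rpow_natCast, inv_mul_le_iff₀ (by positivity)] at h2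
  have hinteg := integrableOn_box_pow hF hB (2 ^ (m - 1)) (fun i => z i - c) (fun i => z i + c)
  rw [hbox] at hinteg
  refine le_trans (le_of_eq ?_) (ENNReal.ofReal_le_ofReal h2)
  rw [ofReal_integral_eq_lintegral_ofReal hinteg
    (Filter.Eventually.of_forall fun x => by positivity)]
  refine lintegral_congr fun x => ?_
  rw [Real.enorm_eq_ofReal_abs, ENNReal.ofReal_pow (abs_nonneg _)]

/-- Functions dominated by the maximal function are normalised at all scales of the tree. -/
lemma normal_of_MalTree_le (hm : 1 ≤ m) {Δ α : ℝ} (hΔ : 0 ≤ Δ) {J : Matrix (Idx m) (Fin m) ℝ}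
    (hJ : ∀ k l, |J k l| ≤ Δ) {F : Corner m → (Fin m → ℝ) → ℝ} (hF : ∀ j, Measurable (F j)) {B : ℝ}
    (hB : ∀ j z, |F j z| ≤ B) {T : Set (ℤ × (Fin m → ℤ))} {μ : Corner m → ℝ} (hμ : ∀ j, 0 < μ j)
    (hM : ∀ j, MalTree α (F j) (Amat J j) T ≤ ENNReal.ofReal (μ j)) (k : ℤ) (j : Corner m)
    (z : Fin m → ℝ) :
    ∫⁻ y in Metric.closedBall z (2 ^ k),
      ‖loc J (fun j z => (μ j)⁻¹ * F j z) (Tkset T k) j y‖ₑ ^ (2 ^ (m - 1) : ℕ) ≤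
      ENNReal.ofReal ((2 * (1 + m * Δ) * 2 ^ k) ^ m) := by
  set p : ℕ := 2 ^ (m - 1) with hp
  have hp0 : p ≠ 0 := by positivity
  by_cases hne : (Metric.closedBall z (2 ^ k) ∩ (Amat J j).mulVec '' Tkset T k).Nonempty
  swap
  · rw [Set.not_nonempty_iff_eq_empty] at hne
    refine le_of_eq_of_le ?_ bot_le
    rw [ENNReal.bot_eq_zero]
    refine (setLIntegral_congr_fun Metric.isClosed_closedBall.measurableSet fun y hy => ?_).trans
      lintegral_zero
    have : y ∉ (Amat J j).mulVec '' Tkset T k := fun h => Set.notMem_empty y (hne ▸ ⟨hy, h⟩)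
    simp only [loc]
    rw [Set.indicator_of_notMem this, enorm_zero, zero_pow hp0]
  obtain ⟨_, hy, q, hq, rfl⟩ := hne
  have h2 : (0 : ℝ) < 2 ^ k := by positivity
  set c : ℝ := (1 + m * Δ) * 2 ^ k with hcdef
  have hc : 0 < c := by positivity
  have hS : (Amat J j).mulVec '' dC (cubeAt k q) ⊆ Metric.closedBall z c := by
    rintro _ ⟨x, hx, rfl⟩
    have h3 := dist_mulVec_le (Amat J j) hΔ (fun i l => hJ _ _) x q
    have h4 : dist x q ≤ 2 ^ k := dC_subset_closedBall (mem_dC_cubeAt k q) hx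
    have h5 : dist ((Amat J j).mulVec q) z ≤ 2 ^ k := hy
    rw [Metric.mem_closedBall]
    calc _ ≤ dist ((Amat J j).mulVec x) ((Amat J j).mulVec q) + dist ((Amat J j).mulVec q) z :=
          dist_triangle _ _ _
      _ ≤ m * Δ * 2 ^ k + 2 ^ k := add_le_add (h3.trans (by gcongr)) h5
      _ = c := by rw [hcdef]; ring
  have hMal : Mal α (F j) ((Amat J j).mulVec '' dC (cubeAt k q)) ≤ ENNReal.ofReal (μ j) :=
    (le_iSup₂_of_le (cubeAt k q) (mem_Tkset.1 hq) le_rfl).trans (hM j)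
  have key := lintegral_box_le_of_Mal_le hm (hF j) (hB j) (hμ j).le hMal hc hS
  calc _ ≤ ∫⁻ y in Metric.closedBall z c, ENNReal.ofReal ((μ j)⁻¹ ^ p) * ‖F j y‖ₑ ^ p := by
        refine (lintegral_mono_set (Metric.closedBall_subset_closedBall ?_)).trans
          (lintegral_mono fun y => ?_)
        · exact le_mul_of_one_le_left h2.le
            (by nlinarith [mul_nonneg (Nat.cast_nonneg (α := ℝ) m) hΔ])
        · have h6 : ‖loc J (fun j z => (μ j)⁻¹ * F j z) (Tkset T k) j y‖ₑ ≤ ‖(μ j)⁻¹ * F j y‖ₑ := by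
            unfold loc
            exact enorm_indicator_le_enorm_self _ _
          refine (pow_le_pow_left' h6 p).trans_eq ?_
          rw [enorm_mul, mul_pow, Real.enorm_eq_ofReal_abs (μ j)⁻¹, abs_of_pos (inv_pos.2 (hμ j)),
            ENNReal.ofReal_pow (inv_nonneg.2 (hμ j).le)]
    _ = ENNReal.ofReal ((μ j)⁻¹ ^ p) * ∫⁻ y in Metric.closedBall z c, ‖F j y‖ₑ ^ p :=
        lintegral_const_mul' _ _ ENNReal.ofReal_ne_top
    _ ≤ ENNReal.ofReal ((μ j)⁻¹ ^ p) * ENNReal.ofReal ((2 * c) ^ m * μ j ^ p) :=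
        mul_le_mul' le_rfl key
    _ = _ := by
        have := (hμ j).ne'
        rw [← ENNReal.ofReal_mul (by have := hμ j; positivity)]
        congr 1
        rw [inv_pow, mul_comm ((2 * c) ^ m), inv_mul_cancel_left₀ (pow_ne_zero _ this), hcdef]
        ring

/-! ### The kernel -/

lemma differentiable_phi (w : Idx m → ℝ) (β : Idx m → ℕ) : Differentiable ℝ (phi w β) := by
  have h : ∀ n, Differentiable ℝ (hn n) := fun n y => (hasDerivAt_hn n y).differentiableAt
  have h1 : ∀ k, Differentiable ℝ fun x : Idx m → ℝ => (w k)⁻¹ * hn (β k) (x k / w k) := fun k => by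
    have hk : Differentiable ℝ fun x : Idx m → ℝ => x k / w k := by fun_prop
    exact ((h (β k)).comp hk).const_mul _
  unfold phi
  exact fun x => (HasFDerivAt.finsetProd fun k _ => (h1 k x).hasFDerivAt).differentiableAt

lemma fderiv_phi_single (β : Idx m → ℕ) (k : Idx m) (x : Idx m → ℝ) :
    fderiv ℝ (phi (fun _ => 1) β) x (Pi.single k 1) = phi (fun _ => 1) (β + Pi.single k 1) x := by
  rw [← (differentiable_phi _ β x).lineDeriv_eq_fderiv]
  have h := hasDerivAt_phi_line (fun _ => 1) β x (Pi.single k 1)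
  have h' : HasLineDerivAt ℝ (phi (fun _ => 1) β) (phi (fun _ => 1) (β + Pi.single k 1) x) x
      (Pi.single k 1) := by
    refine h.congr_deriv ?_
    rw [Finset.sum_eq_single k]
    · simp
    · intro l _ hl
      simp [Pi.single_eq_of_ne hl]
    · exact fun h => absurd (Finset.mem_univ k) h
  exact h'.lineDeriv

lemma gss_eq_phi : (gss : (Idx m → ℝ) → ℝ) = phi (fun _ => 1) 0 := by
  funext x
  simp only [gss, phi, inv_one, one_mul, div_one, Pi.zero_apply, hn_zero]
  rw [← Real.exp_sum, Finset.mul_sum]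

lemma ddg_eq_phi (i : Fin m) : ddg i = phi (fun _ => 1) (pairB i) := by
  funext x
  simp only [ddg, gss_eq_phi, fderiv_phi_single]
  rw [zero_add, pairB_eq]
  rfl

lemma dilM_ddg (i : Fin m) {d : Fin m → ℝ} (hd : ∀ h, 0 < d h) {t : ℝ} (ht : 0 < t)
    (x : Idx m → ℝ) :
    dilM (t • Matrix.diagonal (Sum.elim d d)) (ddg i) x = phi (wid d t) (pairB i) x := by
  have hD : t • Matrix.diagonal (Sum.elim d d) = Matrix.diagonal (wid d t) := by
    rw [← Matrix.diagonal_smul]; rfl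
  have hw := wid_pos hd ht
  have hinv : (Matrix.diagonal (wid d t))⁻¹ = Matrix.diagonal fun k => (wid d t k)⁻¹ := by
    refine Matrix.inv_eq_right_inv ?_
    rw [Matrix.diagonal_mul_diagonal, ← Matrix.diagonal_one]
    congr 1
    funext k
    exact mul_inv_cancel₀ (hw k).ne'
  rw [dilM, hD, Matrix.det_diagonal, hinv, ddg_eq_phi, phi, phi, ← Finset.prod_inv_distrib,
    ← Finset.prod_mul_distrib]
  refine Finset.prod_congr rfl fun k _ => ?_
  rw [Matrix.mulVec_diagonal, inv_one, one_mul, div_one, div_eq_inv_mul]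

lemma lam_const_mul (c : Corner m → ℝ) (f : Corner m → (Fin m → ℝ) → ℝ)
    (J : Matrix (Idx m) (Fin m) ℝ) (w : Idx m → ℝ) (β : Idx m → ℕ) :
    lam (fun j z => c j * f j z) J w β = (∏ j, c j) * lam f J w β := by
  unfold lam
  rw [← integral_const_mul]
  refine integral_congr_ae (Filter.Eventually.of_forall fun x => ?_)
  simp only [Hprod, Finset.prod_mul_distrib, mul_assoc]

lemma loc_const_mul (c : Corner m → ℝ) (J : Matrix (Idx m) (Fin m) ℝ)
    (F : Corner m → (Fin m → ℝ) → ℝ) (E : Set (Fin m → ℝ)) :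
    loc J (fun j z => c j * F j z) E = fun j z => c j * loc J F E j z := by
  funext j z
  unfold loc
  exact Set.indicator_const_mul _ _ _ _

/-- Interchanging the integrations in `x` and in the scale `t`. -/
lemma integral_Hprod_mul_integral {f : Corner m → (Fin m → ℝ) → ℝ} (hf : Nice f)
    {J : Matrix (Idx m) (Fin m) ℝ} (hdet : (Amat J fun _ => 1).det ≠ 0) {d : Fin m → ℝ}
    (hd : ∀ h, 0 < d h) (S : Finset (Fin m)) {a b : ℝ} (ha : 0 < a) :
    ∫ x, Hprod f x * ∫ t in Set.Ioc a b,
      (∑ i ∈ S, ∫ p, phi (wid d t) (pairB i) (x + J.mulVec p)) * t⁻¹ =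
    ∑ i ∈ S, ∫ t in Set.Ioc a b, t⁻¹ * lam f J (wid d t) (pairB i) := by
  obtain ⟨c, hc0, hcw⟩ := exists_width_bound (wid_pos hd one_pos)
  have haW : ∀ᵐ t ∂volume.restrict (Set.Ioc a b), ∀ k, a * c ≤ wid d t k := by
    filter_upwards [ae_restrict_mem measurableSet_Ioc] with t ht k
    have h1 := hcw k
    simp only [wid, one_mul] at h1 ⊢
    exact mul_le_mul ht.1.le h1 hc0.le (ha.trans ht.1).le
  have hinv : ∀ᵐ t ∂volume.restrict (Set.Ioc a b), ‖t⁻¹‖ ≤ a⁻¹ := by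
    filter_upwards [ae_restrict_mem measurableSet_Ioc] with t ht
    rw [Real.norm_eq_abs, abs_of_pos (inv_pos.2 (ha.trans ht.1))]
    exact inv_anti₀ ha ht.1.le
  have hI : ∀ i, Integrable (fun q : ℝ × (Idx m → ℝ) =>
      q.1⁻¹ * (Hprod f q.2 * ∫ p, phi (wid d q.1) (pairB i) (q.2 + J.mulVec p)))
      ((volume.restrict (Set.Ioc a b)).prod volume) := by
    intro i
    have h1 := integrable_param hf hdet (pairB i) (ν := volume.restrict (Set.Ioc a b))
      (measurable_wid d) (mul_pos ha hc0) haW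
    have h2 := (measurePreserving_prodAssoc (volume.restrict (Set.Ioc a b))
      (volume : Measure (Idx m → ℝ))
      (volume : Measure (Fin m → ℝ))).integrable_comp_of_integrable h1
    have h3 := h2.integral_prod_left
    change Integrable (fun q : ℝ × (Idx m → ℝ) => ∫ p, Hprod f q.2 *
      phi (wid d q.1) (pairB i) (q.2 + J.mulVec p)) _ at h3
    simp only [integral_const_mul] at h3
    refine h3.bdd_mul (c := a⁻¹) (by fun_prop) ?_
    exact Measure.quasiMeasurePreserving_fst.ae hinv
  have e1 : ∀ x, Hprod f x * ∫ t in Set.Ioc a b,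
      (∑ i ∈ S, ∫ p, phi (wid d t) (pairB i) (x + J.mulVec p)) * t⁻¹ =
      ∫ t in Set.Ioc a b, ∑ i ∈ S,
        t⁻¹ * (Hprod f x * ∫ p, phi (wid d t) (pairB i) (x + J.mulVec p)) := by
    intro x
    rw [← integral_const_mul]
    refine integral_congr_ae (Filter.Eventually.of_forall fun t => ?_)
    simp only [Finset.sum_mul, Finset.mul_sum]
    exact Finset.sum_congr rfl fun i _ => by ring
  simp_rw [e1]
  rw [integral_integral_swap]
  swap
  · exact (integrable_finsetSum S fun i _ => hI i).swap
  rw [← integral_finsetSum]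
  swap
  · intro i _
    have := (hI i).integral_prod_left
    simpa only [integral_const_mul, lam] using this
  refine setIntegral_congr_fun measurableSet_Ioc fun t ht => ?_
  change ∫ x, ∑ i ∈ S, t⁻¹ * (Hprod f x * ∫ p, phi (wid d t) (pairB i) (x + J.mulVec p)) =
    ∑ i ∈ S, t⁻¹ * lam f J (wid d t) (pairB i)
  rw [integral_finsetSum]
  · exact Finset.sum_congr rfl fun i _ => integral_const_mul _ _
  · exact fun i _ => (integrable_lam hf hdet (pairB i) (wid_pos hd (ha.trans ht.1))).const_mul _

/-- The contribution of one scale to the form. -/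
lemma enorm_LambdaK_term_le {f : Corner m → (Fin m → ℝ) → ℝ} (hf : Nice f)
    {J : Matrix (Idx m) (Fin m) ℝ} (hdet : (Amat J fun _ => 1).det ≠ 0) {d : Fin m → ℝ}
    (hd : ∀ h, 0 < d h) (P : Fin m → Prop) [DecidablePred P] {a b : ℝ} (ha : 0 < a) :
    ‖∫ x : Idx m → ℝ, Complex.ofReal (∏ j, f j (proj j x)) * ∫ t in Set.Ioc a b,
      Complex.ofReal (∑ i : Fin m, if P i then
        ∫ p : Fin m → ℝ, dilM (t • Matrix.diagonal (Sum.elim d d)) (ddg i) (x + J.mulVec p)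
        else 0) * (t : ℂ)⁻¹‖ₑ ≤
    ∑ i ∈ Finset.univ.filter P, ∫⁻ t in Set.Ioc a b,
      ENNReal.ofReal |lam f J (wid d t) (pairB i)| * ENNReal.ofReal t⁻¹ := by
  have e1 : ∀ x : Idx m → ℝ, Complex.ofReal (∏ j, f j (proj j x)) * ∫ t in Set.Ioc a b,
      Complex.ofReal (∑ i : Fin m, if P i then
        ∫ p : Fin m → ℝ, dilM (t • Matrix.diagonal (Sum.elim d d)) (ddg i) (x + J.mulVec p)
        else 0) * (t : ℂ)⁻¹ = Complex.ofReal (Hprod f x * ∫ t in Set.Ioc a b,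
      (∑ i ∈ Finset.univ.filter P, ∫ p, phi (wid d t) (pairB i) (x + J.mulVec p)) * t⁻¹) := by
    intro x
    rw [Complex.ofReal_mul, ← integral_complex_ofReal]
    congr 1
    refine setIntegral_congr_fun measurableSet_Ioc fun t ht => ?_
    simp only [dilM_ddg _ hd (ha.trans ht.1), Finset.sum_filter, Complex.ofReal_mul,
      Complex.ofReal_inv]
  simp_rw [e1]
  rw [integral_complex_ofReal, integral_Hprod_mul_integral hf hdet hd _ ha, ← ofReal_norm,
      Complex.norm_real,
    ofReal_norm]
  refine (enorm_sum_le _ _).trans (Finset.sum_le_sum fun i _ => ?_)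
  refine (enorm_integral_le_lintegral_enorm _).trans
    (setLIntegral_mono' measurableSet_Ioc fun t ht => le_of_eq ?_)
  rw [enorm_mul, Real.enorm_eq_ofReal_abs, Real.enorm_eq_ofReal_abs,
    abs_of_pos (inv_pos.2 (ha.trans ht.1)), mul_comm]

/-! ### Trees as configurations -/

lemma abs_entry_le_opNorm (A : Matrix (Fin m) (Fin m) ℝ) (i k : Fin m) : |A i k| ≤ opNorm A := by
  have h1 := (LinearMap.toContinuousLinearMap (Matrix.toEuclideanLin A)).le_opNorm
    (EuclideanSpace.single k (1 : ℝ))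
  rw [PiLp.norm_single, norm_one, mul_one] at h1
  have h2 := (PiLp.norm_apply_le _ i).trans h1
  have h3 : (LinearMap.toContinuousLinearMap (Matrix.toEuclideanLin A)
      (EuclideanSpace.single k (1 : ℝ))).ofLp i = A i k := by
    change (A *ᵥ Pi.single k 1) i = A i k
    rw [Matrix.mulVec_single_one]
    rfl
  rw [h3] at h2
  exact h2

lemma abs_entry_le_of_isReg {Δ : ℝ} {J : Matrix (Idx m) (Fin m) ℝ}
    (hJ : ∀ j : Corner m, IsReg Δ (Amat J j)) (k : Idx m) (l : Fin m) : |J k l| ≤ Δ := by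
  obtain ⟨h, c, rfl⟩ := exists_slot k
  exact (abs_entry_le_opNorm (Amat J fun _ => c) h l).trans (hJ _).1

lemma update_eq_or_eq_istar (j : Corner m) (h : Fin m) (c : Fin 2) :
    Function.update j h c = j ∨ Function.update j h c = istar h j := by
  by_cases hc : c = j h
  · exact Or.inl (by rw [hc, Function.update_eq_self])
  · refine Or.inr (funext fun k => ?_)
    by_cases hk : k = h
    · subst hk
      simp only [Function.update_self, istar, if_true]
      revert hc
      generalize j k = c'
      revert c c'
      decide
    · simp [istar, hk]

lemma Amat_update {J : Matrix (Idx m) (Fin m) ℝ} {h : Fin m}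
    (hJ : ∀ c c', J (slot h c) = J (slot h c')) (j : Corner m) (c : Fin 2) :
    Amat J (Function.update j h c) = Amat J j := by
  ext i k
  by_cases hi : i = h
  · subst hi
    exact congrFun (hJ _ _) k
  · simp [Amat, sel, hi]

/-- The localisations of a convex tree, after normalisation of the functions, form a
configuration. -/
lemma ConvexTree.isConfig (hm : 1 ≤ m) {Δ α : ℝ} (hΔ : 1 ≤ Δ) {S : Finset (Fin m)}
    {J : Matrix (Idx m) (Fin m) ℝ} (hJ : ∀ j : Corner m, IsReg Δ (Amat J j))
    (hS : ∀ h ∈ S, ∀ c c', J (slot h c) = J (slot h c'))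
    {T : Set (ℤ × (Fin m → ℤ))} {Qt : ℤ × (Fin m → ℤ)} (hT : ConvexTree T Qt)
    {F : Corner m → (Fin m → ℝ) → ℝ} (hF : ∀ j, Measurable (F j)) {B : ℝ}
    (hB : ∀ j z, |F j z| ≤ B) (hFS : ∀ h ∈ S, ∀ j c, F (Function.update j h c) = F j)
    {μ : Corner m → ℝ} (hμ : ∀ j, 0 < μ j)
    (hμS : ∀ h ∈ S, ∀ j c, μ (Function.update j h c) = μ j)
    (hM : ∀ j, MalTree α (F j) (Amat J j) T ≤ ENNReal.ofReal (μ j)) (N : ℕ) :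
    IsConfig Δ (2 * (1 + m * Δ)) S J (fun j z => (μ j)⁻¹ * F j z)
      (fun n => Tkset T (Qt.1 - N + n)) (2 ^ (Qt.1 - N)) N := by
  have hΔ0 : 0 ≤ Δ := zero_le_one.trans hΔ
  have hpow : ∀ n : ℕ, (2 : ℝ) ^ (Qt.1 - (N : ℤ)) * 2 ^ n = 2 ^ (Qt.1 - (N : ℤ) + n) := fun n => by
    rw [zpow_add₀ two_ne_zero, zpow_natCast]
  have hsucc : ∀ n : ℕ, Qt.1 - (N : ℤ) + ((n + 1 : ℕ) : ℤ) = Qt.1 - (N : ℤ) + n + 1 := fun n => by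
    push_cast; ring
  refine ⟨hΔ, abs_entry_le_of_isReg hJ, fun j => (hJ j).2.1, fun j => (hJ j).2.2, hS,
    fun j => (hF j).const_mul _, ⟨∑ j, (μ j)⁻¹ * B, fun j z => ?_⟩, fun h hh j c => ?_,
    fun n => measurableSet_Tkset T _, fun n => hT.exists_bound _, fun n hn' => ?_, by positivity,
    fun n => ?_, fun n => ?_, fun n j z => ?_⟩
  · have hB0 : 0 ≤ B := (abs_nonneg _).trans (hB j z)
    rw [abs_mul, abs_of_pos (inv_pos.2 (hμ j))]
    refine (mul_le_mul_of_nonneg_left (hB j z) (inv_pos.2 (hμ j)).le).trans ?_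
    exact Finset.single_le_sum (f := fun j => (μ j)⁻¹ * B)
      (fun i _ => mul_nonneg (inv_pos.2 (hμ i)).le hB0) (Finset.mem_univ j)
  · simp only [hFS h hh, hμS h hh]
  · simp only [hsucc]
    exact hT.Tkset_mono (by omega)
  · rw [hpow]
    exact thick_Tkset T _
  · rw [hpow, hsucc]
    exact thick_Tkset_sdiff T _
  · rw [hpow]
    exact normal_of_MalTree_le hm hΔ0 (abs_entry_le_of_isReg hJ) hF hB hμ hM _ j z

lemma tsum_le_of_sum_range_le {f : ℤ → ℝ≥0∞} {a : ℤ} {B : ℝ≥0∞} (h0 : ∀ k, a < k → f k = 0)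
    (h : ∀ N : ℕ, ∑ n ∈ Finset.range (N + 1), f (a - N + n) ≤ B) : ∑' k, f k ≤ B := by
  rw [ENNReal.tsum_eq_iSup_sum]
  refine iSup_le fun s => ?_
  set N : ℕ := s.sup fun k => (a - k).toNat
  refine le_trans ?_ (h N)
  have hinj : Set.InjOn (fun n : ℕ => a - N + n) (Finset.range (N + 1)) := by
    intro x _ y _ hxy
    simpa using hxy
  rw [← Finset.sum_image (f := f) hinj]
  refine Finset.sum_le_sum_of_ne_zero fun k hk hne => ?_
  have hka : k ≤ a := not_lt.1 fun hlt => hne (h0 k hlt)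
  have hN : (a - k).toNat ≤ N := Finset.le_sup (f := fun k => (a - k).toNat) hk
  rw [Finset.mem_image]
  exact ⟨(k - (a - N)).toNat, Finset.mem_range.2 (by omega), by omega⟩

lemma bd_le_prod_max {d : Fin m → ℝ} (hd : ∀ h, 0 < d h) {α : ℝ} (hα : 0 ≤ α) :
    bd d ≤ ∏ h, max (d h ^ (2 * α)) (d h ^ (-2 : ℝ)) := by
  refine Finset.prod_le_prod (fun h _ => by positivity) fun h _ => ?_
  have h2 : d h ^ (-2 : ℝ) = ((d h)⁻¹) ^ 2 := by
    rw [Real.rpow_neg (hd h).le, inv_pow]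
    norm_cast
  rcases le_total 1 (d h) with h1 | h1
  · rw [max_eq_left (inv_le_one_of_one_le₀ h1), one_pow]
    exact le_max_of_le_left (Real.one_le_rpow h1 (by positivity))
  · rw [max_eq_right ((one_le_inv₀ (hd h)).2 h1), ← h2]
    exact le_max_right _ _

lemma exists_good {l : ℕ} (hl : 0 < l) (hlm : l ≤ m) {d : Fin m → ℝ} (hd : ∀ h, 0 < d h)
    (hle : ∀ h i : Fin m, (h : ℕ) < l → l ≤ (i : ℕ) → d h ≤ d i)
    (heq : ∀ i i' : Fin m, l ≤ (i : ℕ) → l ≤ (i' : ℕ) → d i = d i') :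
    ∃ e, Good (Finset.univ.filter fun i : Fin m => (i : ℕ) < l) d e := by
  rcases hlm.lt_or_eq with h | h
  · refine ⟨d ⟨l, h⟩, hd, hd _, fun i hi => ?_, fun i hi => ?_⟩
    · exact hle _ _ (Finset.mem_filter.1 hi).2 le_rfl
    · exact heq _ _ (by simpa using hi) le_rfl
  · refine ⟨∑ i, d i, hd, ?_, fun i _ => ?_, fun i hi => ?_⟩
    · exact Finset.sum_pos (fun i _ => hd i) ⟨⟨0, by omega⟩, Finset.mem_univ _⟩
    · exact Finset.single_le_sum (fun i _ => (hd i).le) (Finset.mem_univ i)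
    · exact absurd (Finset.mem_filter.2 ⟨Finset.mem_univ i, by omega⟩) hi

lemma nrm_lamC_const_mul (c : Corner m → ℝ) (J : Matrix (Idx m) (Fin m) ℝ)
    (F : Corner m → (Fin m → ℝ) → ℝ) (E : ℕ → Set (Fin m → ℝ)) (d : Fin m → ℝ) (β : Idx m → ℕ)
    (ρ : ℝ) (N : ℕ) :
    nrm ρ N (lamC J (fun j z => c j * F j z) E d β) =
      ENNReal.ofReal |∏ j, c j| * nrm ρ N (lamC J F E d β) := by
  unfold nrm
  rw [Finset.mul_sum]
  refine Finset.sum_congr rfl fun n _ => ?_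
  rw [← lintegral_const_mul' _ _ ENNReal.ofReal_ne_top]
  simp only [lamC, loc_const_mul, lam_const_mul, abs_mul, ENNReal.ofReal_mul (abs_nonneg _),
    mul_assoc]

/-- The form of a convex tree is controlled by the norms of the single-direction forms. -/
lemma ConvexTree.enorm_LambdaK_le (hm : 1 ≤ m) {Δ : ℝ} (hΔ : 1 ≤ Δ)
    {J : Matrix (Idx m) (Fin m) ℝ} (hJ : ∀ j : Corner m, IsReg Δ (Amat J j))
    {T : Set (ℤ × (Fin m → ℤ))} {Qt : ℤ × (Fin m → ℤ)} (hT : ConvexTree T Qt)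
    {F : Corner m → (Fin m → ℝ) → ℝ} (hF : ∀ j, Measurable (F j)) (hB : ∃ B, ∀ j z, |F j z| ≤ B)
    {d : Fin m → ℝ} (hd : ∀ h, 0 < d h) (P : Fin m → Prop) [DecidablePred P] {A : ℝ≥0∞}
    (hA : ∀ N : ℕ, ∑ i ∈ Finset.univ.filter P,
      nrm (2 ^ (Qt.1 - N)) N (lamC J F (fun n => Tkset T (Qt.1 - N + n)) d (pairB i)) ≤ A) :
    ‖LambdaK J T (fun t x => Complex.ofReal (∑ i : Fin m, if P i then
      ∫ p : Fin m → ℝ, dilM (t • Matrix.diagonal (Sum.elim d d)) (ddg i) (x + J.mulVec p)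
      else 0)) F‖ₑ ≤ A := by
  refine enorm_tsum_le_tsum_enorm.trans
    (tsum_le_of_sum_range_le (a := Qt.1) (fun k hk => ?_) fun N => le_trans ?_ (hA N))
  · rw [enorm_eq_zero]
    refine integral_eq_zero_of_ae (Filter.Eventually.of_forall fun x => ?_)
    have h0 : ∏ j, ((Amat J j).mulVec '' Tkset T k).indicator (F j) (proj j x) = 0 :=
      Finset.prod_eq_zero (Finset.mem_univ fun _ => 0) (by simp [hT.Tkset_eq_empty hm hk])
    simp only [h0, Complex.ofReal_zero, zero_mul, Pi.zero_apply]
  · unfold nrm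
    rw [Finset.sum_comm]
    refine Finset.sum_le_sum fun n _ => ?_
    have hpow : (2 : ℝ) ^ (Qt.1 - (N : ℤ)) * 2 ^ n = 2 ^ (Qt.1 - (N : ℤ) + n) := by
      rw [zpow_add₀ two_ne_zero, zpow_natCast]
    have hhalf : (2 : ℝ) ^ (Qt.1 - (N : ℤ) + n - 1) = 2 ^ (Qt.1 - (N : ℤ) + n) / 2 := by
      rw [zpow_sub_one₀ two_ne_zero, div_eq_mul_inv]
    rw [hpow, hhalf]
    exact enorm_LambdaK_term_le (nice_loc (zero_le_one.trans hΔ) (fun j => (hJ j).2.1)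
      (abs_entry_le_of_isReg hJ) hF hB (measurableSet_Tkset T _) (hT.exists_bound _))
      (hJ _).2.1 hd P
      (by positivity)

end Forms

end SBL

namespace SBL

/-- Induction proposition, bound for the third kernel
`K(t,x) = ∑_{i=1}^{l} ∫ (∂⁰_i∂¹_i g)_{tD}(x + Jp) dp`, for `0 < l ≤ m`. -/
theorem statement17 (m l : ℕ) (hm : 2 ≤ m) (hl0 : 0 < l) (hlm : l ≤ m)
    (Δ α : ℝ) (hΔ : 1 < Δ) (hα0 : 0 < α) (hα : α < 1 / m) :
    ∃ C : ℝ≥0, ∀ J : Matrix (Idx m) (Fin m) ℝ,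
      (∀ j : Corner m, IsReg Δ (Amat J j)) →
      (∀ h : Fin m, (h:ℕ) < l → ∀ k, J (Sum.inl h) k = J (Sum.inr h) k) →
      ∀ (T : Set (ℤ × (Fin m → ℤ))) (Qt : ℤ × (Fin m → ℤ)), ConvexTree T Qt →
      ∀ d : Fin m → ℝ, (∀ h, 0 < d h) →
      (∀ h i : Fin m, (h:ℕ) < l → l ≤ (i:ℕ) → d h ≤ d i) →
      (∀ i i' : Fin m, l ≤ (i:ℕ) → l ≤ (i':ℕ) → d i = d i') →
      ∀ F : Corner m → (Fin m → ℝ) → ℝ,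
        (∀ j, ContDiff ℝ (⊤ : ℕ∞) (F j) ∧ HasCompactSupport (F j)) →
        (∀ j : Corner m, ∀ i : Fin m, (i:ℕ) < l → F j = F (istar i j)) →
        ENNReal.ofReal ‖LambdaK J T
            (fun t x => Complex.ofReal (∑ i : Fin m, if (i:ℕ) < l then
              ∫ p : Fin m → ℝ, dilM (t • Matrix.diagonal (Sum.elim d d)) (ddg i)
                (x + J.mulVec p)
              else 0)) F‖ ≤
          C * ENNReal.ofReal (∏ h : Fin m, max (d h ^ (2*α)) (d h ^ (-2 : ℝ))) *
            volume (dC Qt) * ∏ j : Corner m, MalTree α (F j) (Amat J j) T := by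
  have hm1 : 1 ≤ m := by omega
  set S : Finset (Fin m) := Finset.univ.filter fun i : Fin m => (i : ℕ) < l with hS
  have hK : 0 ≤ 2 * (1 + (m : ℝ) * Δ) := by positivity
  choose C hCb using pairBounded hm1 hΔ.le hK S
  refine ⟨∑ i ∈ S.attach, C i.1 i.2, ?_⟩
  intro J hJ hJS T Qt hT d hd hle heq F hF hFS
  obtain ⟨e, he⟩ := exists_good hl0 hlm hd hle heq
  have hmeas : ∀ j, Measurable (F j) := fun j => (hF j).1.continuous.measurable
  have hbdd : ∀ j, ∃ B, ∀ z, |F j z| ≤ B := fun j =>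
    (hF j).2.exists_bound_of_continuous (hF j).1.continuous
  choose b hb using hbdd
  have hB : ∀ j z, |F j z| ≤ ∑ j, |b j| := fun j z => (hb j z).trans <| (le_abs_self _).trans <|
    Finset.single_le_sum (f := fun j => |b j|) (fun _ _ => abs_nonneg _) (Finset.mem_univ j)
  have hSlot : ∀ h ∈ S, ∀ c c', J (slot h c) = J (slot h c') := by
    intro h hh
    have h1 : J (Sum.inl h) = J (Sum.inr h) := funext (hJS h (Finset.mem_filter.1 hh).2)
    have h2 : ∀ c, J (slot h c) = J (Sum.inl h) := fun c => by
      unfold slot; split_ifs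
      exacts [rfl, h1.symm]
    exact fun c c' => (h2 c).trans (h2 c').symm
  have hFu : ∀ h ∈ S, ∀ j c, F (Function.update j h c) = F j := by
    intro h hh j c
    rcases update_eq_or_eq_istar j h c with h1 | h1 <;> rw [h1]
    exact (hFS j h (Finset.mem_filter.1 hh).2).symm
  set M : Corner m → ℝ≥0∞ := fun j => MalTree α (F j) (Amat J j) T with hM
  have hMt : ∀ j, M j ≠ ⊤ := fun j => MalTree_ne_top hm1 hα0.le (hmeas j) (hB j) _ _
  have hMu : ∀ h ∈ S, ∀ j c, M (Function.update j h c) = M j := fun h hh j c => by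
    simp only [hM, hFu h hh, Amat_update (hSlot h hh)]
  rw [ofReal_norm]
  have key : ∀ ε : ℝ, 0 < ε → ‖LambdaK J T
      (fun t x => Complex.ofReal (∑ i : Fin m, if (i:ℕ) < l then
        ∫ p : Fin m → ℝ, dilM (t • Matrix.diagonal (Sum.elim d d)) (ddg i) (x + J.mulVec p)
        else 0)) F‖ₑ ≤ ((∑ i ∈ S.attach, C i.1 i.2 : ℝ≥0) : ℝ≥0∞) * ENNReal.ofReal (bd d) *
          volume (dC Qt) * ∏ j, ENNReal.ofReal ((M j).toReal + ε) := by
    intro ε hε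
    set μ : Corner m → ℝ := fun j => (M j).toReal + ε with hμ
    have hμ0 : ∀ j, 0 < μ j := fun j => add_pos_of_nonneg_of_pos ENNReal.toReal_nonneg hε
    have hμM : ∀ j, MalTree α (F j) (Amat J j) T ≤ ENNReal.ofReal (μ j) := fun j =>
      (ENNReal.ofReal_toReal (hMt j)).symm.le.trans
        (ENNReal.ofReal_le_ofReal (le_add_of_nonneg_right hε.le))
    refine hT.enorm_LambdaK_le hm1 hΔ.le hJ hmeas ⟨_, hB⟩ hd (fun i : Fin m => (i : ℕ) < l)
      fun N => ?_
    have hcfg := hT.isConfig hm1 hΔ.le hJ hSlot hmeas hB hFu hμ0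
      (fun h hh j c => by simp only [hμ, hMu h hh]) hμM N
    have hFe : F = fun j z => μ j * ((μ j)⁻¹ * F j z) := by
      funext j z
      rw [mul_inv_cancel_left₀ (hμ0 j).ne']
    have hterm : ∀ i (hi : i ∈ S), nrm (2 ^ (Qt.1 - (N : ℤ))) N
        (lamC J F (fun n => Tkset T (Qt.1 - N + n)) d (pairB i)) ≤
        (∏ j, ENNReal.ofReal (μ j)) * (C i hi * ENNReal.ofReal (bd d) * volume (dC Qt)) := by
      intro i hi
      have h1 := hCb i hi _ _ _ _ _ hcfg d e he
      simp only [sub_add_cancel, hT.Tkset_top] at h1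
      conv_lhs => rw [hFe]
      rw [nrm_lamC_const_mul, abs_of_pos (Finset.prod_pos fun j _ => hμ0 j),
        ENNReal.ofReal_prod_of_nonneg fun j _ => (hμ0 j).le]
      exact mul_le_mul' le_rfl h1
    rw [← Finset.sum_attach]
    refine (Finset.sum_le_sum fun i _ => hterm i.1 i.2).trans (le_of_eq ?_)
    rw [← Finset.mul_sum, ← Finset.sum_mul, ← Finset.sum_mul, ENNReal.ofNNReal_finsetSum, mul_comm]
  have hbd := ENNReal.ofReal_le_ofReal (bd_le_prod_max hd hα0.le)
  refine le_trans ?_ (mul_le_mul' (mul_le_mul' (mul_le_mul' le_rfl hbd) le_rfl) le_rfl)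
  have hvol : volume (dC Qt) ≠ ⊤ := by
    rw [volume_dC]
    finiteness
  have hlim : Filter.Tendsto (fun ε : ℝ => ((∑ i ∈ S.attach, C i.1 i.2 : ℝ≥0) : ℝ≥0∞) *
      ENNReal.ofReal (bd d) * volume (dC Qt) * ∏ j, ENNReal.ofReal ((M j).toReal + ε))
      (nhdsWithin 0 (Set.Ioi 0)) (nhds (((∑ i ∈ S.attach, C i.1 i.2 : ℝ≥0) : ℝ≥0∞) *
      ENNReal.ofReal (bd d) * volume (dC Qt) * ∏ j, M j)) := by
    refine ENNReal.Tendsto.const_mul (ENNReal.tendsto_finsetProd_of_ne_top _ (fun j _ => ?_)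
      fun j _ => hMt j) (Or.inr (by finiteness))
    have h1 : Continuous fun ε : ℝ => ENNReal.ofReal ((M j).toReal + ε) :=
      ENNReal.continuous_ofReal.comp (by fun_prop)
    have h2 := (h1.tendsto 0).mono_left (nhdsWithin_le_nhds (s := Set.Ioi 0))
    rwa [add_zero, ENNReal.ofReal_toReal (hMt j)] at h2
  exact ge_of_tendsto hlim (eventually_nhdsWithin_of_forall key)

end SBL
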